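/- Let f : M → N be a proper morphism of complex manifolds (or a proper morphism of schemes). If the natural map O_N → f_*O_M of sheaves is surjective, then every fiber of f is connected. -/

import Mathlib

open AlgebraicGeometry

namespace GradedCech

open Filter

section RelativeFiniteness

variable {A V W : Type*} [CommRing A] [AddCommGroup V] [Module A V] [AddCommGroup W] [Module A W]

/-- `P` is finitely generated modulo `Q`. -/
def RelFG (P Q : Submodule A V) : Prop := (P.map Q.mkQ).FG

lemma exists_fg_le_map_eq {P : Submodule A V} {F : V →ₗ[A] W} (h : (P.map F).FG) :
    ∃ P₁ ≤ P, P₁.FG ∧ P₁.map F = P.map F := by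
  obtain ⟨s, hs⟩ := h
  have hs' : (s : Set W) ⊆ F '' P := by
    rw [← Submodule.map_coe, ← hs]; exact Submodule.subset_span
  classical
  obtain ⟨t, ht, hts⟩ := Finset.subset_set_image_iff.mp hs'
  refine ⟨Submodule.span A t, Submodule.span_le.mpr ht, ⟨t, rfl⟩, ?_⟩
  rw [Submodule.map_span, ← hs, ← hts, Finset.coe_image]

lemma RelFG.of_map_of_ker {P Q : Submodule A V} {F : V →ₗ[A] W} (h : (P.map F).FG)
    (hK : RelFG (P ⊓ LinearMap.ker F) Q) : RelFG P Q := by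
  obtain ⟨P₁, hle, hfg, heq⟩ := exists_fg_le_map_eq h
  have : P = P₁ ⊔ (P ⊓ LinearMap.ker F) := by
    refine le_antisymm (fun v hv ↦ ?_) (sup_le hle inf_le_left)
    have : F v ∈ P₁.map F := heq ▸ Submodule.mem_map_of_mem hv
    obtain ⟨w, hw, hwv⟩ := this
    refine Submodule.mem_sup.mpr ⟨w, hw, v - w, ⟨sub_mem hv (hle hw), ?_⟩, by abel⟩
    simp [hwv]
  rw [RelFG, this, Submodule.map_sup]
  exact (hfg.map _).sup hK

lemma RelFG.of_le [IsNoetherianRing A] {P Q : Submodule A V} {P' Q' : Submodule A W}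
    (h : RelFG P' Q') (T : W →ₗ[A] V) (hQ : Q'.map T ≤ Q) (hP : P ≤ P'.map T ⊔ Q) :
    RelFG P Q := by
  have h1 : P.map Q.mkQ ≤
      (P'.map Q'.mkQ).map (Q'.mapQ Q T (Submodule.map_le_iff_le_comap.mp hQ)) := by
    rintro _ ⟨v, hv, rfl⟩
    obtain ⟨_, ⟨w, hw, rfl⟩, q, hq, rfl⟩ := Submodule.mem_sup.mp (hP hv)
    refine ⟨Q'.mkQ w, ⟨w, hw, rfl⟩, ?_⟩
    have : Q.mkQ q = 0 := by simpa using hq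
    simp only [map_add, this, add_zero]
    rfl
  exact Submodule.FG.of_le (Submodule.FG.map _ h) h1

lemma RelFG.of_comap [IsNoetherianRing A] {P Q : Submodule A V} {P' Q' : Submodule A W}
    (h : RelFG P' Q') (T : V →ₗ[A] W) (hP : P.map T ≤ P') (hK : RelFG (P ⊓ Q'.comap T) Q) :
    RelFG P Q := by
  refine RelFG.of_map_of_ker (F := Q'.mkQ ∘ₗ T) ?_ ?_
  · rw [Submodule.map_comp]
    exact Submodule.FG.of_le h (Submodule.map_mono hP)
  · rwa [LinearMap.ker_comp, Submodule.ker_mkQ]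

lemma relFG_of_le {P Q : Submodule A V} (h : P ≤ Q) : RelFG P Q := by
  have : P.map Q.mkQ = ⊥ := by
    rw [eq_bot_iff, Submodule.map_le_iff_le_comap]
    simpa using h
  rw [RelFG, this]
  exact Submodule.fg_bot

end RelativeFiniteness

variable {A R ι : Type*} [CommRing A] [CommRing R] [Algebra A R] (x : ι → R)

/-- A family of projections onto the graded pieces of a module whose degree is raised by one by
each of the `x i`. -/
structure IsProj {M : Type*} [AddCommGroup M] [Module R M] [Module A M]
    (π : ℕ → M →ₗ[A] M) : Prop where
  idem : ∀ d m, π d (π d m) = π d m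
  succ : ∀ i d m, π (d + 1) (x i • m) = x i • π d m
  zero : ∀ i m, π 0 (x i • m) = 0
  bdd : ∀ m, ∃ e, ∀ d ≥ e, π d m = 0
  fg : ∀ d, (LinearMap.range (π d)).FG

section Cochains

variable {M : Type*} [AddCommGroup M] [Module R M] [Module A M] [IsScalarTower A R M]
  (π : ℕ → M →ₗ[A] M)

lemma IsProj.pow {x : ι → R} {π : ℕ → M →ₗ[A] M} (h : IsProj x π) (i : ι) (n d : ℕ) (m : M) :
    π (d + n) (x i ^ n • m) = x i ^ n • π d m := by
  induction n with
  | zero => simp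
  | succ n ih => rw [pow_succ', mul_smul, mul_smul, ← add_assoc, h.succ, ih]

/-- Cochains of degree zero in the Čech complex: families of eventually defined fractions
`b i n / x i ^ n` of degree `d`. -/
def C0 (d : ℕ) : Submodule A (ι → ℕ → M) where
  carrier := {b | ∀ i, ∀ᶠ n in atTop, b i (n + 1) = x i • b i n ∧ π (d + n) (b i n) = b i n}
  zero_mem' := fun i ↦ .of_forall fun n ↦ by simp
  add_mem' := fun ha hb i ↦ by
    filter_upwards [ha i, hb i] with n h1 h2
    simp [h1, h2]
  smul_mem' := fun a b hb i ↦ by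
    filter_upwards [hb i] with n h
    simp [h, smul_comm a]

/-- The fractions that vanish. -/
def E0 : Submodule A (ι → ℕ → M) where
  carrier := {b | ∀ i, ∀ᶠ n in atTop, b i n = 0}
  zero_mem' := fun i ↦ .of_forall fun n ↦ by simp
  add_mem' := fun ha hb i ↦ by
    filter_upwards [ha i, hb i] with n h1 h2
    simp [h1, h2]
  smul_mem' := fun a b hb i ↦ by
    filter_upwards [hb i] with n h
    simp [h]

/-- `c` is the Čech coboundary of `b`. -/
def IsCob (b : ι → ℕ → M) (c : ι → ι → ℕ → M) : Prop :=
  ∀ i j, ∀ᶠ n in atTop, c i j n = x i ^ n • b j n - x j ^ n • b i n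

variable {x} in
lemma IsCob.add {b b' : ι → ℕ → M} {c c' : ι → ι → ℕ → M} (h : IsCob x b c) (h' : IsCob x b' c') :
    IsCob x (b + b') (c + c') := fun i j ↦ by
  filter_upwards [h i j, h' i j] with n h1 h2
  simp only [Pi.add_apply, h1, h2, smul_add]; abel

variable {x} in
lemma IsCob.sub {b b' : ι → ℕ → M} {c c' : ι → ι → ℕ → M} (h : IsCob x b c) (h' : IsCob x b' c') :
    IsCob x (b - b') (c - c') := fun i j ↦ by
  filter_upwards [h i j, h' i j] with n h1 h2
  simp only [Pi.sub_apply, h1, h2, smul_sub]; abel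

variable {x} in
lemma IsCob.smul {b : ι → ℕ → M} {c : ι → ι → ℕ → M} (h : IsCob x b c) (a : A) :
    IsCob x (a • b) (a • c) := fun i j ↦ by
  filter_upwards [h i j] with n h1
  simp only [Pi.smul_apply, h1, smul_sub, smul_comm a]

lemma isCob_zero : IsCob x (0 : ι → ℕ → M) 0 := fun i j ↦ .of_forall fun n ↦ by simp

/-- Cocycles of degree one. -/
def Z1 (d : ℕ) : Submodule A (ι → ι → ℕ → M) where
  carrier := {c | (∀ i j, ∀ᶠ n in atTop, c i j (n + 1) = (x i * x j) • c i j n ∧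
    π (d + 2 * n) (c i j n) = c i j n) ∧
    ∀ i j k, ∀ᶠ n in atTop, x k ^ n • c i j n - x j ^ n • c i k n + x i ^ n • c j k n = 0}
  zero_mem' := ⟨fun i j ↦ .of_forall fun n ↦ by simp, fun i j k ↦ .of_forall fun n ↦ by simp⟩
  add_mem' := fun {a b} ha hb ↦ ⟨fun i j ↦ by
    filter_upwards [ha.1 i j, hb.1 i j] with n h1 h2
    simp [h1, h2], fun i j k ↦ by
    filter_upwards [ha.2 i j k, hb.2 i j k] with n h1 h2
    rw [← add_zero (0 : M)]
    nth_rw 1 [← h1]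
    rw [← h2]
    simp only [Pi.add_apply, smul_add]; abel⟩
  smul_mem' := fun a b hb ↦ ⟨fun i j ↦ by
    filter_upwards [hb.1 i j] with n h
    simp [h, smul_comm a], fun i j k ↦ by
    filter_upwards [hb.2 i j k] with n h
    simp only [Pi.smul_apply, smul_comm _ a, ← smul_sub, ← smul_add, h, smul_zero]⟩

/-- Coboundaries of degree one. -/
def B1 (d : ℕ) : Submodule A (ι → ι → ℕ → M) where
  carrier := {c | ∃ b ∈ C0 x π d, IsCob x b c}
  zero_mem' := ⟨0, zero_mem _, isCob_zero x⟩
  add_mem' := fun ⟨_, hb, h⟩ ⟨_, hb', h'⟩ ↦ ⟨_, add_mem hb hb', h.add h'⟩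
  smul_mem' := fun a _ ⟨_, hb, h⟩ ↦ ⟨_, Submodule.smul_mem _ a hb, h.smul a⟩

/-- Cocycles of degree zero. -/
def H0 (d : ℕ) : Submodule A (ι → ℕ → M) where
  carrier := {b | b ∈ C0 x π d ∧ IsCob x b 0}
  zero_mem' := ⟨zero_mem _, isCob_zero x⟩
  add_mem' := fun ⟨hb, h⟩ ⟨hb', h'⟩ ↦ ⟨add_mem hb hb', by simpa using h.add h'⟩
  smul_mem' := fun a _ ⟨hb, h⟩ ↦ ⟨Submodule.smul_mem _ a hb, by simpa using h.smul a⟩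

/-- Finiteness and vanishing properties of the Čech cohomology of a graded module. -/
structure Good : Prop where
  inj : ∃ e, ∀ d ≥ e, ∀ m, π d m = m → (∀ i, ∃ n, x i ^ n • m = 0) → m = 0
  surj : ∃ e, ∀ d ≥ e, ∀ b ∈ H0 x π d, ∃ m, π d m = m ∧ ∀ i, ∀ᶠ n in atTop, b i n = x i ^ n • m
  fg0 : ∀ d, RelFG (H0 x π d) (E0 (A := A))
  fg1 : ∀ d, RelFG (Z1 x π d) (B1 x π d)

variable {π}

lemma eventually_eq_pow_smul {r : R} {b : ℕ → M} (h : ∀ᶠ n in atTop, b (n + 1) = r • b n) :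
    ∃ N, ∀ n ≥ N, ∀ k, b (n + k) = r ^ k • b n := by
  obtain ⟨N, hN⟩ := eventually_atTop.mp h
  refine ⟨N, fun n hn k ↦ ?_⟩
  induction k with
  | zero => simp
  | succ k ih => rw [← add_assoc, hN _ (by omega), ih, pow_succ', mul_smul]

end Cochains

section Maps

variable {A R ι : Type*} [CommRing A] [CommRing R] [Algebra A R] {x : ι → R}
variable {M M' : Type*} [AddCommGroup M] [Module R M] [Module A M] [IsScalarTower A R M]
  [AddCommGroup M'] [Module R M'] [Module A M'] [IsScalarTower A R M']
  {π : ℕ → M →ₗ[A] M} {π' : ℕ → M' →ₗ[A] M'}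

/-- A family of sequences is mapped termwise. -/
def map0 (ι : Type*) (f : M →ₗ[R] M') : (ι → ℕ → M) →ₗ[A] (ι → ℕ → M') :=
  ((f.restrictScalars A).compLeft ℕ).compLeft ι

/-- A double family of sequences is mapped termwise. -/
def map1 (ι : Type*) (f : M →ₗ[R] M') : (ι → ι → ℕ → M) →ₗ[A] (ι → ι → ℕ → M') :=
  (((f.restrictScalars A).compLeft ℕ).compLeft ι).compLeft ι

@[simp] lemma map0_apply (f : M →ₗ[R] M') (b : ι → ℕ → M) (i n) :
    map0 (A := A) ι f b i n = f (b i n) := rfl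

@[simp] lemma map1_apply (f : M →ₗ[R] M') (b : ι → ι → ℕ → M) (i j n) :
    map1 (A := A) ι f b i j n = f (b i j n) := rfl

lemma map0_mem_C0 {f : M →ₗ[R] M'} (hf : ∀ d m, f (π d m) = π' d (f m)) {d : ℕ}
    {b : ι → ℕ → M} (hb : b ∈ C0 x π d) : map0 (A := A) ι f b ∈ C0 x π' d := fun i ↦ by
  filter_upwards [hb i] with n h
  simp [h, ← hf]

lemma map1_mem_Z1 {f : M →ₗ[R] M'} (hf : ∀ d m, f (π d m) = π' d (f m)) {d : ℕ}
    {b : ι → ι → ℕ → M} (hb : b ∈ Z1 x π d) : map1 (A := A) ι f b ∈ Z1 x π' d := by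
  refine ⟨fun i j ↦ ?_, fun i j k ↦ ?_⟩
  · filter_upwards [hb.1 i j] with n h
    simp [h, ← hf]
  · filter_upwards [hb.2 i j k] with n h
    simp only [map1_apply, ← map_smul, ← map_sub, ← map_add, h, map_zero]

lemma IsCob.map {b : ι → ℕ → M} {c : ι → ι → ℕ → M} (h : IsCob x b c) (f : M →ₗ[R] M') :
    IsCob x (map0 (A := A) ι f b) (map1 (A := A) ι f c) := fun i j ↦ by
  filter_upwards [h i j] with n h
  simp [h]

lemma map0_mem_H0 {f : M →ₗ[R] M'} (hf : ∀ d m, f (π d m) = π' d (f m)) {d : ℕ}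
    {b : ι → ℕ → M} (hb : b ∈ H0 x π d) : map0 (A := A) ι f b ∈ H0 x π' d :=
  ⟨map0_mem_C0 hf hb.1, by simpa using hb.2.map (A := A) f⟩

lemma map1_mem_B1 {f : M →ₗ[R] M'} (hf : ∀ d m, f (π d m) = π' d (f m)) {d : ℕ}
    {b : ι → ι → ℕ → M} (hb : b ∈ B1 x π d) : map1 (A := A) ι f b ∈ B1 x π' d := by
  obtain ⟨b, hb, h⟩ := hb
  exact ⟨_, map0_mem_C0 hf hb, h.map f⟩

lemma mem_C0_of_map {f : M →ₗ[R] M'} (hf : ∀ d m, f (π d m) = π' d (f m))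
    (hinj : Function.Injective f) {d : ℕ} {b : ι → ℕ → M} {b' : ι → ℕ → M'}
    (hb' : b' ∈ C0 x π' d) (h : ∀ i, ∀ᶠ n in atTop, f (b i n) = b' i n) : b ∈ C0 x π d := fun i ↦ by
  filter_upwards [hb' i, h i, (tendsto_add_atTop_nat 1).eventually (h i)] with n h1 h2 h3
  refine ⟨hinj ?_, hinj ?_⟩
  · rw [h3, h1.1, map_smul, h2]
  · rw [hf, h2, h1.2]

lemma mem_Z1_of_map {f : M →ₗ[R] M'} (hf : ∀ d m, f (π d m) = π' d (f m))
    (hinj : Function.Injective f) {d : ℕ} {b : ι → ι → ℕ → M} {b' : ι → ι → ℕ → M'}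
    (hb' : b' ∈ Z1 x π' d) (h : ∀ i j, ∀ᶠ n in atTop, f (b i j n) = b' i j n) :
    b ∈ Z1 x π d := by
  refine ⟨fun i j ↦ ?_, fun i j k ↦ ?_⟩
  · filter_upwards [hb'.1 i j, h i j, (tendsto_add_atTop_nat 1).eventually (h i j)] with n h1 h2 h3
    refine ⟨hinj ?_, hinj ?_⟩
    · rw [h3, h1.1, map_smul, h2]
    · rw [hf, h2, h1.2]
  · filter_upwards [hb'.2 i j k, h i j, h i k, h j k] with n h1 h2 h3 h4
    exact hinj (by simp [h1, h2, h3, h4])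

lemma isCob_of_map {f : M →ₗ[R] M'}
    (hinj : Function.Injective f) {b : ι → ℕ → M} {c : ι → ι → ℕ → M}
    {b' : ι → ℕ → M'} {c' : ι → ι → ℕ → M'} (hb' : IsCob x b' c')
    (h : ∀ i, ∀ᶠ n in atTop, f (b i n) = b' i n)
    (hc : ∀ i j, ∀ᶠ n in atTop, f (c i j n) = c' i j n) : IsCob x b c := fun i j ↦ by
  filter_upwards [hb' i j, h i, h j, hc i j] with n h1 h2 h3 h4
  exact hinj (by simp [h1, h2, h3, h4])

lemma IsCob.congr {b b' : ι → ℕ → M} {c c' : ι → ι → ℕ → M} (hb : IsCob x b c)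
    (h : ∀ i, ∀ᶠ n in atTop, b i n = b' i n)
    (hc : ∀ i j, ∀ᶠ n in atTop, c i j n = c' i j n) : IsCob x b' c' := fun i j ↦ by
  filter_upwards [hb i j, h i, h j, hc i j] with n h1 h2 h3 h4
  rw [← h4, ← h3, ← h2, h1]

/-- The Čech coboundary. -/
def cob (x : ι → R) (b : ι → ℕ → M) (i j : ι) (n : ℕ) : M := x i ^ n • b j n - x j ^ n • b i n

lemma isCob_cob (b : ι → ℕ → M) : IsCob x b (cob x b) := fun _ _ ↦ .of_forall fun _ ↦ rfl

lemma mem_Z1_of_isCob (hπ : IsProj x π) {d : ℕ} {b : ι → ℕ → M} {c : ι → ι → ℕ → M}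
    (hb : b ∈ C0 x π d) (h : IsCob x b c) : c ∈ Z1 x π d := by
  refine ⟨fun i j ↦ ?_, fun i j k ↦ ?_⟩
  · filter_upwards [hb i, hb j, h i j, (tendsto_add_atTop_nat 1).eventually (h i j)]
      with n h1 h2 h3 h4
    constructor
    · rw [h4, h3, h1.1, h2.1, smul_sub, smul_smul, smul_smul, smul_smul, smul_smul]
      congr 2 <;> ring
    · rw [h3, map_sub, two_mul, ← add_assoc, hπ.pow, hπ.pow, h1.2, h2.2]
  · filter_upwards [h i j, h i k, h j k] with n h1 h2 h3
    rw [h1, h2, h3]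
    simp only [smul_sub, smul_smul, mul_comm (x k ^ n), mul_comm (x j ^ n) (x i ^ n)]
    abel

lemma mem_H0_of_eq (hπ : IsProj x π) {d : ℕ} {m : M} (hm : π d m = m) :
    (fun i n ↦ x i ^ n • m : ι → ℕ → M) ∈ H0 x π d := by
  refine ⟨fun i ↦ .of_forall fun n ↦ ⟨by simp only [pow_succ', mul_smul],
    by simp only [hπ.pow, hm]⟩,
    fun i j ↦ .of_forall fun n ↦ ?_⟩
  simp [smul_comm (x i ^ n)]

lemma exists_map0_eq_of_surjective {g : M →ₗ[R] M'} (hg : ∀ d m, g (π d m) = π' d (g m))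
    (hπ : IsProj x π)
    (hsurj : Function.Surjective g) {d : ℕ} {b' : ι → ℕ → M'} (hb' : b' ∈ C0 x π' d) :
    ∃ b ∈ C0 x π d, ∀ i, ∀ᶠ n in atTop, g (b i n) = b' i n := by
  have (i : ι) : ∃ N m, π (d + N) m = m ∧ ∀ k, b' i (N + k) = x i ^ k • g m := by
    obtain ⟨N, hN⟩ := eventually_eq_pow_smul ((hb' i).mono fun _ h ↦ h.1)
    obtain ⟨N', hN'⟩ := eventually_atTop.mp (hb' i)
    obtain ⟨m, hm⟩ := hsurj (b' i (max N N'))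
    refine ⟨max N N', π (d + max N N') m, hπ.idem _ _, fun k ↦ ?_⟩
    rw [hN _ (le_max_left _ _), hg, hm, (hN' _ (le_max_right _ _)).2]
  choose N m hm h using this
  refine ⟨fun i n ↦ x i ^ (n - N i) • m i, fun i ↦ ?_, fun i ↦ ?_⟩
  · filter_upwards [eventually_ge_atTop (N i)] with n hn
    rw [Nat.sub_add_comm hn, pow_succ', mul_smul]
    refine ⟨rfl, ?_⟩
    conv_lhs => rw [show d + n = d + N i + (n - N i) by omega]
    rw [hπ.pow, hm]
  · filter_upwards [eventually_ge_atTop (N i)] with n hn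
    rw [map_smul, ← h, Nat.add_sub_cancel' hn]

lemma exists_lift {α : Type*} {f : M' → M} {p : M → Prop}
    (h : ∀ m, p m → ∃ m', f m' = m) [Nonempty M'] (b : α → ℕ → M)
    (hb : ∀ i, ∀ᶠ n in atTop, p (b i n)) :
    ∃ c : α → ℕ → M', ∀ i, ∀ᶠ n in atTop, f (c i n) = b i n := by
  choose! l hl using h
  exact ⟨fun i n ↦ l (b i n), fun i ↦ (hb i).mono fun n hn ↦ hl _ hn⟩

lemma exists_lift₂ {α : Type*} {f : M' → M} {p : M → Prop}
    (h : ∀ m, p m → ∃ m', f m' = m) [Nonempty M'] (b : α → α → ℕ → M)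
    (hb : ∀ i j, ∀ᶠ n in atTop, p (b i j n)) :
    ∃ c : α → α → ℕ → M', ∀ i j, ∀ᶠ n in atTop, f (c i j n) = b i j n := by
  choose! l hl using h
  exact ⟨fun i j n ↦ l (b i j n), fun i j ↦ (hb i j).mono fun n hn ↦ hl _ hn⟩

end Maps

section Extension

variable {A R ι : Type*} [CommRing A] [CommRing R] [Algebra A R] {x : ι → R}
variable {M M' M'' : Type*} [AddCommGroup M] [Module R M] [Module A M] [IsScalarTower A R M]
  [AddCommGroup M'] [Module R M'] [Module A M'] [IsScalarTower A R M']
  [AddCommGroup M''] [Module R M''] [Module A M''] [IsScalarTower A R M'']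
  {π : ℕ → M →ₗ[A] M} {π' : ℕ → M' →ₗ[A] M'} {π'' : ℕ → M'' →ₗ[A] M''}

lemma Good.of_exact [IsNoetherianRing A] (hπ : IsProj x π)
    {f : M' →ₗ[R] M} {g : M →ₗ[R] M''} (hf : ∀ d m, f (π' d m) = π d (f m))
    (hg : ∀ d m, g (π d m) = π'' d (g m)) (hinj : Function.Injective f)
    (hsurj : Function.Surjective g) (hex : ∀ m, g m = 0 → ∃ m', f m' = m)
    (h' : Good x π') (h'' : Good x π'') : Good x π := by
  refine ⟨?_, ?_, fun d ↦ ?_, fun d ↦ ?_⟩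
  · obtain ⟨e', h'⟩ := h'.inj
    obtain ⟨e'', h''⟩ := h''.inj
    refine ⟨max e' e'', fun d hd m hm ht ↦ ?_⟩
    obtain ⟨m', rfl⟩ := hex m <| h'' d (by omega) (g m) (by rw [← hg, hm]) fun i ↦ by
      obtain ⟨n, hn⟩ := ht i
      exact ⟨n, by rw [← map_smul, hn, map_zero]⟩
    rw [h' d (by omega) m' (hinj (by rw [hf, hm])) fun i ↦ by
      obtain ⟨n, hn⟩ := ht i
      exact ⟨n, hinj (by rw [map_smul, hn, map_zero])⟩, map_zero]
  · obtain ⟨e', h'⟩ := h'.surj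
    obtain ⟨e'', h''⟩ := h''.surj
    refine ⟨max e' e'', fun d hd b hb ↦ ?_⟩
    obtain ⟨m'', hm'', hbm⟩ := h'' d (by omega) _ (map0_mem_H0 hg hb)
    obtain ⟨m, rfl⟩ := hsurj m''
    have hm : π d (π d m) = π d m := hπ.idem d m
    have hgm : g (π d m) = g m := by rw [hg, hm'']
    generalize π d m = m at hm hgm
    rw [← hgm] at hbm
    have hb2 := sub_mem hb (mem_H0_of_eq hπ hm)
    obtain ⟨c, hc⟩ := exists_lift (f := f) hex (b - fun i n ↦ x i ^ n • m)
      fun i ↦ by filter_upwards [hbm i] with n hn; simpa [sub_eq_zero] using hn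
    obtain ⟨m', hm', hcm⟩ := h' d (by omega) c
      ⟨mem_C0_of_map hf hinj hb2.1 hc, isCob_of_map hinj hb2.2 hc (by simp)⟩
    refine ⟨m + f m', by rw [map_add, hm, ← hf, hm'], fun i ↦ ?_⟩
    filter_upwards [hcm i, hc i] with n h1 h2
    rw [h1, map_smul] at h2
    simp [smul_add, h2]
  · refine (h''.fg0 d).of_comap (map0 ι g) (Submodule.map_le_iff_le_comap.mpr
      fun b hb ↦ map0_mem_H0 hg hb) ?_
    refine (h'.fg0 d).of_le (map0 ι f) (Submodule.map_le_iff_le_comap.mpr fun b hb i ↦ ?_) ?_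
    · filter_upwards [hb i] with n hn
      simp [hn]
    · rintro b ⟨hb, hb0⟩
      obtain ⟨c, hc⟩ := exists_lift (f := f) hex b hb0
      rw [← add_sub_cancel (map0 (A := A) ι f c) b]
      refine Submodule.add_mem_sup (Submodule.mem_map_of_mem
        ⟨mem_C0_of_map hf hinj hb.1 hc, isCob_of_map hinj hb.2 hc (by simp)⟩) fun i ↦ ?_
      filter_upwards [hc i] with n hn
      simp [hn]
  · refine (h''.fg1 d).of_comap (map1 ι g) (Submodule.map_le_iff_le_comap.mpr
      fun b hb ↦ map1_mem_Z1 hg hb) ?_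
    refine (h'.fg1 d).of_le (map1 ι f) (Submodule.map_le_iff_le_comap.mpr fun b hb ↦
      map1_mem_B1 hf hb) ?_
    rintro c ⟨hc, b'', hb'', hbc⟩
    obtain ⟨b, hb, hbb⟩ := exists_map0_eq_of_surjective hg hπ hsurj hb''
    obtain ⟨c', hc'⟩ := exists_lift₂ (f := f) hex (c - cob x b) fun i j ↦ by
      filter_upwards [hbc i j, hbb i, hbb j] with n h1 h2 h3
      rw [map1_apply] at h1
      simp [cob, h1, h2, h3]
    rw [← add_sub_cancel (map1 (A := A) ι f c') c]
    refine Submodule.add_mem_sup (Submodule.mem_map_of_mem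
        (mem_Z1_of_map hf hinj (sub_mem hc (mem_Z1_of_isCob hπ hb (isCob_cob b))) hc'))
        ⟨b, hb, fun i j ↦ ?_⟩
    filter_upwards [hc' i j] with n hn
    simp only [Pi.sub_apply, map1_apply, hn, cob]
    abel

end Extension

section TorsionFree

variable {A R ι : Type*} [CommRing A] [CommRing R] [Algebra A R] {x : ι → R}
variable {M M'' : Type*} [AddCommGroup M] [Module R M] [Module A M] [IsScalarTower A R M]
  [AddCommGroup M''] [Module R M''] [Module A M''] [IsScalarTower A R M'']
  {π : ℕ → M →ₗ[A] M} {π'' : ℕ → M'' →ₗ[A] M''}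

lemma C0_shift (d : ℕ) : C0 x (fun d ↦ π (d + 1)) d = C0 x π (d + 1) := by
  ext b; simp [C0, add_right_comm]

lemma Z1_shift (d : ℕ) : Z1 x (fun d ↦ π (d + 1)) d = Z1 x π (d + 1) := by
  ext b; simp [Z1, add_right_comm]

lemma H0_shift (d : ℕ) : H0 x (fun d ↦ π (d + 1)) d = H0 x π (d + 1) := by
  ext b
  change _ ∧ _ ↔ _ ∧ _
  rw [C0_shift]

lemma isCob_of_forall {b : ι → ℕ → M} {c : ι → ι → ℕ → M} (h : ∀ i j, ∀ᶠ n in atTop, c i j n = 0)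
    (hc : IsCob x b c) : IsCob x b 0 :=
  hc.congr (fun _ ↦ .of_forall fun _ ↦ rfl) h

lemma pow_smul_cancel {l : ι} (hl : ∀ m : M, x l • m = 0 → m = 0) (n : ℕ) {m m' : M}
    (h : x l ^ n • m = x l ^ n • m') : m = m' := by
  induction n with
  | zero => simpa using h
  | succ n ih =>
    refine ih (sub_eq_zero.mp (hl _ ?_))
    rw [smul_sub, smul_smul, smul_smul, ← pow_succ', h, sub_self]

variable (hπ : IsProj x π) {g : M →ₗ[R] M''} (hg : ∀ d m, g (π d m) = π'' d (g m))
  (hsurj : Function.Surjective g) (l : ι) (hl : ∀ m : M, x l • m = 0 → m = 0)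
  (hex : ∀ m, g m = 0 → ∃ m', x l • m' = m) (hgl : ∀ m, g (x l • m) = 0)

/-- Multiplication by `x l` as a linear map. -/
def mulx (M : Type*) [AddCommGroup M] [Module R M] (x : ι → R) (l : ι) : M →ₗ[R] M :=
  LinearMap.lsmul R M (x l)

@[simp] lemma mulx_apply (m : M) : mulx M x l m = x l • m := rfl

include hπ in
lemma mulx_comm (d : ℕ) (m : M) : mulx (R := R) M x l (π d m) = (fun d ↦ π (d + 1)) d (mulx M x l m) :=
  (hπ.succ l d m).symm

include hl in
lemma mulx_injective : Function.Injective (mulx M x l) := fun m m' h ↦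
  pow_smul_cancel hl 1 (by simpa using h)

include hπ hl hex in
lemma exists_mul_eq {d : ℕ} {b : ι → ℕ → M} (hb : b ∈ C0 x π (d + 1))
    (h : ∀ i, ∀ᶠ n in atTop, g (b i n) = 0) :
    ∃ b' ∈ C0 x π d, ∀ i, ∀ᶠ n in atTop, x l • b' i n = b i n := by
  obtain ⟨c, hc⟩ := exists_lift (f := mulx M x l) hex b h
  exact ⟨c, mem_C0_of_map (A := A) (mulx_comm hπ l) (mulx_injective l hl) (C0_shift (x := x) (π := π) d ▸ hb) hc, hc⟩

include hπ hg hl hex in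
lemma exists_eq_pow_smul {e : ℕ}
    (he : ∀ d ≥ e, ∀ m, π'' d m = m → (∀ i, ∃ n, x i ^ n • m = 0) → m = 0) (hgl : ∀ m, g (x l • m) = 0)
    {d : ℕ} (hd : e ≤ d)
    (b : ι → ℕ → M) (N : ℕ) (m : M) (hm : π (d + N) m = m)
    (h : ∀ i, ∀ᶠ n in atTop, x i ^ n • m = x l ^ N • b i n) :
    ∃ m', π d m' = m' ∧ m = x l ^ N • m' := by
  induction N generalizing m with
  | zero => exact ⟨m, hm, by simp⟩
  | succ N ih =>
    obtain ⟨m1, rfl⟩ := hex m <| he (d + (N + 1)) (by omega) (g m) (by rw [← hg, hm]) fun i ↦ by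
      obtain ⟨n, hn⟩ := (h i).exists
      exact ⟨n, by rw [← map_smul, hn, pow_succ', mul_smul, hgl]⟩
    rw [← add_assoc, hπ.succ] at hm
    obtain ⟨m', hm', rfl⟩ := ih m1 (mulx_injective l hl hm) fun i ↦ by
      filter_upwards [h i] with n hn
      refine mulx_injective l hl ?_
      rw [mulx_apply, mulx_apply, smul_comm, hn, pow_succ', mul_smul]
    exact ⟨m', hm', by rw [pow_succ', mul_smul]⟩

include hπ hg hl hex in
lemma exists_of_mem_H0 {e : ℕ}
    (he : ∀ d ≥ e, ∀ m, π'' d m = m → (∀ i, ∃ n, x i ^ n • m = 0) → m = 0) (hgl : ∀ m, g (x l • m) = 0)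
    {d : ℕ} (hd : e ≤ d) {b : ι → ℕ → M} (hb : b ∈ H0 x π d) :
    ∃ m, π d m = m ∧ ∀ i, ∀ᶠ n in atTop, b i n = x i ^ n • m := by
  obtain ⟨N₁, hN₁⟩ := eventually_eq_pow_smul ((hb.1 l).mono fun _ h ↦ h.1)
  obtain ⟨N₂, hN₂⟩ := eventually_atTop.mp (hb.1 l)
  set N := max N₁ N₂ with hN
  have key (i : ι) : ∀ᶠ n in atTop, x i ^ n • b l N = x l ^ N • b i n := by
    filter_upwards [hb.2 i l, eventually_ge_atTop N] with n hn hle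
    obtain ⟨k, rfl⟩ := Nat.exists_eq_add_of_le hle
    rw [hN₁ N (le_max_left _ _) k] at hn
    refine pow_smul_cancel hl k ?_
    rw [smul_comm, smul_smul (x l ^ k), ← pow_add, add_comm k]
    exact (sub_eq_zero.mp hn.symm)
  obtain ⟨m, hm, h⟩ := exists_eq_pow_smul hπ hg l hl hex he hgl hd b N _
    (hN₂ N (le_max_right _ _)).2 key
  refine ⟨m, hm, fun i ↦ ?_⟩
  filter_upwards [key i] with n hn
  rw [h, smul_comm] at hn
  exact (pow_smul_cancel hl _ hn).symm

/-- The family of fractions defined by an element. -/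
def toC (x : ι → R) : M →ₗ[A] (ι → ℕ → M) where
  toFun m i n := x i ^ n • m
  map_add' m m' := by ext; simp
  map_smul' a m := by ext; simp [smul_comm a]

include hπ hl in
lemma exists_pow_smul_mem_B1 [Finite ι] {d : ℕ} {c : ι → ι → ℕ → M} (hc : c ∈ Z1 x π d) :
    ∃ N, (fun i j n ↦ x l ^ N • c i j n) ∈ B1 x π (d + N) := by
  obtain ⟨N, hN⟩ := eventually_atTop.mp (eventually_all.mpr fun i ↦ hc.1 i l)
  have hN' (i : ι) (k : ℕ) : c i l (N + k) = (x i * x l) ^ k • c i l N := by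
    induction k with
    | zero => simp
    | succ k ih => rw [← add_assoc, (hN _ (by omega) i).1, ih, pow_succ', mul_smul (x i * x l)]
  refine ⟨N, fun i n ↦ - (x i ^ (n - N) • c i l N), fun i ↦ ?_, fun i j ↦ ?_⟩
  · filter_upwards [eventually_ge_atTop N] with n hn
    constructor
    · rw [Nat.sub_add_comm hn, pow_succ', mul_smul, smul_neg]
    · rw [map_neg, show d + N + n = d + 2 * N + (n - N) by omega, hπ.pow, (hN N le_rfl i).2]
  · filter_upwards [hc.2 i j l, eventually_ge_atTop N] with n h hn
    obtain ⟨k, rfl⟩ := Nat.exists_eq_add_of_le hn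
    rw [hN', hN'] at h
    refine pow_smul_cancel hl k ?_
    rw [Nat.add_sub_cancel_left, smul_smul, ← pow_add, add_comm k,
      ← sub_eq_zero, ← sub_eq_zero.mpr h, sub_zero]
    simp only [smul_sub, smul_neg, smul_smul, mul_pow]
    rw [show x l ^ k * (x i ^ (N + k) * x j ^ k) = x i ^ (N + k) * (x j ^ k * x l ^ k) by ring,
      show x l ^ k * (x j ^ (N + k) * x i ^ k) = x j ^ (N + k) * (x i ^ k * x l ^ k) by ring]
    abel

include hπ hg hsurj hl hex hgl in
lemma mem_B1_of_mulx_mem {e : ℕ}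
    (he : ∀ d ≥ e, ∀ b ∈ H0 x π'' d, ∃ m, π'' d m = m ∧ ∀ i, ∀ᶠ n in atTop, b i n = x i ^ n • m)
    {d : ℕ} (hd : e ≤ d + 1) {c : ι → ι → ℕ → M} 
    (h : map1 (A := A) ι (mulx M x l) c ∈ B1 x π (d + 1)) : c ∈ B1 x π d := by
  obtain ⟨b, hb, hbc⟩ := h
  have hgc : IsCob x (map0 (A := A) ι g b) 0 :=
    isCob_of_forall (fun i j ↦ .of_forall fun n ↦ by simp [hgl]) (hbc.map g)
  obtain ⟨m'', hm'', hbm⟩ := he (d + 1) hd _ ⟨map0_mem_C0 hg hb, hgc⟩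
  obtain ⟨m, rfl⟩ := hsurj m''
  have hm : π (d + 1) (π (d + 1) m) = π (d + 1) m := hπ.idem _ m
  have hgm : g (π (d + 1) m) = g m := by rw [hg, hm'']
  generalize π (d + 1) m = m at hm hgm
  rw [← hgm] at hbm
  have hb2 := mem_H0_of_eq hπ hm
  obtain ⟨b', hb', hbb⟩ := exists_mul_eq hπ (g := g) l hl hex (sub_mem hb hb2.1) fun i ↦ by
    filter_upwards [hbm i] with n hn
    rw [map0_apply] at hn
    simp [hn]
  exact ⟨b', hb', isCob_of_map (mulx_injective l hl) (by
    have := hbc.sub hb2.2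
    rwa [sub_zero] at this) hbb fun i j ↦ .of_forall fun n ↦ rfl⟩

include hπ in
lemma map1_mulx_mem {d : ℕ} {c : ι → ι → ℕ → M} (hc : c ∈ Z1 x π d) :
    map1 (A := A) ι (mulx M x l) c ∈ Z1 x π (d + 1) :=
  Z1_shift (x := x) (π := π) d ▸ map1_mem_Z1 (mulx_comm hπ l) hc

include hπ hg hsurj hl hex hgl in
lemma mem_B1_of_pow {e : ℕ}
    (he : ∀ d ≥ e, ∀ b ∈ H0 x π'' d, ∃ m, π'' d m = m ∧ ∀ i, ∀ᶠ n in atTop, b i n = x i ^ n • m)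
    (N : ℕ) {d : ℕ} (hd : e ≤ d + 1) {c : ι → ι → ℕ → M}
    (h : (fun i j n ↦ x l ^ N • c i j n) ∈ B1 x π (d + N)) : c ∈ B1 x π d := by
  induction N generalizing d c with
  | zero => simpa using h
  | succ N ih =>
    refine mem_B1_of_mulx_mem hπ hg hsurj l hl hex hgl he hd (ih (by omega) ?_)
    simpa only [map1_apply, mulx_apply, smul_smul, ← pow_succ, add_right_comm d 1, add_assoc] using h

include hπ hg hsurj hl hex hgl in
lemma Good.of_torsionFree [IsNoetherianRing A] [Finite ι] (h'' : Good x π'') : Good x π := by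
  obtain ⟨e, he⟩ := h''.inj
  obtain ⟨e', he'⟩ := h''.surj
  refine ⟨⟨0, fun d _ m _ h ↦ ?_⟩, ⟨e, fun d hd b hb ↦ exists_of_mem_H0 hπ hg l hl hex he hgl hd hb⟩,
    ?_, ?_⟩
  · obtain ⟨n, hn⟩ := h l
    exact pow_smul_cancel hl n (by rw [hn, smul_zero])
  · suffices ∀ k d, e ≤ d + k → RelFG (H0 x π d) (E0 (A := A)) from fun d ↦ this e d (by omega)
    intro k
    induction k with
    | zero =>
      intro d hd
      have : RelFG (LinearMap.range (π d)) (⊥ : Submodule A M) := (hπ.fg d).map _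
      refine this.of_le (toC x) (by simp) fun b hb ↦ ?_
      obtain ⟨m, hm, h⟩ := exists_of_mem_H0 hπ hg l hl hex he hgl hd hb
      rw [← add_sub_cancel (toC (A := A) x m) b]
      refine Submodule.add_mem_sup (Submodule.mem_map_of_mem ⟨m, hm⟩) fun i ↦ ?_
      filter_upwards [h i] with n hn
      simp [hn, toC]
    | succ k ih =>
      intro d hd
      refine (ih (d + 1) (by omega)).of_comap (map0 ι (mulx M x l)) ?_ (relFG_of_le ?_)
      · rintro _ ⟨b, hb, rfl⟩
        exact H0_shift (x := x) (π := π) d ▸ map0_mem_H0 (mulx_comm hπ l) hb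
      · rintro b ⟨-, hb⟩ i
        filter_upwards [hb i] with n hn
        exact hl _ hn
  · suffices ∀ k d, e' ≤ d + k + 1 → RelFG (Z1 x π d) (B1 x π d) from fun d ↦ this e' d (by omega)
    intro k
    induction k with
    | zero =>
      intro d hd
      refine relFG_of_le fun c hc ↦ ?_
      obtain ⟨N, hN⟩ := exists_pow_smul_mem_B1 hπ l hl hc
      exact mem_B1_of_pow hπ hg hsurj l hl hex hgl he' N hd hN
    | succ k ih =>
      intro d hd
      refine (ih (d + 1) (by omega)).of_comap (map1 ι (mulx M x l)) ?_ ?_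
      · rintro _ ⟨b, hb, rfl⟩
        exact map1_mulx_mem hπ l hb
      let W : Submodule A ((ι → ℕ → M) × (ι → ι → ℕ → M)) :=
        { carrier := {p | (p.1 ∈ C0 x π (d + 1) ∧ p.2 ∈ Z1 x π d) ∧
            IsCob x p.1 (map1 (A := A) ι (mulx M x l) p.2)}
          zero_mem' := ⟨⟨zero_mem _, zero_mem _⟩, by simpa using isCob_zero x⟩
          add_mem' := fun h h' ↦ ⟨⟨add_mem h.1.1 h'.1.1, add_mem h.1.2 h'.1.2⟩,
            by simpa using h.2.add h'.2⟩
          smul_mem' := fun a _ h ↦ ⟨⟨Submodule.smul_mem _ a h.1.1, Submodule.smul_mem _ a h.1.2⟩,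
            by simpa using h.2.smul a⟩ }
      have hW : RelFG W ((B1 x π d).comap (LinearMap.snd A _ _)) := by
        refine RelFG.of_map_of_ker
          (F := (E0 (A := A)).mkQ ∘ₗ map0 ι g ∘ₗ LinearMap.fst A _ _) ?_ (relFG_of_le ?_)
        · rw [Submodule.map_comp]
          refine Submodule.FG.of_le (h''.fg0 (d + 1)) (Submodule.map_mono ?_)
          rintro _ ⟨p, hp, rfl⟩
          exact ⟨map0_mem_C0 hg hp.1.1,
            isCob_of_forall (fun i j ↦ .of_forall fun n ↦ by simp [hgl]) (hp.2.map (A := A) g)⟩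
        · rintro ⟨b, c⟩ ⟨hp, hk⟩
          have hk' : map0 (A := A) ι g b ∈ E0 (A := A) := by simpa using hk
          obtain ⟨b', hb', hbb⟩ := exists_mul_eq hπ (g := g) l hl hex hp.1.1 hk'
          exact ⟨b', hb', isCob_of_map (mulx_injective l hl) hp.2 hbb
            fun i j ↦ .of_forall fun n ↦ rfl⟩
      refine hW.of_le (LinearMap.snd A _ _) (Submodule.map_comap_le _ _) ?_
      rintro c ⟨hc, b, hb, hbc⟩
      exact Submodule.mem_sup_left ⟨(b, c), ⟨⟨hb, hc⟩, hbc⟩, rfl⟩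

end TorsionFree

section Main

variable {A R ι : Type*} [CommRing A] [CommRing R] [Algebra A R] {x : ι → R}
variable {M M' : Type*} [AddCommGroup M] [Module R M] [Module A M] [IsScalarTower A R M]
  [AddCommGroup M'] [Module R M'] [Module A M'] [IsScalarTower A R M']
  {π : ℕ → M →ₗ[A] M} {π' : ℕ → M' →ₗ[A] M'}

lemma IsProj.of_injective [IsNoetherianRing A] (hπ : IsProj x π) {f : M' →ₗ[R] M}
    (hf : ∀ d m, f (π' d m) = π d (f m)) (hinj : Function.Injective f) : IsProj x π' where
  idem d m := hinj (by rw [hf, hf, hπ.idem])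
  succ i d m := hinj (by rw [hf, map_smul, hπ.succ, map_smul, hf])
  zero i m := hinj (by rw [hf, map_smul, hπ.zero, map_zero])
  bdd m := by
    obtain ⟨e, he⟩ := hπ.bdd (f m)
    exact ⟨e, fun d hd ↦ hinj (by rw [hf, he d hd, map_zero])⟩
  fg d := by
    refine Submodule.fg_of_fg_map_injective (f.restrictScalars A) hinj (.of_le (hπ.fg d) ?_)
    rintro _ ⟨_, ⟨m, rfl⟩, rfl⟩
    exact ⟨f m, (hf d m).symm⟩

lemma IsProj.of_surjective (hπ : IsProj x π) {f : M →ₗ[R] M'}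
    (hf : ∀ d m, f (π d m) = π' d (f m)) (hsurj : Function.Surjective f) : IsProj x π' where
  idem d m := by
    obtain ⟨m, rfl⟩ := hsurj m
    rw [← hf, ← hf, hπ.idem]
  succ i d m := by
    obtain ⟨m, rfl⟩ := hsurj m
    rw [← map_smul, ← hf, ← hf, hπ.succ, map_smul]
  zero i m := by
    obtain ⟨m, rfl⟩ := hsurj m
    rw [← map_smul, ← hf, hπ.zero, map_zero]
  bdd m := by
    obtain ⟨m, rfl⟩ := hsurj m
    obtain ⟨e, he⟩ := hπ.bdd m
    exact ⟨e, fun d hd ↦ by rw [← hf, he d hd, map_zero]⟩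
  fg d := by
    have : LinearMap.range (π' d) = (LinearMap.range (π d)).map (f.restrictScalars A) := by
      apply le_antisymm
      · rintro _ ⟨m, rfl⟩
        obtain ⟨m, rfl⟩ := hsurj m
        exact ⟨_, ⟨m, rfl⟩, hf d m⟩
      · rintro _ ⟨_, ⟨m, rfl⟩, rfl⟩
        exact ⟨f m, (hf d m).symm⟩
    rw [this]
    exact (hπ.fg d).map _

lemma exists_sub_proj (π : ℕ → M →ₗ[A] M) (N : Submodule R M) (h : ∀ d, ∀ m ∈ N, π d m ∈ N) :
    ∃ π' : ℕ → N →ₗ[A] N, ∀ d m, N.subtype (π' d m) = π d (N.subtype m) :=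
  ⟨fun d ↦
    { toFun m := ⟨π d m, h d m m.2⟩
      map_add' m m' := by ext; simp
      map_smul' a m := by ext; simp }, fun d m ↦ rfl⟩

lemma exists_quot_proj (π : ℕ → M →ₗ[A] M) (N : Submodule R M) (h : ∀ d, ∀ m ∈ N, π d m ∈ N) :
    ∃ π' : ℕ → (M ⧸ N) →ₗ[A] (M ⧸ N), ∀ d m, N.mkQ (π d m) = π' d (N.mkQ m) :=
  ⟨fun d ↦ (Submodule.Quotient.restrictScalarsEquiv A N).toLinearMap ∘ₗ
    (N.restrictScalars A).mapQ (N.restrictScalars A) (π d) (h d) ∘ₗ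
    (Submodule.Quotient.restrictScalarsEquiv A N).symm.toLinearMap, fun _ _ ↦ rfl⟩

lemma good_of_eventually_zero {e : ℕ} (h : ∀ d ≥ e, ∀ m, π d m = 0) : Good x π := by
  refine ⟨⟨e, fun d hd m hm _ ↦ hm ▸ h d hd m⟩,
    ⟨e, fun d hd b hb ↦ ⟨0, map_zero _, fun i ↦ ?_⟩⟩, fun d ↦ relFG_of_le fun b hb i ↦ ?_,
    fun d ↦ relFG_of_le fun c hc ↦ ⟨0, zero_mem _, fun i j ↦ ?_⟩⟩
  · filter_upwards [hb.1 i] with n hn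
    rw [← hn.2, h _ (by omega), smul_zero]
  · filter_upwards [hb.1 i, eventually_ge_atTop e] with n hn hle
    rw [← hn.2, h _ (by omega)]
  · filter_upwards [hc.1 i j, eventually_ge_atTop e] with n hn hle
    rw [← hn.2, h _ (by omega)]
    simp

lemma exists_forall_eq_zero [Finite ι] [IsNoetherian R M] (hπ : IsProj x π)
    (hR : ∀ r : R, ∃ a : A, r - algebraMap A R a ∈ Ideal.span (Set.range x))
    (hnil : ∀ i, ∃ n, ∀ m : M, x i ^ n • m = 0) : ∃ e, ∀ d ≥ e, ∀ m, π d m = 0 := by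
  set J := Ideal.span (Set.range x) with hJ
  let W : Submodule R M :=
    { carrier := {m | ∃ e, ∀ r : R, ∀ d ≥ e, π d (r • m) = 0}
      zero_mem' := ⟨0, by simp⟩
      add_mem' := by
        rintro m m' ⟨e, he⟩ ⟨e', he'⟩
        refine ⟨max e e', fun r d hd ↦ ?_⟩
        rw [smul_add, map_add, he r d (by omega), he' r d (by omega), add_zero]
      smul_mem' := by
        rintro s m ⟨e, he⟩
        exact ⟨e, fun r d hd ↦ by rw [smul_smul]; exact he _ d hd⟩ }
  have hW (m : M) (h : ∀ i, x i • m ∈ W) : m ∈ W := by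
    choose e he using h
    obtain ⟨E, hE⟩ := (Set.finite_range e).bddAbove
    obtain ⟨E', hE'⟩ := hπ.bdd m
    let I : Ideal R :=
      { carrier := {j | ∀ r : R, ∀ d ≥ E, π d (r • j • m) = 0}
        zero_mem' := by simp
        add_mem' := by
          intro a b ha hb r d hd
          rw [add_smul, smul_add, map_add, ha r d hd, hb r d hd, add_zero]
        smul_mem' := by
          intro s a ha r d hd
          rw [smul_assoc, smul_smul]
          exact ha _ d hd }
    have hI : J ≤ I := Ideal.span_le.mpr (by
      rintro _ ⟨i, rfl⟩ r d hd
      exact he i r d ((hE ⟨i, rfl⟩).trans hd))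
    refine ⟨max E E', fun r d hd ↦ ?_⟩
    obtain ⟨a, ha⟩ := hR r
    have h1 := hI ha 1 d (by omega)
    rw [one_smul, sub_smul, algebraMap_smul, map_sub, (π d).map_smul a, hE' d (by omega),
      smul_zero, sub_zero] at h1
    exact h1
  have hJle : J ≤ (Module.annihilator R M).radical := Ideal.span_le.mpr (by
    rintro _ ⟨i, rfl⟩
    obtain ⟨n, hn⟩ := hnil i
    exact ⟨n, Module.mem_annihilator.mpr hn⟩)
  obtain ⟨k, hk⟩ := Ideal.exists_pow_le_of_le_radical_of_fg hJle
    ⟨(Set.finite_range x).toFinset, by simp [hJ]⟩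
  have key (j : ℕ) (hj : j ≤ k) : ∀ r ∈ J ^ (k - j), ∀ m : M, r • m ∈ W := by
    induction j with
    | zero =>
      intro r hr m
      rw [Module.mem_annihilator.mp (hk hr)]
      exact zero_mem _
    | succ j ih =>
      intro r hr m
      refine hW _ fun i ↦ ?_
      rw [smul_smul]
      refine ih (by omega) _ ?_ m
      rw [show k - j = k - (j + 1) + 1 by omega, pow_succ']
      exact Ideal.mul_mem_mul (Ideal.subset_span ⟨i, rfl⟩) hr
  have htop (m : M) : m ∈ W := by simpa using key k le_rfl 1 (by simp) m
  obtain ⟨s, hs⟩ := IsNoetherian.noetherian (⊤ : Submodule R M)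
  choose e he using htop
  refine ⟨s.sup e, fun d hd m ↦ ?_⟩
  let V : Submodule R M :=
    { carrier := {m | ∀ r : R, π d (r • m) = 0}
      zero_mem' := by simp
      add_mem' := by
        intro m m' h h' r
        rw [smul_add, map_add, h r, h' r, add_zero]
      smul_mem' := by
        intro s m h r
        rw [smul_smul]; exact h _ }
  have : (⊤ : Submodule R M) ≤ V := by
    rw [← hs, Submodule.span_le]
    exact fun m hm r ↦ he m r d ((Finset.le_sup hm).trans hd)
  simpa using this (Submodule.mem_top : m ∈ ⊤) 1

end Main

section

universe u

variable {A R ι : Type*} [CommRing A] [CommRing R] [Algebra A R] {x : ι → R}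

/-- Finiteness of the Čech cohomology of a finitely generated graded module. -/
theorem good_of_isNoetherian [Finite ι] [IsNoetherianRing A]
    (hR : ∀ r : R, ∃ a : A, r - algebraMap A R a ∈ Ideal.span (Set.range x))
    (M : Type u) [AddCommGroup M] [Module R M] [Module A M] [IsScalarTower A R M]
    [IsNoetherian R M] {π : ℕ → M →ₗ[A] M} (hπ : IsProj x π) : Good x π := by
  suffices ∀ (k : ℕ) (M : Type u) [AddCommGroup M] [Module R M] [Module A M] [IsScalarTower A R M]
      [IsNoetherian R M] (π : ℕ → M →ₗ[A] M), IsProj x π →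
      {i | ¬ ∃ n, ∀ m : M, x i ^ n • m = 0}.ncard = k → Good x π from this _ M π hπ rfl
  clear hπ
  intro k
  induction k using Nat.strong_induction_on with
  | _ k ih =>
  intro M _ _ _ _ _ π hπ hk
  by_cases hnil : ∀ i, ∃ n, ∀ m : M, x i ^ n • m = 0
  · obtain ⟨e, he⟩ := exists_forall_eq_zero hπ hR hnil
    exact good_of_eventually_zero he
  obtain ⟨l, hl⟩ := not_forall.mp hnil
  let K : ℕ →o Submodule R M :=
    ⟨fun n ↦ LinearMap.ker (LinearMap.lsmul R M (x l ^ n)), monotone_nat_of_le_succ fun n m hm ↦ by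
      have hm : x l ^ n • m = 0 := hm
      change x l ^ (n + 1) • m = 0
      rw [pow_succ', mul_smul, hm, smul_zero]⟩
  obtain ⟨n, hn⟩ := monotone_stabilizes_iff_noetherian.mpr ‹IsNoetherian R M› K
  have memK (n) (m : M) : m ∈ K n ↔ x l ^ n • m = 0 := Iff.rfl
  obtain ⟨π', hπ'⟩ := exists_sub_proj π (K n) fun d m hm ↦ by
    rw [memK] at hm ⊢
    rw [← hπ.pow, hm, map_zero]
  obtain ⟨π'', hπ''⟩ := exists_quot_proj π (K n) fun d m hm ↦ by
    rw [memK] at hm ⊢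
    rw [← hπ.pow, hm, map_zero]
  have hP'' : IsProj x π'' := hπ.of_surjective hπ'' (Submodule.mkQ_surjective _)
  refine Good.of_exact hπ hπ' hπ'' (Submodule.subtype_injective _) (Submodule.mkQ_surjective _)
    (fun m hm ↦ ⟨⟨m, by simpa using hm⟩, rfl⟩) ?_ ?_
  · refine ih _ ?_ _ π' (hπ.of_injective hπ' (Submodule.subtype_injective _)) rfl
    rw [← hk]
    refine Set.ncard_lt_ncard ⟨fun i hi ⟨N, h⟩ ↦ hi ⟨N, fun m ↦ Subtype.ext (h m)⟩, fun h ↦ ?_⟩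
      (Set.toFinite _)
    exact h hl ⟨n, fun m ↦ Subtype.ext m.2⟩
  · let Q := LinearMap.range (mulx (M ⧸ K n) x l)
    obtain ⟨π₃, hπ₃⟩ := exists_quot_proj π'' Q fun d m hm ↦ by
      obtain ⟨m, rfl⟩ := hm
      rcases d with _ | d
      · rw [mulx_apply, hP''.zero]; exact zero_mem _
      · rw [mulx_apply, hP''.succ]; exact ⟨_, rfl⟩
    refine Good.of_torsionFree hP'' hπ₃ (Submodule.mkQ_surjective Q) l ?_ ?_ ?_ ?_
    · intro m hm
      obtain ⟨m, rfl⟩ := Submodule.mkQ_surjective _ m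
      rw [← map_smul, ← LinearMap.mem_ker, Submodule.ker_mkQ, memK, smul_smul, ← pow_succ,
        ← memK, ← hn (n + 1) (by omega)] at hm
      simpa using hm
    · intro m hm
      rw [← LinearMap.mem_ker, Submodule.ker_mkQ] at hm
      exact hm
    · intro m
      rw [← LinearMap.mem_ker, Submodule.ker_mkQ]
      exact ⟨m, rfl⟩
    · refine ih _ ?_ _ π₃ (hP''.of_surjective hπ₃ (Submodule.mkQ_surjective _)) rfl
      rw [← hk]
      refine Set.ncard_lt_ncard ⟨fun i hi ⟨N, h⟩ ↦ hi ⟨N, fun m ↦ ?_⟩, fun h ↦ ?_⟩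
        (Set.toFinite _)
      · obtain ⟨m, rfl⟩ := Submodule.mkQ_surjective _ m
        obtain ⟨m, rfl⟩ := Submodule.mkQ_surjective _ m
        rw [← map_smul, ← map_smul, h, map_zero, map_zero]
      · refine h hl ⟨1, fun m ↦ ?_⟩
        obtain ⟨m, rfl⟩ := Submodule.mkQ_surjective _ m
        rw [← map_smul, ← LinearMap.mem_ker, Submodule.ker_mkQ, pow_one]
        exact ⟨m, rfl⟩

end

section Homogeneous

variable {σ A : Type*} [CommRing A]

open MvPolynomial

lemma homogeneousComponent_succ_X_mul (i : σ) (d : ℕ) (r : MvPolynomial σ A) :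
    homogeneousComponent (d + 1) (X i * r) = X i * homogeneousComponent d r := by
  classical
  ext m
  rw [coeff_homogeneousComponent, coeff_X_mul', coeff_X_mul', coeff_homogeneousComponent]
  by_cases hi : i ∈ m.support
  · obtain ⟨m', rfl⟩ : ∃ m', m = m' + Finsupp.single i 1 := by
      refine ⟨m - Finsupp.single i 1, (tsub_add_cancel_of_le ?_).symm⟩
      rw [Finsupp.single_le_iff]
      exact Nat.one_le_iff_ne_zero.mpr (Finsupp.mem_support_iff.mp hi)
    simp [hi]
  · simp [hi]

lemma homogeneousComponent_zero_X_mul (i : σ) (r : MvPolynomial σ A) :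
    homogeneousComponent 0 (X i * r) = 0 := by
  classical
  rw [homogeneousComponent_zero, coeff_X_mul']
  simp

lemma isProj_mvPolynomial [Finite σ] :
    IsProj (A := A) (M := MvPolynomial σ A) (X : σ → MvPolynomial σ A)
      (fun d ↦ homogeneousComponent d) where
  idem d r := homogeneousComponent_eq_self (homogeneousComponent_isHomogeneous d r)
  succ i d r := homogeneousComponent_succ_X_mul i d r
  zero i r := homogeneousComponent_zero_X_mul i r
  bdd r := ⟨r.totalDegree + 1, fun d hd ↦ homogeneousComponent_eq_zero d r (by omega)⟩
  fg d := by
    have : LinearMap.range (homogeneousComponent d) = homogeneousSubmodule σ A d := by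
      apply le_antisymm
      · rintro _ ⟨r, rfl⟩
        exact homogeneousComponent_isHomogeneous d r
      · exact fun r hr ↦ ⟨r, homogeneousComponent_eq_self hr⟩
    rw [this]
    exact homogeneousSubmodule_fg _ _ d

lemma sub_algebraMap_mem_span_X (r : MvPolynomial σ A) :
    ∃ a, r - algebraMap A _ a ∈ Ideal.span (Set.range (X : σ → MvPolynomial σ A)) := by
  induction r using MvPolynomial.induction_on with
  | C a => exact ⟨a, by simp [MvPolynomial.algebraMap_eq]⟩
  | add p q hp hq =>
    obtain ⟨a, ha⟩ := hp
    obtain ⟨b, hb⟩ := hq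
    exact ⟨a + b, by rw [map_add, add_sub_add_comm]; exact add_mem ha hb⟩
  | mul_X p i hp =>
    exact ⟨0, by
      rw [map_zero, sub_zero]
      exact Ideal.mul_mem_left _ _ (Ideal.subset_span ⟨i, rfl⟩)⟩

end Homogeneous

section Rees

variable {A L ι : Type*} [CommRing A] [Field L] [Algebra A L] (J : Ideal A) (s : ι → L)

/-- The `p`-th step of the `J`-adic filtration of the `d`-th power of the span of `s`. -/
abbrev FU (p d : ℕ) : Submodule A L := J ^ p • (Submodule.span A (Set.range s)) ^ d

lemma FU_mul {p d q e : ℕ} {u v : L} (hu : u ∈ FU J s p d) (hv : v ∈ FU J s q e) :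
    u * v ∈ FU J s (p + q) (d + e) := by
  refine Submodule.smul_induction_on hu (fun a ha u hu ↦ ?_) (fun _ _ h h' ↦ by
    rw [add_mul]; exact add_mem h h')
  refine Submodule.smul_induction_on hv (fun b hb v hv ↦ ?_) (fun _ _ h h' ↦ by
    rw [mul_add]; exact add_mem h h')
  rw [smul_mul_smul_comm, FU, pow_add, pow_add]
  exact Submodule.smul_mem_smul (Ideal.mul_mem_mul ha hb) (Submodule.mul_mem_mul hu hv)

variable {s} in
lemma mem_FU (i : ι) : s i ∈ FU J s 0 1 := by
  have : s i ∈ Submodule.span A (Set.range s) := Submodule.subset_span (Set.mem_range_self i)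
  simpa [FU] using this

lemma one_mem_FU : (1 : L) ∈ FU J s 0 0 := by
  have : (1 : L) ∈ (1 : Submodule A L) := Submodule.one_le.mp le_rfl
  simpa [FU] using this

lemma pow_mem_FU {p d : ℕ} {u : L} (hu : u ∈ FU J s p d) (n : ℕ) :
    u ^ n ∈ FU J s (n * p) (n * d) := by
  induction n with
  | zero => simpa using one_mem_FU J s
  | succ n ih => rw [pow_succ, add_mul, add_mul, one_mul, one_mul]; exact FU_mul J s ih hu

variable {J s} in
lemma FU_anti {p q d : ℕ} (h : p ≤ q) : FU J s q d ≤ FU J s p d :=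
  Submodule.smul_mono_left (Ideal.pow_le_pow_right h)

open Polynomial

/-- The Rees algebra, as a commutative ring. -/
def Rees {A : Type*} [CommRing A] (J : Ideal A) : Type _ := reesAlgebra J

noncomputable instance : CommRing (Rees J) := inferInstanceAs (CommRing (reesAlgebra J))

/-- The inclusion of the Rees algebra in the polynomial ring. -/
noncomputable def Rees.val : Rees J →+* A[X] := (reesAlgebra J).val.toRingHom

lemma Rees.coeff_val_mem (a : Rees J) (p : ℕ) : (Rees.val J a).coeff p ∈ J ^ p :=
  (mem_reesAlgebra_iff J a.1).mp a.2 p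

variable {J} in
lemma Rees.exists_val_eq {a : A} {p : ℕ} (ha : a ∈ J ^ p) :
    ∃ b : Rees J, Rees.val J b = monomial p a :=
  ⟨⟨monomial p a, reesAlgebra.monomial_mem.mpr ha⟩, rfl⟩

instance [IsNoetherianRing A] : IsNoetherianRing (Rees J) :=
  inferInstanceAs (IsNoetherianRing (reesAlgebra J))

/-- The homomorphism with image the bigraded Rees algebra `⨁ J ^ p • (span s) ^ d`. -/
noncomputable def reesHom : MvPolynomial ι (Rees J) →+* L[X][X] :=
  MvPolynomial.eval₂Hom (C.comp ((mapRingHom (algebraMap A L)).comp (Rees.val J)))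
    (fun i ↦ C (C (s i)) * X)

lemma reesHom_C (a : Rees J) :
    reesHom J s (MvPolynomial.C a) = C (mapRingHom (algebraMap A L) (Rees.val J a)) := by
  simp [reesHom]

lemma reesHom_X (i : ι) : reesHom J s (MvPolynomial.X i) = C (C (s i)) * X := by
  simp [reesHom]

lemma reesHom_homogeneousComponent (r : MvPolynomial ι (Rees J)) (d : ℕ) :
    reesHom J s (MvPolynomial.homogeneousComponent d r) =
      monomial d ((reesHom J s r).coeff d) := by
  induction r using MvPolynomial.induction_on generalizing d with
  | C a =>
    rw [MvPolynomial.homogeneousComponent_of_mem (MvPolynomial.isHomogeneous_C _ a)]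
    split_ifs with h
    · subst h
      simp [reesHom_C]
    · simp [reesHom_C, coeff_C, h]
  | add p q hp hq => simp [hp, hq]
  | mul_X p i hp =>
    rw [mul_comm]
    cases d with
    | zero => rw [homogeneousComponent_zero_X_mul]; simp [reesHom_X]
    | succ d =>
      rw [homogeneousComponent_succ_X_mul, map_mul, hp, map_mul, reesHom_X, mul_assoc, mul_assoc, coeff_C_mul,
        coeff_X_mul, X_mul_monomial, C_mul_monomial]

lemma coeff_reesHom_mem (r : MvPolynomial ι (Rees J)) (d p : ℕ) :
    ((reesHom J s r).coeff d).coeff p ∈ FU J s p d := by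
  induction r using MvPolynomial.induction_on generalizing d p with
  | C a =>
    rw [reesHom_C, coeff_C]
    split_ifs with h
    · subst h
      rw [coe_mapRingHom, coeff_map, Algebra.algebraMap_eq_smul_one, FU, pow_zero]
      exact Submodule.smul_mem_smul (Rees.coeff_val_mem J a p)
        (Submodule.one_le.mp le_rfl)
    · simp
  | add p q hp hq =>
    rw [map_add, coeff_add, coeff_add]
    exact add_mem (hp _ _) (hq _ _)
  | mul_X r i hp =>
    rw [mul_comm, map_mul, reesHom_X, mul_assoc, coeff_C_mul, coeff_C_mul]
    cases d with
    | zero => simp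
    | succ d =>
      rw [coeff_X_mul, mul_comm]
      have := FU_mul J s (hp d p) (mem_FU J i)
      rwa [add_zero] at this

lemma exists_reesHom_eq {p d : ℕ} {v : L} (hv : v ∈ FU J s p d) :
    ∃ r, reesHom J s r = monomial d (monomial p v) := by
  have h1 (d : ℕ) : ∀ v ∈ (Submodule.span A (Set.range s)) ^ d,
      ∃ r, reesHom J s r = monomial d (monomial 0 v) := by
    have hA (a : A) : ∃ r, reesHom J s r = monomial 0 (monomial 0 (algebraMap A L a)) := by
      obtain ⟨b, hb⟩ := Rees.exists_val_eq (J := J) (p := 0) (a := a) (by simp)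
      exact ⟨MvPolynomial.C b, by rw [reesHom_C, hb]; simp⟩
    intro v hv
    induction hv using Submodule.pow_induction_on_left' with
    | algebraMap a => exact hA a
    | add u v i hu hv h h' =>
      obtain ⟨r, hr⟩ := h
      obtain ⟨r', hr'⟩ := h'
      exact ⟨r + r', by simp [hr, hr']⟩
    | mem_mul u hu i v hv h =>
      obtain ⟨r, hr⟩ := h
      induction hu using Submodule.span_induction with
      | mem u hu =>
        obtain ⟨j, rfl⟩ := hu
        refine ⟨MvPolynomial.X j * r, ?_⟩
        rw [map_mul, reesHom_X, hr, mul_assoc, X_mul_monomial, C_mul_monomial, C_mul_monomial]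
      | zero => exact ⟨0, by simp⟩
      | add u u' _ _ h h' =>
        obtain ⟨r, hr⟩ := h
        obtain ⟨r', hr'⟩ := h'
        exact ⟨r + r', by simp [hr, hr', add_mul]⟩
      | smul a u _ h =>
        obtain ⟨r, hr⟩ := h
        obtain ⟨r', hr'⟩ := hA a
        exact ⟨r' * r, by simp [hr, hr', Algebra.smul_def, mul_assoc]⟩
  refine Submodule.smul_induction_on hv (fun a ha u hu ↦ ?_) ?_
  · obtain ⟨r, hr⟩ := h1 d u hu
    obtain ⟨b, hb⟩ := Rees.exists_val_eq ha
    refine ⟨MvPolynomial.C b * r, ?_⟩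
    rw [map_mul, reesHom_C, hr, hb, C_mul_monomial]
    simp [Algebra.smul_def]
  · rintro u v ⟨r, hr⟩ ⟨r', hr'⟩
    exact ⟨r + r', by simp [hr, hr']⟩

end Rees

section Filtration

variable {A L ι : Type*} [CommRing A] [Field L] [Algebra A L] (J : Ideal A) (s : ι → L)

/-- Fractions whose numerators with denominator `σ ^ n`, of degree `e * n`, lie in the `p`-th step
of the filtration. -/
def Fil (σ : L) (e p : ℕ) : Submodule A L where
  carrier := {γ | ∀ᶠ n in atTop, γ * σ ^ n ∈ FU J s p (e * n)}
  zero_mem' := .of_forall fun n ↦ by simp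
  add_mem' := fun ha hb ↦ by
    filter_upwards [ha, hb] with n h h'
    rw [add_mul]; exact add_mem h h'
  smul_mem' := fun a b hb ↦ by
    filter_upwards [hb] with n h
    rw [smul_mul_assoc]; exact Submodule.smul_mem _ a h

variable {J s}

lemma mem_Fil_of_exists {σ γ : L} {e p : ℕ} (hσ : σ ∈ FU J s 0 e)
    (h : ∃ n, γ * σ ^ n ∈ FU J s p (e * n)) : γ ∈ Fil J s σ e p := by
  obtain ⟨n, hn⟩ := h
  refine eventually_atTop.mpr ⟨n, fun k hk ↦ ?_⟩
  obtain ⟨k, rfl⟩ := Nat.exists_eq_add_of_le hk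
  have := FU_mul J s hn (pow_mem_FU J s hσ k)
  rwa [mul_zero, add_zero, mul_assoc, ← pow_add, mul_comm k, ← mul_add] at this

lemma exists_of_mem_Fil {σ γ : L} {e p : ℕ} (h : γ ∈ Fil J s σ e p) :
    ∃ n, γ * σ ^ n ∈ FU J s p (e * n) := h.exists

lemma mul_mem_FU (i j : ι) : s i * s j ∈ FU J s 0 2 := by
  have := FU_mul J s (mem_FU J i) (mem_FU J j)
  rwa [add_zero, one_add_one_eq_two] at this

variable (J s) in
/-- Cocycles with values in the `p`-th step of the filtration. -/
def ZL (p : ℕ) : Submodule A (ι → ι → L) where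
  carrier := {c | (∀ i j, c i j ∈ Fil J s (s i * s j) 2 p) ∧ ∀ i j k, c i j - c i k + c j k = 0}
  zero_mem' := ⟨fun i j ↦ zero_mem _, by simp⟩
  add_mem' := fun ha hb ↦ ⟨fun i j ↦ add_mem (ha.1 i j) (hb.1 i j), fun i j k ↦ by
    have := congr($(ha.2 i j k) + $(hb.2 i j k))
    rw [add_zero] at this
    rw [← this]; simp only [Pi.add_apply]; ring⟩
  smul_mem' := fun a b hb ↦ ⟨fun i j ↦ Submodule.smul_mem _ a (hb.1 i j), fun i j k ↦ by
    simp only [Pi.smul_apply, ← smul_sub, ← smul_add, hb.2 i j k, smul_zero]⟩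

variable (J s) in
/-- Coboundaries of cochains with values in the `p`-th step of the filtration. -/
def BL (p : ℕ) : Submodule A (ι → ι → L) where
  carrier := {c | ∃ b : ι → L, (∀ i, b i ∈ Fil J s (s i) 1 p) ∧ ∀ i j, c i j = b j - b i}
  zero_mem' := ⟨0, fun i ↦ zero_mem _, by simp⟩
  add_mem' := by
    rintro _ _ ⟨b, hb, h⟩ ⟨b', hb', h'⟩
    refine ⟨b + b', fun i ↦ add_mem (hb i) (hb' i), fun i j ↦ ?_⟩
    simp only [Pi.add_apply, h, h']; ring
  smul_mem' := by
    rintro a _ ⟨b, hb, h⟩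
    refine ⟨a • b, fun i ↦ Submodule.smul_mem _ a (hb i), fun i j ↦ ?_⟩
    simp only [Pi.smul_apply, h, smul_sub]

end Filtration

section Extraction

lemma RelFG.exists_fin {A V : Type*} [CommRing A] [AddCommGroup V] [Module A V]
    {P Q : Submodule A V} (h : RelFG P Q) : ∃ (r : ℕ) (g : Fin r → V), (∀ k, g k ∈ P) ∧
      ∀ v ∈ P, ∃ a : Fin r → A, v - ∑ k, a k • g k ∈ Q := by
  obtain ⟨P₁, hle, hfg, heq⟩ := exists_fg_le_map_eq h
  obtain ⟨r, g, rfl⟩ := Submodule.fg_iff_exists_fin_generating_family.mp hfg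
  refine ⟨r, g, fun k ↦ hle (Submodule.subset_span ⟨k, rfl⟩), fun v hv ↦ ?_⟩
  obtain ⟨w, hw, hwv⟩ : Q.mkQ v ∈ (Submodule.span A (Set.range g)).map Q.mkQ :=
    heq ▸ Submodule.mem_map_of_mem hv
  obtain ⟨a, rfl⟩ := (Submodule.mem_span_range_iff_exists_fun A).mp hw
  exact ⟨a, (Submodule.Quotient.eq Q).mp hwv.symm⟩

variable {A L ι : Type*} [CommRing A] [Field L] [Algebra A L] (J : Ideal A) (s : ι → L)

open Polynomial

/-- The bigraded Rees algebra `⨁ J ^ p • (span s) ^ d`. -/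
abbrev ReesM : Type _ := MvPolynomial ι (Rees J) ⧸ RingHom.ker (reesHom J s)

/-- The embedding of the bigraded Rees algebra into a polynomial ring. -/
noncomputable def reesLift : ReesM J s →+* L[X][X] := RingHom.kerLift (reesHom J s)

variable {J s}

lemma reesLift_injective : Function.Injective (reesLift J s) := RingHom.kerLift_injective _

@[simp] lemma reesLift_mk (r : MvPolynomial ι (Rees J)) :
    reesLift J s (Ideal.Quotient.mk _ r) = reesHom J s r := RingHom.kerLift_mk _ r

lemma reesLift_smul (r : MvPolynomial ι (Rees J)) (m : ReesM J s) :
    reesLift J s (r • m) = reesHom J s r * reesLift J s m := by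
  obtain ⟨m, rfl⟩ := Ideal.Quotient.mk_surjective m
  rw [reesLift_mk, ← map_mul, ← reesLift_mk]; rfl

lemma reesLift_smul' (a : Rees J) (m : ReesM J s) :
    reesLift J s (a • m) = C (mapRingHom (algebraMap A L) (Rees.val J a)) * reesLift J s m := by
  rw [← reesHom_C J s, ← reesLift_smul]
  congr 1
  exact (algebraMap_smul (MvPolynomial ι (Rees J)) a m).symm

variable (J s) in
lemma exists_isProj_rees [Finite ι] : ∃ π : ℕ → ReesM J s →ₗ[Rees J] ReesM J s,
    IsProj (MvPolynomial.X : ι → MvPolynomial ι (Rees J)) π ∧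
    ∀ d m, reesLift J s (π d m) = monomial d ((reesLift J s m).coeff d) := by
  obtain ⟨π, hπ⟩ := exists_quot_proj (A := Rees J)
    (fun d ↦ MvPolynomial.homogeneousComponent d) (RingHom.ker (reesHom J s)) (fun d m hm ↦ by
      rw [RingHom.mem_ker] at hm ⊢
      rw [reesHom_homogeneousComponent, hm, coeff_zero, map_zero])
  refine ⟨π, isProj_mvPolynomial.of_surjective hπ (Submodule.mkQ_surjective _), fun d m ↦ ?_⟩
  obtain ⟨m, rfl⟩ := Ideal.Quotient.mk_surjective m
  rw [reesLift_mk, ← reesHom_homogeneousComponent, ← reesLift_mk]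
  exact congr(reesLift J s $(hπ d m)).symm

lemma coeff_reesLift_mem (m : ReesM J s) (d p : ℕ) :
    ((reesLift J s m).coeff d).coeff p ∈ FU J s p d := by
  obtain ⟨m, rfl⟩ := Ideal.Quotient.mk_surjective m
  exact coeff_reesHom_mem J s m d p

lemma exists_reesLift_eq {p d : ℕ} {v : L} (hv : v ∈ FU J s p d) :
    ∃ m, reesLift J s m = monomial d (monomial p v) := by
  obtain ⟨r, hr⟩ := exists_reesHom_eq J s hv
  exact ⟨Ideal.Quotient.mk _ r, by rw [reesLift_mk, hr]⟩

lemma reesHom_pow {r : MvPolynomial ι (Rees J)} {e : ℕ} {σ : L}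
    (h : reesHom J s r = monomial e (C σ)) (n : ℕ) :
    reesHom J s (r ^ n) = monomial (e * n) (C (σ ^ n)) := by
  rw [map_pow, h, monomial_pow, C_pow]

lemma reesHom_X' (i : ι) : reesHom J s (MvPolynomial.X i) = monomial 1 (C (s i)) := by
  rw [reesHom_X, C_mul_X_eq_monomial]

lemma reesHom_X_mul_X (i j : ι) :
    reesHom J s (MvPolynomial.X i * MvPolynomial.X j) = monomial 2 (C (s i * s j)) := by
  rw [map_mul, reesHom_X', reesHom_X', monomial_mul_monomial, C_mul]

variable {π : ℕ → ReesM J s →ₗ[Rees J] ReesM J s}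

lemma exists_polynomial (hπ : ∀ d m, reesLift J s (π d m) = monomial d ((reesLift J s m).coeff d))
    {r : MvPolynomial ι (Rees J)} {e : ℕ} {σ : L} (hr : reesHom J s r = monomial e (C σ))
    (hσ : σ ≠ 0) {h : ℕ → ReesM J s}
    (hh : ∀ᶠ n in atTop, h (n + 1) = r • h n ∧ π (0 + e * n) (h n) = h n) :
    ∃ Γ : L[X], (∀ᶠ n in atTop, reesLift J s (h n) = monomial (e * n) (Γ * C (σ ^ n))) ∧
      ∀ q, Γ.coeff q ∈ Fil J s σ e q := by
  obtain ⟨N₁, hN₁⟩ := eventually_eq_pow_smul (hh.mono fun _ h ↦ h.1)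
  obtain ⟨N₂, hN₂⟩ := eventually_atTop.mp hh
  set N := max N₁ N₂ with hN
  set P := (reesLift J s (h N)).coeff (e * N) with hP
  have hPN : reesLift J s (h N) = monomial (e * N) P := by
    have := hπ (0 + e * N) (h N)
    rwa [(hN₂ N (le_max_right _ _)).2, zero_add] at this
  have key : ∀ᶠ n in atTop, reesLift J s (h n) =
      monomial (e * n) (P * C (σ ^ N)⁻¹ * C (σ ^ n)) := by
    filter_upwards [eventually_ge_atTop N] with n hn
    obtain ⟨k, rfl⟩ := Nat.exists_eq_add_of_le hn
    rw [hN₁ N (le_max_left _ _), reesLift_smul, reesHom_pow hr, hPN, monomial_mul_monomial,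
      ← mul_add, add_comm k, mul_assoc, ← C_mul, pow_add, inv_mul_cancel_left₀ (pow_ne_zero _ hσ),
      mul_comm (C _)]
  refine ⟨_, key, fun q ↦ ?_⟩
  filter_upwards [key] with n hn
  have := coeff_reesLift_mem (h n) (e * n) q
  rwa [hn, coeff_monomial_same, coeff_mul_C] at this

lemma exists_polynomial_cocycle (hs : ∀ i, s i ≠ 0)
    (hπ : ∀ d m, reesLift J s (π d m) = monomial d ((reesLift J s m).coeff d))
    {g : ι → ι → ℕ → ReesM J s} (hg : g ∈ Z1 (MvPolynomial.X : ι → MvPolynomial ι (Rees J)) π 0) :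
    ∃ Γ : ι → ι → L[X], (∀ i j, ∀ᶠ n in atTop, reesLift J s (g i j n) =
      monomial (2 * n) (Γ i j * C ((s i * s j) ^ n))) ∧
      ∀ q, (fun i j ↦ (Γ i j).coeff q) ∈ ZL J s q := by
  have this := fun i j ↦ exists_polynomial hπ (reesHom_X_mul_X i j) (mul_ne_zero (hs i) (hs j)) (hg.1 i j)
  choose Γ h1 h2 using this
  refine ⟨Γ, h1, fun q ↦ ⟨fun i j ↦ h2 i j q, fun i j k ↦ ?_⟩⟩
  obtain ⟨n, hn, h1, h2, h3⟩ := ((hg.2 i j k).and ((h1 i j).and ((h1 i k).and (h1 j k)))).exists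
  apply_fun reesLift J s at hn
  rw [map_add, map_sub, reesLift_smul, reesLift_smul, reesLift_smul, h1, h2, h3,
    reesHom_pow (reesHom_X' _), reesHom_pow (reesHom_X' _), reesHom_pow (reesHom_X' _),
    monomial_mul_monomial, monomial_mul_monomial, monomial_mul_monomial, map_zero,
    ← map_sub, ← map_add, monomial_eq_zero_iff] at hn
  have : (Γ i j - Γ i k + Γ j k) * C ((s i * s j * s k) ^ n) = 0 := by
    rw [← hn]; simp only [mul_pow, C_mul]; ring
  rw [mul_eq_zero, C_eq_zero] at this
  have := this.resolve_right (pow_ne_zero _ (mul_ne_zero (mul_ne_zero (hs i) (hs j)) (hs k)))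
  rw [← coeff_sub, ← coeff_add, this, coeff_zero]

lemma exists_cocycle
    (hπ : ∀ d m, reesLift J s (π d m) = monomial d ((reesLift J s m).coeff d)) {p : ℕ}
    {c : ι → ι → L} (hc : c ∈ ZL J s p) :
    ∃ g ∈ Z1 (MvPolynomial.X : ι → MvPolynomial ι (Rees J)) π 0, ∀ i j, ∀ᶠ n in atTop,
      reesLift J s (g i j n) = monomial (2 * n) (monomial p (c i j * (s i * s j) ^ n)) := by
  have h (i j) : ∀ᶠ n in atTop, ∃ m, reesLift J s m =
      monomial (2 * n) (monomial p (c i j * (s i * s j) ^ n)) :=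
    (hc.1 i j).mono fun n hn ↦ exists_reesLift_eq hn
  simp_rw [Filter.skolem] at h
  choose g hg using h
  refine ⟨g, ⟨fun i j ↦ ?_, fun i j k ↦ ?_⟩, hg⟩
  · filter_upwards [hg i j, (tendsto_add_atTop_nat 1).eventually (hg i j)] with n h1 h2
    refine ⟨reesLift_injective ?_, reesLift_injective ?_⟩
    · rw [h2, reesLift_smul, h1, reesHom_X_mul_X, monomial_mul_monomial, C_mul_monomial]
      congr 2 <;> ring
    · rw [hπ, h1, zero_add, coeff_monomial_same]
  · filter_upwards [hg i j, hg i k, hg j k] with n h1 h2 h3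
    refine reesLift_injective ?_
    rw [map_add, map_sub, reesLift_smul, reesLift_smul, reesLift_smul, h1, h2, h3,
      reesHom_pow (reesHom_X' _), reesHom_pow (reesHom_X' _), reesHom_pow (reesHom_X' _),
      monomial_mul_monomial, monomial_mul_monomial, monomial_mul_monomial, map_zero,
      ← map_sub, ← map_add, C_mul_monomial, C_mul_monomial, C_mul_monomial, ← map_sub, ← map_add]
    have : s k ^ n * (c i j * (s i * s j) ^ n) - s j ^ n * (c i k * (s i * s k) ^ n) +
        s i ^ n * (c j k * (s j * s k) ^ n) = 0 := by
      linear_combination (s i * s j * s k) ^ n * hc.2 i j k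
    rw [this, map_zero, map_zero]

variable (J) in
/-- The finiteness of the first Čech cohomology of the bigraded Rees algebra, in degree zero. -/
theorem exists_generators [IsNoetherianRing A] [Finite ι] (hs : ∀ i, s i ≠ 0) :
    ∃ (r : ℕ) (Γ : Fin r → ι → ι → L[X]), (∀ k q, (fun i j ↦ (Γ k i j).coeff q) ∈ ZL J s q) ∧
      ∀ p, ∀ c ∈ ZL J s p, ∃ a : Fin r → Rees J, ∃ b ∈ BL J s p, ∀ i j,
        c i j = ∑ k, (mapRingHom (algebraMap A L) (Rees.val J (a k)) * Γ k i j).coeff p + b i j := by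
  obtain ⟨π, hP, hπ⟩ := exists_isProj_rees J s
  obtain ⟨r, g, hg, hgen⟩ := ((good_of_isNoetherian sub_algebraMap_mem_span_X
    (ReesM J s) hP).fg1 0).exists_fin
  have this := fun k ↦ exists_polynomial_cocycle hs hπ (hg k)
  choose Γ h1 h2 using this
  refine ⟨r, Γ, h2, fun p c hc ↦ ?_⟩
  obtain ⟨g', hg', hcg⟩ := exists_cocycle hπ hc
  obtain ⟨a, b, hb, hcob⟩ := hgen g' hg'
  have this := fun i ↦ exists_polynomial hπ (e := 1) (reesHom_X' i) (hs i) (by simpa using hb i)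
  choose β h3 h4 using this
  refine ⟨a, fun i j ↦ (β j - β i).coeff p, ⟨fun i ↦ (β i).coeff p, fun i ↦ h4 i p,
    fun i j ↦ coeff_sub ..⟩, fun i j ↦ ?_⟩
  obtain ⟨n, hn, hi, hj, hij, hall⟩ := ((hcob i j).and ((h3 i).and ((h3 j).and
    ((hcg i j).and (eventually_all.mpr fun k ↦ h1 k i j))))).exists
  apply_fun reesLift J s at hn
  rw [map_sub, reesLift_smul, reesLift_smul, hi, hj, reesHom_pow (reesHom_X' _),
    reesHom_pow (reesHom_X' _), monomial_mul_monomial, monomial_mul_monomial, ← map_sub,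
    Pi.sub_apply, Pi.sub_apply, Pi.sub_apply, map_sub, hij, ← two_mul, one_mul] at hn
  simp only [Finset.sum_apply, Pi.smul_apply, map_sum, reesLift_smul', hall, C_mul_monomial] at hn
  rw [← map_sum, ← map_sub] at hn
  have hn := monomial_injective _ hn
  have hne : (C ((s i * s j) ^ n) : L[X]) ≠ 0 :=
    C_ne_zero.mpr (pow_ne_zero _ (mul_ne_zero (hs i) (hs j)))
  have key : monomial p (c i j) =
      ∑ k, (mapRingHom (algebraMap A L) (Rees.val J (a k)) * Γ k i j) + (β j - β i) := by
    refine mul_right_cancel₀ hne ?_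
    rw [add_mul, Finset.sum_mul, monomial_mul_C, ← sub_eq_iff_eq_add']
    simp only [mul_assoc]
    rw [hn, mul_pow, C_mul]
    ring
  rw [← finsetSum_coeff, ← coeff_add, ← key, coeff_monomial_same]

end Extraction

section FilLemmas

variable {A L ι : Type*} [CommRing A] [Field L] [Algebra A L] {J : Ideal A} {s : ι → L}

lemma Fil_anti {σ : L} {e p q : ℕ} (h : p ≤ q) : Fil J s σ e q ≤ Fil J s σ e p :=
  fun γ (hγ : ∀ᶠ n in atTop, γ * σ ^ n ∈ FU J s q (e * n)) ↦ hγ.mono fun _ hn ↦ FU_anti h hn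

lemma mul_mem_Fil {σ γ δ : L} {e p q : ℕ} (hσ : σ ∈ FU J s 0 e) (hγ : γ ∈ Fil J s σ e p)
    (hδ : δ ∈ Fil J s σ e q) : γ * δ ∈ Fil J s σ e (p + q) := by
  obtain ⟨n, h1⟩ := exists_of_mem_Fil hγ
  obtain ⟨k, h2⟩ := exists_of_mem_Fil hδ
  refine mem_Fil_of_exists hσ ⟨n + k, ?_⟩
  have := FU_mul J s h1 h2
  rwa [← mul_add, mul_mul_mul_comm, ← pow_add] at this

lemma one_mem_Fil {σ : L} {e : ℕ} (hσ : σ ∈ FU J s 0 e) : (1 : L) ∈ Fil J s σ e 0 :=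
  mem_Fil_of_exists hσ ⟨0, by simpa using one_mem_FU J s⟩

lemma smul_mem_Fil {σ γ : L} {e p q : ℕ} {a : A} (ha : a ∈ J ^ q) (hγ : γ ∈ Fil J s σ e p) :
    a • γ ∈ Fil J s σ e (q + p) := by
  filter_upwards [hγ] with n hn
  rw [smul_mul_assoc, FU, pow_add, mul_smul]
  exact Submodule.smul_mem_smul ha hn

lemma Fil_le_left (i j : ι) {p : ℕ} : Fil J s (s i) 1 p ≤ Fil J s (s i * s j) 2 p := by
  intro γ hγ
  obtain ⟨n, hn⟩ := exists_of_mem_Fil hγ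
  refine mem_Fil_of_exists (mul_mem_FU i j) ⟨n, ?_⟩
  have := FU_mul J s hn (pow_mem_FU J s (mem_FU J j) n)
  rwa [mul_zero, add_zero, mul_assoc, ← mul_pow, one_mul, mul_one, ← two_mul] at this

lemma Fil_le_right (i j : ι) {p : ℕ} : Fil J s (s j) 1 p ≤ Fil J s (s i * s j) 2 p := by
  rw [mul_comm]; exact Fil_le_left j i

/-- The subring of fractions with denominators the powers of `σ`. -/
def filSubring (J : Ideal A) {s : ι → L} {σ : L} {e : ℕ} (hσ : σ ∈ FU J s 0 e) : Subring L where
  carrier := Fil J s σ e 0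
  mul_mem' := fun ha hb ↦ by
    have := mul_mem_Fil hσ ha hb
    rwa [add_zero] at this
  one_mem' := one_mem_Fil hσ
  add_mem' := add_mem
  zero_mem' := zero_mem _
  neg_mem' := fun ha ↦ (Fil J s σ e 0).neg_mem ha

lemma ZL_anti {p q : ℕ} (h : p ≤ q) : ZL J s q ≤ ZL J s p :=
  fun _ hc ↦ ⟨fun i j ↦ Fil_anti h (hc.1 i j), hc.2⟩

lemma BL_anti {p q : ℕ} (h : p ≤ q) : BL J s q ≤ BL J s p := by
  rintro c ⟨b, hb, h'⟩
  exact ⟨b, fun i ↦ Fil_anti h (hb i), h'⟩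

lemma smul_mem_ZL {p q : ℕ} {a : A} (ha : a ∈ J ^ q) {c : ι → ι → L} (hc : c ∈ ZL J s p) :
    a • c ∈ ZL J s (q + p) :=
  ⟨fun i j ↦ smul_mem_Fil ha (hc.1 i j), (Submodule.smul_mem _ a hc).2⟩

lemma pow_succ_smul_ZL_zero (K : ℕ) : J ^ (K + 1) • ZL J s 0 ≤ J ^ K • ZL J s 1 := by
  rw [pow_succ, mul_smul]
  refine Submodule.smul_mono le_rfl (Submodule.smul_le.mpr fun a ha c hc ↦ ?_)
  have := smul_mem_ZL (q := 1) (by rwa [pow_one]) hc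
  rwa [add_zero] at this

end FilLemmas

section Krull

variable {A L ι : Type*} [CommRing A] [Field L] [Algebra A L] {J : Ideal A} {s : ι → L}

open Polynomial

lemma exists_combination [IsNoetherianRing A] [Finite ι] (hs : ∀ i, s i ≠ 0) :
    ∃ (r Q : ℕ) (g : Fin r → ℕ → ι → ι → L), (∀ k q, g k q ∈ ZL J s q) ∧ ∀ p, ∀ c ∈ ZL J s p,
      ∃ a : Fin r → ℕ → A, (∀ k q, a k q ∈ J ^ (p - q)) ∧
        c - ∑ k, ∑ q ∈ Finset.range (Q + 1), a k q • g k q ∈ BL J s p := by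
  classical
  cases nonempty_fintype ι
  obtain ⟨r, Γ, hΓ, h⟩ := exists_generators J hs
  obtain ⟨Q, hQ⟩ : ∃ Q, ∀ k i j, (Γ k i j).natDegree ≤ Q :=
    ⟨∑ k, ∑ i, ∑ j, (Γ k i j).natDegree, fun k i j ↦
      (Finset.single_le_sum (f := fun j ↦ (Γ k i j).natDegree) (by simp) (Finset.mem_univ j)).trans
      ((Finset.single_le_sum (f := fun i ↦ ∑ j, (Γ k i j).natDegree) (by simp)
        (Finset.mem_univ i)).trans
      (Finset.single_le_sum (f := fun k ↦ ∑ i, ∑ j, (Γ k i j).natDegree) (by simp)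
        (Finset.mem_univ k)))⟩
  refine ⟨r, Q, fun k q i j ↦ (Γ k i j).coeff q, hΓ, fun p c hc ↦ ?_⟩
  obtain ⟨a, b, hb, hab⟩ := h p c hc
  refine ⟨fun k q ↦ if q ≤ p then (Rees.val J (a k)).coeff (p - q) else 0, fun k q ↦ ?_, ?_⟩
  · dsimp only
    split_ifs
    · exact Rees.coeff_val_mem J _ _
    · exact zero_mem _
  convert hb using 1
  ext i j
  simp only [Pi.sub_apply, hab i j, Finset.sum_apply, Pi.smul_apply]
  rw [sub_eq_iff_eq_add, add_comm]
  congr 1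
  refine Finset.sum_congr rfl fun k _ ↦ ?_
  rw [mul_comm, coeff_mul, Finset.Nat.sum_antidiagonal_eq_sum_range_succ
    (fun x y ↦ (Γ k i j).coeff x * (mapRingHom (algebraMap A L) (Rees.val J (a k))).coeff y)]
  refine (Finset.sum_subset (s₁ := Finset.range (min p Q + 1)) (Finset.range_mono (by omega))
    fun q hq hq' ↦ ?_).symm.trans (.trans ?_ (Finset.sum_subset
    (s₁ := Finset.range (min p Q + 1)) (Finset.range_mono (by omega)) fun q hq hq' ↦ ?_))
  · rw [Finset.mem_range] at hq hq'
    rw [coeff_eq_zero_of_natDegree_lt (lt_of_le_of_lt (hQ k i j) (by omega)), zero_mul]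
  · refine Finset.sum_congr rfl fun q hq ↦ ?_
    rw [Finset.mem_range] at hq
    rw [if_pos (by omega), coe_mapRingHom, coeff_map, Algebra.smul_def, mul_comm]
  · rw [Finset.mem_range] at hq hq'
    rw [if_neg (by omega), zero_smul]

lemma mem_BL_one_of_forall [IsNoetherianRing A] [IsLocalRing A] [Finite ι] (hs : ∀ i, s i ≠ 0)
    (hJ : J ≠ ⊤) {c : ι → ι → L} (h : ∀ p, ∃ c' ∈ ZL J s p, c - c' ∈ BL J s 1) :
    c ∈ BL J s 1 := by
  obtain ⟨r, Q, g, hg, hgen⟩ := exists_combination (J := J) hs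
  set H := (ZL J s 1).map (BL J s 1).mkQ
  have hfg : H.FG := by
    refine Submodule.FG.of_le (T := (Submodule.span A
      (Set.range fun x : Fin r × Fin (Q + 1) ↦ g x.1 x.2)).map (BL J s 1).mkQ)
      (.map _ (Submodule.fg_span (Set.finite_range _))) ?_
    rintro _ ⟨c, hc, rfl⟩
    obtain ⟨a, -, hb⟩ := hgen 1 c hc
    refine ⟨∑ k, ∑ q ∈ Finset.range (Q + 1), a k q • g k q, ?_, ?_⟩
    · refine sum_mem fun k _ ↦ sum_mem fun q hq ↦ Submodule.smul_mem _ _ (Submodule.subset_span ?_)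
      exact ⟨(k, ⟨q, Finset.mem_range.mp hq⟩), rfl⟩
    · exact ((Submodule.Quotient.eq _).mpr hb).symm
  have hc : (BL J s 1).mkQ c ∈ H := by
    obtain ⟨c', hc', hcc'⟩ := h 1
    exact ⟨c', hc', ((Submodule.Quotient.eq _).mpr hcc').symm⟩
  have hK (K : ℕ) : (BL J s 1).mkQ c ∈ J ^ K • H := by
    obtain ⟨c', hc', hcc'⟩ := h (K + Q + 1)
    obtain ⟨a, ha, hb⟩ := hgen _ c' hc'
    have : (BL J s 1).mkQ c =
        (BL J s 1).mkQ (∑ k, ∑ q ∈ Finset.range (Q + 1), a k q • g k q) := by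
      refine ((Submodule.Quotient.eq _).mpr ?_)
      simpa using add_mem hcc' (BL_anti (by omega) hb)
    rw [this, ← Submodule.map_smul'']
    refine Submodule.mem_map_of_mem (sum_mem fun k _ ↦ sum_mem fun q hq ↦ ?_)
    rw [Finset.mem_range] at hq
    rcases Nat.eq_zero_or_pos q with rfl | hq0
    · refine pow_succ_smul_ZL_zero K (Submodule.smul_mem_smul ?_ (hg k 0))
      exact Ideal.pow_le_pow_right (by omega) (ha k 0)
    · refine Submodule.smul_mem_smul ?_ (ZL_anti hq0 (hg k q))
      exact Ideal.pow_le_pow_right (by omega) (ha k q)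
  have : Module.Finite A H := Module.Finite.iff_fg.mpr hfg
  have key : (⟨_, hc⟩ : H) ∈ (⨅ i : ℕ, J ^ i • (⊤ : Submodule A H)) := by
    refine Submodule.mem_iInf _ |>.mpr fun K ↦ ?_
    have h1 := hK K
    rw [← Submodule.map_subtype_top H, ← Submodule.map_smul''] at h1
    obtain ⟨y, hy, hyc⟩ := h1
    have : y = ⟨_, hc⟩ := Subtype.ext hyc
    rwa [← this]
  rw [Ideal.iInf_pow_smul_eq_bot_of_isLocalRing J hJ] at key
  have := congr_arg Subtype.val ((Submodule.mem_bot A).mp key)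
  exact (Submodule.Quotient.mk_eq_zero _).mp this

end Krull

section Newton

variable {A L ι : Type*} [CommRing A] [Field L] [Algebra A L] {J : Ideal A} {s : ι → L}

lemma exists_newton {σ : L} {d : ℕ} (hσ : σ ∈ FU J s 0 d) {e : L} (h0 : e ∈ Fil J s σ d 0)
    (h1 : e ^ 2 - e ∈ Fil J s σ d 1) (p : ℕ) :
    ∃ e', e' - e ∈ Fil J s σ d 1 ∧ e' ^ 2 - e' ∈ Fil J s σ d p := by
  suffices ∃ e', e' - e ∈ Fil J s σ d 1 ∧ e' ^ 2 - e' ∈ Fil J s σ d (p + 1) by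
    obtain ⟨e', h, h'⟩ := this
    exact ⟨e', h, Fil_anti (by omega) h'⟩
  induction p with
  | zero => exact ⟨e, by simp, h1⟩
  | succ p ih =>
    obtain ⟨e', h, h'⟩ := ih
    have he' : e' ∈ filSubring J hσ := by
      have : e' - e ∈ filSubring J hσ := Fil_anti (Nat.zero_le 1) h
      simpa using add_mem this (show e ∈ filSubring J hσ from h0)
    have hu : e' ^ 2 - e' ∈ filSubring J hσ := sub_mem (pow_mem he' 2) he'
    have hi (n : ℤ) : (n : L) ∈ filSubring J hσ := intCast_mem _ n
    refine ⟨3 * e' ^ 2 - 2 * e' ^ 3, ?_, ?_⟩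
    · have := mul_mem_Fil hσ (Fil_anti (p := 1) (by omega) h')
        (show 1 - (2 : ℤ) * e' ∈ filSubring J hσ from sub_mem (one_mem _) (mul_mem (hi _) he'))
      convert add_mem this h using 1
      push_cast; ring
    · have := mul_mem_Fil hσ (mul_mem_Fil hσ h' h')
        (show (4 : ℤ) * (e' ^ 2 - e') - (3 : ℤ) ∈ filSubring J hσ from
          sub_mem (mul_mem (hi _) hu) (hi _))
      have := Fil_anti (p := p + 1 + 1) (by omega) this
      convert this using 1
      push_cast; ring

lemma cube_sub_mem_Fil {σ : L} {d : ℕ} (hσ : σ ∈ FU J s 0 d) {a b : L}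
    (ha : a ∈ Fil J s σ d 0) (hb : b ∈ Fil J s σ d 0) {p : ℕ}
    (ha' : a ^ 2 - a ∈ Fil J s σ d p) (hb' : b ^ 2 - b ∈ Fil J s σ d p) :
    (a - b) ^ 3 - (a - b) ∈ Fil J s σ d p := by
  have ha : a ∈ filSubring J hσ := ha
  have hb : b ∈ filSubring J hσ := hb
  have h1 := mul_mem_Fil hσ ha' (show (a - b) + (1 - (b + b)) ∈ filSubring J hσ from
    add_mem (sub_mem ha hb) (sub_mem (one_mem _) (add_mem hb hb)))
  have h2 := mul_mem_Fil hσ hb' (show (a - b) - (1 - (a + a)) ∈ filSubring J hσ from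
    sub_mem (sub_mem ha hb) (sub_mem (one_mem _) (add_mem ha ha)))
  have h4 := add_mem h1 h2
  rw [add_zero] at h4
  have : (a - b) ^ 3 - (a - b) = (a ^ 2 - a) * (a - b + (1 - (b + b))) +
    (b ^ 2 - b) * (a - b - (1 - (a + a))) := by ring
  rwa [this]

lemma sub_mem_Fil_of_idempotents {σ : L} {d : ℕ} (hσ : σ ∈ FU J s 0 d) {a b : L}
    (ha : a ∈ Fil J s σ d 0) (hb : b ∈ Fil J s σ d 0) (h : a - b ∈ Fil J s σ d 1) {p : ℕ}
    (ha' : a ^ 2 - a ∈ Fil J s σ d p) (hb' : b ^ 2 - b ∈ Fil J s σ d p) :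
    a - b ∈ Fil J s σ d p := by
  have h3 := cube_sub_mem_Fil hσ ha hb ha' hb'
  suffices ∀ q ≤ p, a - b ∈ Fil J s σ d q from this p le_rfl
  intro q hq
  induction q with
  | zero => exact sub_mem ha hb
  | succ q ih =>
    rcases Nat.eq_zero_or_pos q with rfl | hq0
    · exact h
    have ih := ih (by omega)
    have := mul_mem_Fil hσ (mul_mem_Fil hσ ih ih) ih
    convert sub_mem (Fil_anti (p := q + 1) (by omega) this) (Fil_anti hq h3) using 1
    ring

/-- Gluing of idempotents modulo the maximal ideal, over a noetherian local ring. -/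
theorem exists_glue_of_isNoetherianRing [IsNoetherianRing A] [IsLocalRing A] [Finite ι]
    (hJ : J ≠ ⊤) (hs : ∀ i, s i ≠ 0) {e : ι → L} (h0 : ∀ i, e i ∈ Fil J s (s i) 1 0)
    (h1 : ∀ i j, e i - e j ∈ Fil J s (s i * s j) 2 1)
    (h2 : ∀ i, e i ^ 2 - e i ∈ Fil J s (s i) 1 1) : ∃ a : L, ∀ i, a - e i ∈ Fil J s (s i) 1 1 := by
  have key : (fun i j ↦ e j - e i) ∈ BL J s 1 := by
    refine mem_BL_one_of_forall hs hJ fun p ↦ ?_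
    choose e' h3 h4 using fun i ↦ exists_newton (mem_FU J i) (h0 i) (h2 i) p
    have h5 (i) : e' i ∈ Fil J s (s i) 1 0 := by
      simpa using add_mem (Fil_anti (Nat.zero_le 1) (h3 i)) (h0 i)
    refine ⟨fun i j ↦ e' j - e' i, ⟨fun i j ↦ ?_, fun i j k ↦ by ring⟩, fun i ↦ e i - e' i,
      fun i ↦ by simpa using neg_mem (h3 i), fun i j ↦ by simp only [Pi.sub_apply]; ring⟩
    refine sub_mem_Fil_of_idempotents (mul_mem_FU i j) (Fil_le_right i j (h5 j))
      (Fil_le_left i j (h5 i)) ?_ (Fil_le_right i j (h4 j)) (Fil_le_left i j (h4 i))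
    have := sub_mem (Fil_le_right i j (h3 j)) (add_mem (h1 i j) (Fil_le_left i j (h3 i)))
    convert this using 1
    ring
  obtain ⟨b, hb, hbe⟩ := key
  rcases isEmpty_or_nonempty ι with h | ⟨⟨i₀⟩⟩
  · exact ⟨0, fun i ↦ isEmptyElim i⟩
  refine ⟨e i₀ - b i₀, fun i ↦ ?_⟩
  convert neg_mem (hb i) using 1
  linear_combination -hbe i₀ i

end Newton

section BaseChange

variable {A A' L ι : Type*} [CommRing A] [CommRing A'] [Field L] [Algebra A L] [Algebra A' L]
  [Algebra A A'] [IsScalarTower A A' L] {J : Ideal A} {J' : Ideal A'} {s : ι → L}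

lemma FU_le_of_tower (h : J ≤ J'.comap (algebraMap A A')) {p d : ℕ} {u : L}
    (hu : u ∈ FU J s p d) : u ∈ FU J' s p d := by
  refine Submodule.smul_induction_on hu (fun a ha w hw ↦ ?_) fun _ _ ↦ add_mem
  rw [← algebraMap_smul A']
  refine Submodule.smul_mem_smul ?_ ?_
  · refine Ideal.pow_right_mono (Ideal.map_le_iff_le_comap.mpr h) p ?_
    rw [← Ideal.map_pow]
    exact Ideal.mem_map_of_mem _ ha
  · rw [Submodule.span_pow] at hw ⊢
    exact Submodule.span_le_restrictScalars A A' _ hw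

lemma Fil_le_of_tower (h : J ≤ J'.comap (algebraMap A A')) {σ γ : L} {e p : ℕ}
    (hγ : γ ∈ Fil J s σ e p) : γ ∈ Fil J' s σ e p := by
  filter_upwards [hγ] with n hn
  exact FU_le_of_tower h hn

end BaseChange

section Approximation

variable {A L ι : Type*} [CommRing A] [Field L] [Algebra A L] {J : Ideal A} {s : ι → L}

variable (J s) in
/-- The elements which lie in the filtration over all sufficiently large subrings. -/
def FinFU (u : L) (p d : ℕ) : Prop := ∃ Φ : Finset A, ∀ B : Subalgebra ℤ A, (Φ : Set A) ⊆ B →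
  u ∈ FU (J.comap (algebraMap B A)) s p d

lemma FinFU.add {u v : L} {p d : ℕ} (hu : FinFU J s u p d) (hv : FinFU J s v p d) :
    FinFU J s (u + v) p d := by
  classical
  obtain ⟨Φ, h⟩ := hu
  obtain ⟨Ψ, h'⟩ := hv
  refine ⟨Φ ∪ Ψ, fun B hB ↦ ?_⟩
  rw [Finset.coe_union, Set.union_subset_iff] at hB
  exact add_mem (h B hB.1) (h' B hB.2)

lemma FinFU.mul {u v : L} {p d q e : ℕ} (hu : FinFU J s u p d) (hv : FinFU J s v q e) :
    FinFU J s (u * v) (p + q) (d + e) := by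
  classical
  obtain ⟨Φ, h⟩ := hu
  obtain ⟨Ψ, h'⟩ := hv
  refine ⟨Φ ∪ Ψ, fun B hB ↦ ?_⟩
  rw [Finset.coe_union, Set.union_subset_iff] at hB
  exact FU_mul _ _ (h B hB.1) (h' B hB.2)

lemma finFU_of_mem {a : A} (ha : a ∈ J) : FinFU J s (algebraMap A L a) 1 0 := by
  refine ⟨{a}, fun B hB ↦ ?_⟩
  have : algebraMap A L a = (⟨a, by simpa using hB⟩ : B) • (1 : L) := by
    rw [Algebra.smul_def, mul_one]; rfl
  rw [this, FU, pow_one, pow_zero]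
  exact Submodule.smul_mem_smul ha (Submodule.one_le.mp le_rfl)

lemma finFU_algebraMap (a : A) : FinFU J s (algebraMap A L a) 0 0 := by
  refine ⟨{a}, fun B hB ↦ ?_⟩
  have : algebraMap A L a = (⟨a, by simpa using hB⟩ : B) • (1 : L) := by
    rw [Algebra.smul_def, mul_one]; rfl
  rw [this]
  exact Submodule.smul_mem _ _ (one_mem_FU _ s)

lemma finFU_pow {p : ℕ} {a : A} (ha : a ∈ J ^ p) : FinFU J s (algebraMap A L a) p 0 := by
  induction p generalizing a with
  | zero => exact finFU_algebraMap a
  | succ p ih =>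
    rw [pow_succ] at ha
    refine Submodule.mul_induction_on ha (fun a ha b hb ↦ ?_) (fun a b ha hb ↦ ?_)
    · rw [map_mul]
      have := (ih ha).mul (finFU_of_mem (s := s) hb)
      rwa [add_zero] at this
    · rw [map_add]
      exact ha.add hb

lemma finFU_of_mem_FU {u : L} {p d : ℕ} (hu : u ∈ FU J s p d) : FinFU J s u p d := by
  refine Submodule.smul_induction_on hu (fun a ha w hw ↦ ?_) fun _ _ h h' ↦ h.add h'
  suffices FinFU J s w 0 d by
    have := (finFU_pow (s := s) ha).mul this
    rwa [add_zero, zero_add, ← Algebra.smul_def] at this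
  rw [Submodule.span_pow] at hw
  induction hw using Submodule.span_induction with
  | mem w hw =>
    refine ⟨∅, fun B _ ↦ ?_⟩
    rw [FU, pow_zero, Ideal.one_eq_top, Submodule.top_smul, Submodule.span_pow]
    exact Submodule.subset_span hw
  | zero => exact ⟨∅, fun B _ ↦ zero_mem _⟩
  | add u v _ _ hu hv => exact hu.add hv
  | smul a w _ hw =>
    have := (finFU_algebraMap (J := J) (s := s) a).mul hw
    rwa [add_zero, zero_add, ← Algebra.smul_def] at this

lemma exists_finset_of_mem_Fil {γ σ : L} {e p : ℕ} (h : γ ∈ Fil J s σ e p)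
    (hσ : ∀ B : Subalgebra ℤ A, σ ∈ FU (J.comap (algebraMap B A)) s 0 e) :
    ∃ Φ : Finset A, ∀ B : Subalgebra ℤ A, (Φ : Set A) ⊆ B →
      γ ∈ Fil (J.comap (algebraMap B A)) s σ e p := by
  obtain ⟨n, hn⟩ := exists_of_mem_Fil h
  obtain ⟨Φ, hΦ⟩ := finFU_of_mem_FU hn
  exact ⟨Φ, fun B hB ↦ mem_Fil_of_exists (hσ B) ⟨n, hΦ B hB⟩⟩

open IsLocalRing in
/-- Gluing of idempotents modulo the maximal ideal, over a local ring. -/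
theorem exists_glue [IsLocalRing A] [Finite ι] (hs : ∀ i, s i ≠ 0) {e : ι → L}
    (h0 : ∀ i, e i ∈ Fil (maximalIdeal A) s (s i) 1 0)
    (h1 : ∀ i j, e i - e j ∈ Fil (maximalIdeal A) s (s i * s j) 2 1)
    (h2 : ∀ i, e i ^ 2 - e i ∈ Fil (maximalIdeal A) s (s i) 1 1) :
    ∃ a : L, ∀ i, a - e i ∈ Fil (maximalIdeal A) s (s i) 1 1 := by
  classical
  cases nonempty_fintype ι
  choose Φ0 h0 using fun i ↦ exists_finset_of_mem_Fil (h0 i) fun B ↦ mem_FU _ i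
  choose Φ1 h1 using fun i j ↦ exists_finset_of_mem_Fil (h1 i j) fun B ↦ mul_mem_FU i j
  choose Φ2 h2 using fun i ↦ exists_finset_of_mem_Fil (h2 i) fun B ↦ mem_FU _ i
  set Φ : Finset A := Finset.univ.biUnion Φ0 ∪
    (Finset.univ.biUnion (fun x : ι × ι ↦ Φ1 x.1 x.2) ∪ Finset.univ.biUnion Φ2)
  set B := Algebra.adjoin ℤ (Φ : Set A)
  have hB : (Φ : Set A) ⊆ B := Algebra.subset_adjoin
  have hB0 (i) : (Φ0 i : Set A) ⊆ B := fun x hx ↦ hB (by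
    simp only [Φ, Finset.coe_union, Finset.coe_biUnion]
    exact Or.inl (Set.mem_biUnion (Finset.mem_coe.mpr (Finset.mem_univ i)) hx))
  have hB1 (i j) : (Φ1 i j : Set A) ⊆ B := fun x hx ↦ hB (by
    simp only [Φ, Finset.coe_union, Finset.coe_biUnion]
    exact Or.inr (Or.inl (Set.mem_biUnion (Finset.mem_coe.mpr (Finset.mem_univ (i, j))) hx)))
  have hB2 (i) : (Φ2 i : Set A) ⊆ B := fun x hx ↦ hB (by
    simp only [Φ, Finset.coe_union, Finset.coe_biUnion]
    exact Or.inr (Or.inr (Set.mem_biUnion (Finset.mem_coe.mpr (Finset.mem_univ i)) hx)))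
  have : IsNoetherianRing B := isNoetherianRing_of_fg (Subalgebra.fg_adjoin_finset Φ)
  set p := (maximalIdeal A).comap (algebraMap B A)
  have : p.IsPrime := inferInstance
  let φ : Localization.AtPrime p →+* A := IsLocalization.lift (M := p.primeCompl)
    (g := algebraMap B A) fun y ↦ by
      by_contra hy
      exact y.2 hy
  let _ : Algebra (Localization.AtPrime p) A := φ.toAlgebra
  let _ : Algebra (Localization.AtPrime p) L := ((algebraMap A L).comp φ).toAlgebra
  have : IsScalarTower (Localization.AtPrime p) A L := .of_algebraMap_eq fun _ ↦ rfl
  have : IsScalarTower B (Localization.AtPrime p) L := .of_algebraMap_eq fun x ↦ by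
    change algebraMap A L (algebraMap B A x) = algebraMap A L (φ (algebraMap _ _ x))
    rw [IsLocalization.lift_eq]
  have hle : p ≤ (maximalIdeal (Localization.AtPrime p)).comap (algebraMap B _) :=
    (Localization.AtPrime.under_maximalIdeal (I := p)).ge
  have hle' : maximalIdeal (Localization.AtPrime p) ≤
      (maximalIdeal A).comap (algebraMap (Localization.AtPrime p) A) := by
    rw [← Localization.AtPrime.map_eq_maximalIdeal, Ideal.map_le_iff_le_comap]
    intro x hx
    rw [Ideal.mem_comap, Ideal.mem_comap]
    change φ (algebraMap _ _ x) ∈ _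
    rw [IsLocalization.lift_eq]
    exact hx
  have : IsNoetherianRing (Localization.AtPrime p) :=
    IsLocalization.isNoetherianRing p.primeCompl _ inferInstance
  obtain ⟨a, ha⟩ := exists_glue_of_isNoetherianRing (A := Localization.AtPrime p)
    (Ideal.IsPrime.ne_top inferInstance) hs (fun i ↦ Fil_le_of_tower hle (h0 i B (hB0 i)))
    (fun i j ↦ Fil_le_of_tower hle (h1 i j B (hB1 i j)))
    (fun i ↦ Fil_le_of_tower hle (h2 i B (hB2 i)))
  exact ⟨a, fun i ↦ Fil_le_of_tower hle' (ha i)⟩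

end Approximation

section Monomials

variable {A L κ : Type*} [CommRing A] [Field L] [Algebra A L] {s : κ → L}

open Submodule

lemma prod_mem_span_pow {α : Type*} (F : Finset α) (f : α → κ) :
    ∏ x ∈ F, s (f x) ∈ span A (Set.range s) ^ F.card := by
  classical
  induction F using Finset.induction_on with
  | empty => simp [Submodule.one_le.mp]
  | insert x F hx ih =>
    rw [Finset.prod_insert hx, Finset.card_insert_of_notMem hx, pow_succ']
    exact Submodule.mul_mem_mul (subset_span ⟨_, rfl⟩) ih

lemma span_pow_le_span_prod (n : ℕ) : span A (Set.range s) ^ n ≤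
    span A (Set.range fun f : Fin n → κ ↦ ∏ x, s (f x)) := by
  induction n with
  | zero =>
    rw [pow_zero, Submodule.one_le]
    exact subset_span ⟨Fin.elim0, by simp⟩
  | succ n ih =>
    rw [pow_succ']
    refine (mul_le_mul_right ih _).trans ?_
    rw [Submodule.span_mul_span]
    refine span_mono ?_
    rintro _ ⟨_, ⟨a, rfl⟩, _, ⟨f, rfl⟩, rfl⟩
    exact ⟨Fin.cons a f, by simp [Fin.prod_univ_succ]⟩

lemma pow_mem_mul_of_le {G : Submodule A L} {σ : κ} {k l : ℕ} (hkl : k ≤ l)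
    (h : s σ ^ (k + 1) ∈ G * span A (Set.range s) ^ k) :
    s σ ^ (l + 1) ∈ G * span A (Set.range s) ^ l := by
  obtain ⟨d, rfl⟩ := Nat.exists_eq_add_of_le hkl
  have : s σ ^ d ∈ span A (Set.range s) ^ d :=
    Submodule.pow_mem_pow _ (subset_span (Set.mem_range_self σ)) d
  have := Submodule.mul_mem_mul h this
  rwa [mul_assoc, ← pow_add, ← pow_add, add_right_comm] at this

lemma exists_span_pow_succ_le [Finite κ] {G : Submodule A L}
    (h : ∀ σ, ∃ k, s σ ^ (k + 1) ∈ G * span A (Set.range s) ^ k) :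
    ∃ N, span A (Set.range s) ^ (N + 1) ≤ G * span A (Set.range s) ^ N := by
  classical
  cases nonempty_fintype κ
  choose k hk using h
  set K := ∑ σ, k σ
  have hK (σ) : k σ ≤ K := Finset.single_le_sum (by simp) (Finset.mem_univ σ)
  refine ⟨Fintype.card κ * K, (span_pow_le_span_prod _).trans (span_le.mpr ?_)⟩
  rintro _ ⟨f, rfl⟩
  obtain ⟨σ, hσ⟩ := Fintype.exists_lt_card_fiber_of_mul_lt_card (f := f) (n := K)
    (by rw [Fintype.card_fin]; omega)
  set F := Finset.univ.filter fun x ↦ f x = σ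
  obtain ⟨c, hc⟩ : ∃ c, F.card = c + 1 := ⟨F.card - 1, by omega⟩
  have h1 : ∏ x ∈ F, s (f x) = s σ ^ (c + 1) := by
    rw [Finset.prod_congr rfl (g := fun _ ↦ s σ), Finset.prod_const, hc]
    intro x hx
    rw [(Finset.mem_filter.mp hx).2]
  have h2 := pow_mem_mul_of_le (l := c) ((hK σ).trans (by omega)) (hk σ)
  have h3 := Submodule.mul_mem_mul h2 (prod_mem_span_pow (A := A) (s := s) Fᶜ f)
  rw [← h1, Finset.prod_mul_prod_compl, mul_assoc, ← pow_add] at h3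
  have : c + Fᶜ.card = Fintype.card κ * K := by
    have := F.card_add_card_compl
    rw [Fintype.card_fin] at this
    omega
  rwa [this] at h3

end Monomials

section Valuations

variable {A L κ : Type*} [CommRing A] [Field L] [Algebra A L] {s : κ → L}

open Submodule

lemma algebraMap_mem_filSubring {J : Ideal A} {σ : L} {e : ℕ} (hσ : σ ∈ FU J s 0 e) (a : A) :
    algebraMap A L a ∈ filSubring J hσ := by
  rw [Algebra.algebraMap_eq_smul_one]
  exact Submodule.smul_mem _ a (one_mem_Fil hσ)

lemma exists_pow_mem_mul {Gd : Set κ} {σ : κ} (hσ : s σ ≠ 0)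
    (h : ∀ O : ValuationSubring L, (∀ a, algebraMap A L a ∈ O) → (∀ τ, s τ / s σ ∈ O) →
      ∃ τ ∈ Gd, ¬ O.valuation (s τ / s σ) < 1) :
    ∃ k, s σ ^ (k + 1) ∈ span A (s '' Gd) * span A (Set.range s) ^ k := by
  set R := filSubring (⊥ : Ideal A) (mem_FU (⊥ : Ideal A) (s := s) σ)
  have memR {γ : L} : γ ∈ R ↔ ∃ n, γ * s σ ^ n ∈ span A (Set.range s) ^ n := by
    constructor
    · intro h
      obtain ⟨n, hn⟩ := exists_of_mem_Fil h
      exact ⟨n, by simpa [FU] using hn⟩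
    · rintro ⟨n, hn⟩
      exact mem_Fil_of_exists (mem_FU _ σ) ⟨n, by simpa [FU] using hn⟩
  have hσU (n) : s σ ^ n ∈ span A (Set.range s) ^ n :=
    Submodule.pow_mem_pow _ (subset_span (Set.mem_range_self σ)) n
  have key {γ : L} {n d : ℕ} (h : γ * s σ ^ (n + 1) ∈ span A (s '' Gd) * span A (Set.range s) ^ n) :
      γ * s σ ^ (n + d + 1) ∈ span A (s '' Gd) * span A (Set.range s) ^ (n + d) := by
    have := Submodule.mul_mem_mul h (hσU d)
    rwa [mul_assoc, mul_assoc, ← pow_add, ← pow_add, add_right_comm] at this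
  let I : Ideal R :=
    { carrier := {γ | ∃ n, (γ : L) * s σ ^ (n + 1) ∈ span A (s '' Gd) * span A (Set.range s) ^ n}
      zero_mem' := ⟨0, by simp⟩
      add_mem' := by
        rintro γ δ ⟨n, hn⟩ ⟨k, hk⟩
        refine ⟨n + k, ?_⟩
        have hn := key (d := k) hn
        have hk := key (d := n) hk
        rw [add_comm k] at hk
        have := add_mem hn hk
        rwa [← add_mul] at this
      smul_mem' := by
        rintro r γ ⟨n, hn⟩
        obtain ⟨k, hk⟩ := memR.mp r.2
        refine ⟨n + k, ?_⟩
        have := Submodule.mul_mem_mul hn hk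
        rw [mul_assoc, ← pow_add] at this
        convert this using 1
        rw [smul_eq_mul, Subring.coe_mul]
        ring }
  by_cases hI : I = ⊤
  · obtain ⟨n, hn⟩ : (1 : R) ∈ I := hI ▸ Submodule.mem_top
    exact ⟨n, by simpa using hn⟩
  · obtain ⟨O, hO, hOI⟩ := I.image_subset_nonunits_valuationSubring hI
    have hR (τ) : s τ / s σ ∈ R := memR.mpr ⟨1, by
      rw [pow_one, pow_one, div_mul_cancel₀ _ hσ]
      exact subset_span ⟨τ, rfl⟩⟩
    obtain ⟨τ, hτ, hlt⟩ := h O (fun a ↦ hO (algebraMap_mem_filSubring _ a)) fun τ ↦ hO (hR τ)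
    refine (hlt (O.mem_nonunits_iff.mp (hOI ⟨⟨_, hR τ⟩, ⟨0, ?_⟩, rfl⟩))).elim
    rw [zero_add, pow_zero, pow_one, mul_one, div_mul_cancel₀ _ hσ]
    exact subset_span ⟨τ, hτ, rfl⟩

lemma isIntegral_of_forall_valuationSubring {a : L}
    (h : ∀ O : ValuationSubring L, (∀ a, algebraMap A L a ∈ O) → a ∈ O) : IsIntegral A a := by
  have h1 : a ∈ (⨅ V : {V : ValuationSubring L // Set.range (algebraMap A L) ⊆ V.toSubring},
      V.1.toSubring) := by
    rw [Subring.mem_iInf]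
    exact fun O ↦ h O.1 fun x ↦ O.2 ⟨x, rfl⟩
  rw [iInf_valuationSubring_superset, ← RingHom.coe_range, Subring.closure_eq] at h1
  have h2 : IsIntegral (algebraMap A L).range a := h1
  let _ : Algebra A (algebraMap A L).range := (algebraMap A L).rangeRestrict.toAlgebra
  have : IsScalarTower A (algebraMap A L).range L := .of_algebraMap_eq fun x ↦ rfl
  have : Algebra.IsIntegral A (algebraMap A L).range :=
    ⟨RingHom.isIntegral_of_surjective _ (algebraMap A L).rangeRestrict_surjective⟩
  exact isIntegral_trans _ h2

variable {O : ValuationSubring L} (hO : ∀ a, algebraMap A L a ∈ O) {J : Ideal A} {j : κ}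
  (hj : ∀ l, O.valuation (s l) ≤ O.valuation (s j))

include hO hj

lemma valuation_le_of_mem_FU {p d : ℕ} {u : L} (hu : u ∈ FU J s p d) :
    O.valuation u ≤ O.valuation (s j) ^ d := by
  replace hu : u ∈ span A (Set.range s) ^ d := Submodule.smul_le_right hu
  replace hu := span_pow_le_span_prod d hu
  induction hu using Submodule.span_induction with
  | mem x hx =>
    obtain ⟨f, rfl⟩ := hx
    rw [map_prod]
    refine (Finset.prod_le_prod' fun x _ ↦ hj (f x)).trans ?_
    simp
  | zero => simp
  | add x y _ _ hx hy => exact O.valuation.map_add_le hx hy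
  | smul a x _ hx =>
    rw [Algebra.smul_def, map_mul]
    exact mul_le_of_le_one_of_le ((O.valuation_le_one_iff _).mpr (hO a)) hx

lemma valuation_lt_of_mem_FU (hs : s j ≠ 0)
    (hlt : ∀ a ∈ J, O.valuation (algebraMap A L a) < 1) {d : ℕ} {u : L} (hu : u ∈ FU J s 1 d) :
    O.valuation u < O.valuation (s j) ^ d := by
  refine Submodule.smul_induction_on hu (fun a ha x hx ↦ ?_) fun x y hx hy ↦
    O.valuation.map_add_lt hx hy
  rw [Algebra.smul_def, map_mul]
  rw [pow_one] at ha
  have : x ∈ FU J s 0 d := by rwa [FU, pow_zero, Ideal.one_eq_top, Submodule.top_smul]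
  refine (mul_le_mul_right (valuation_le_of_mem_FU hO hj this) _).trans_lt ?_
  refine (mul_lt_mul_of_pos_right (hlt a ha) ?_).trans_eq (one_mul _)
  exact pow_pos (by simpa [zero_lt_iff] using hs) d

lemma mem_of_mem_Fil (hs : s j ≠ 0) {p : ℕ} {γ : L} (hγ : γ ∈ Fil J s (s j) 1 p) : γ ∈ O := by
  obtain ⟨n, hn⟩ := exists_of_mem_Fil hγ
  have := valuation_le_of_mem_FU hO hj hn
  rw [one_mul, map_mul, map_pow] at this
  rw [← O.valuation_le_one_iff]
  have hpos : 0 < O.valuation (s j) ^ n := pow_pos (by simpa [zero_lt_iff] using hs) n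
  exact le_of_mul_le_mul_right (by rwa [one_mul]) hpos

lemma valuation_lt_one_of_mem_Fil (hs : s j ≠ 0)
    (hlt : ∀ a ∈ J, O.valuation (algebraMap A L a) < 1) {γ : L} (hγ : γ ∈ Fil J s (s j) 1 1) :
    O.valuation γ < 1 := by
  obtain ⟨n, hn⟩ := exists_of_mem_Fil hγ
  have := valuation_lt_of_mem_FU hO hj hs hlt hn
  rw [one_mul, map_mul, map_pow] at this
  have hpos : 0 < O.valuation (s j) ^ n := pow_pos (by simpa [zero_lt_iff] using hs) n
  exact lt_of_mul_lt_mul_right (by rwa [one_mul]) hpos.le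

end Valuations

end GradedCech

namespace GradedCech

open Filter IsLocalRing

section Dominates

variable {A L : Type*} [CommRing A] [IsLocalRing A] [Field L] [Algebra A L]

variable (A) in
/-- A valuation ring of `L` dominating the image of the local ring `A`. -/
structure Dominates (O : ValuationSubring L) : Prop where
  mem : ∀ a, algebraMap A L a ∈ O
  lt : ∀ a ∈ maximalIdeal A, O.valuation (algebraMap A L a) < 1

variable {ι : Type*} {s : ι → L}

lemma mem_Fil_one_of_dominates {σ : L} {d : ℕ} (hσ : σ ∈ FU (maximalIdeal A) s 0 d) {h : L}
    (h0 : h ∈ Fil (maximalIdeal A) s σ d 0) (h3 : h ^ 3 - h ∈ Fil (maximalIdeal A) s σ d 1)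
    (H : ∀ O : ValuationSubring L, Dominates A O →
      (∀ γ ∈ Fil (maximalIdeal A) s σ d 0, γ ∈ O) → O.valuation h < 1) :
    h ∈ Fil (maximalIdeal A) s σ d 1 := by
  set R := filSubring (maximalIdeal A) hσ
  have hmul {γ δ : L} (hγ : γ ∈ Fil (maximalIdeal A) s σ d 1) (hδ : δ ∈ R) :
      γ * δ ∈ Fil (maximalIdeal A) s σ d 1 := by
    have := mul_mem_Fil hσ hγ hδ
    rwa [add_zero] at this
  let I : Ideal R :=
    { carrier := {γ | (γ : L) ∈ Fil (maximalIdeal A) s σ d 1}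
      zero_mem' := zero_mem (Fil (maximalIdeal A) s σ d 1)
      add_mem' := fun ha hb ↦ (Fil (maximalIdeal A) s σ d 1).add_mem ha hb
      smul_mem' := fun r γ hγ ↦ by
        have := hmul hγ r.2
        rwa [mul_comm] at this }
  let η : R := ⟨h, h0⟩
  by_cases hI : I ⊔ Ideal.span {1 - η ^ 2} = ⊤
  · have : (1 : R) ∈ I ⊔ Ideal.span {1 - η ^ 2} := hI ▸ Submodule.mem_top
    obtain ⟨x, hx, y, hy, hxy⟩ := Submodule.mem_sup.mp this
    obtain ⟨r, rfl⟩ := Ideal.mem_span_singleton'.mp hy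
    have hxy : (x : L) + r * (1 - h ^ 2) = 1 := congr_arg Subtype.val hxy
    have := sub_mem (hmul hx h0) (hmul h3 r.2)
    convert this using 1
    linear_combination -h * hxy
  · obtain ⟨O, hO, hOI⟩ := (I ⊔ Ideal.span {1 - η ^ 2}).image_subset_nonunits_valuationSubring hI
    have hO1 (γ : L) (hγ : γ ∈ Fil (maximalIdeal A) s σ d 1) : O.valuation γ < 1 :=
      O.mem_nonunits_iff.mp (hOI ⟨⟨γ, Fil_anti (Nat.zero_le 1) hγ⟩,
        Ideal.mem_sup_left (show _ ∈ I from hγ), rfl⟩)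
    have hdom : Dominates A O := by
      refine ⟨fun a ↦ hO (algebraMap_mem_filSubring hσ a), fun a ha ↦ hO1 _ ?_⟩
      rw [Algebra.algebraMap_eq_smul_one]
      have := smul_mem_Fil (q := 1) (by rwa [pow_one]) (one_mem_Fil hσ)
      rwa [add_zero] at this
    have h1 := H O hdom fun γ hγ ↦ hO hγ
    have h2 : O.valuation (1 - h ^ 2) < 1 := O.mem_nonunits_iff.mp
      (hOI ⟨1 - η ^ 2, Ideal.mem_sup_right (Ideal.mem_span_singleton_self _), rfl⟩)
    have h4 : O.valuation (h ^ 2) < 1 := by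
      rw [map_pow]
      exact pow_lt_one₀ zero_le h1 two_ne_zero
    have := O.valuation.map_add_lt h2 h4
    simp at this

variable {I : Type*} [Finite I] {T : I → Set L} [∀ i, Finite (T i)] {e : I → L}

/-- A connectedness principle: a compatible family of idempotents modulo the maximal ideal on a
complete family of affine models takes the same value at all valuation rings dominating `A`. -/
theorem forall_or_forall_of_dominates
    (hA : ∀ x : L, IsIntegral A x → x ∈ Set.range (algebraMap A L))
    (h1 : ∀ i, 1 ∈ T i) (h0 : ∀ i, 0 ∉ T i) (he : ∀ i, e i ∈ Algebra.adjoin A (T i))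
    (hidem : ∀ i, e i ^ 2 - e i ∈ maximalIdeal A • Subalgebra.toSubmodule (Algebra.adjoin A (T i)))
    (hval : ∀ O : ValuationSubring L, (∀ a, algebraMap A L a ∈ O) → ∃ i, T i ⊆ O)
    (hcomp : ∀ O : ValuationSubring L, Dominates A O → ∀ i j, T i ⊆ O → T j ⊆ O →
      O.valuation (e i - e j) < 1) :
    (∀ O : ValuationSubring L, Dominates A O → ∀ i, T i ⊆ O → O.valuation (e i) < 1) ∨
    (∀ O : ValuationSubring L, Dominates A O → ∀ i, T i ⊆ O → O.valuation (e i - 1) < 1) := by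
  classical
  cases nonempty_fintype I
  obtain ⟨i₀, -⟩ := hval ⊤ fun a ↦ ValuationSubring.mem_top _
  let κ := ∀ i, T i
  let s : κ → L := fun σ ↦ ∏ i, (σ i : L)
  have hs (σ) : s σ ≠ 0 := Finset.prod_ne_zero_iff.mpr fun i _ h ↦ h0 i (h ▸ (σ i).2)
  have upd (σ : κ) (i : I) (t : T i) : s (Function.update σ i t) * σ i = t * s σ := by
    simp only [s]
    rw [Fintype.prod_eq_mul_prod_compl i, Fintype.prod_eq_mul_prod_compl i (fun i ↦ (σ i : L)),
      Function.update_self, mul_assoc, mul_comm _ (σ i : L)]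
    congr 2
    refine Finset.prod_congr rfl fun j hj ↦ ?_
    rw [Function.update_of_ne (by simpa using hj)]
  let Gd : Set κ := {σ | ∃ i, (σ i : L) = 1}
  set U := Submodule.span A (Set.range s) with hU
  obtain ⟨N, hN⟩ : ∃ N, U ^ (N + 1) ≤ Submodule.span A (s '' Gd) * U ^ N := by
    refine exists_span_pow_succ_le fun σ ↦ exists_pow_mem_mul (hs σ) fun O hO hσ ↦ ?_
    obtain ⟨i, hi⟩ := hval O hO
    refine ⟨Function.update σ i ⟨1, h1 i⟩, ⟨i, by simp⟩, fun hlt ↦ ?_⟩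
    have h2 := (O.valuation_le_one_iff _).mpr (hi (σ i).2)
    have h3 := mul_lt_one_of_nonneg_of_lt_one_left zero_le hlt h2
    rw [← map_mul, div_mul_eq_mul_div, upd, one_mul, div_self (hs σ), map_one] at h3
    exact h3.false
  let ι := Gd × (Fin N → κ)
  let s' : ι → L := fun j ↦ s j.1 * ∏ x, s (j.2 x)
  have hs' (j) : s' j ≠ 0 := mul_ne_zero (hs _) (Finset.prod_ne_zero_iff.mpr fun _ _ ↦ hs _)
  have hUs' : U ^ (N + 1) ≤ Submodule.span A (Set.range s') := by
    refine (hN.trans (mul_le_mul_right (span_pow_le_span_prod N) _)).trans ?_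
    rw [Submodule.span_mul_span]
    refine Submodule.span_mono ?_
    rintro _ ⟨_, ⟨τ, hτ, rfl⟩, _, ⟨f, rfl⟩, rfl⟩
    exact ⟨(⟨τ, hτ⟩, f), rfl⟩
  have hprod (τ : κ) (f : Fin N → κ) : s τ * ∏ x, s (f x) ∈ Submodule.span A (Set.range s') := by
    refine hUs' ?_
    rw [pow_succ']
    refine Submodule.mul_mem_mul (Submodule.subset_span ⟨τ, rfl⟩) ?_
    simpa using prod_mem_span_pow (A := A) (s := s) Finset.univ f
  choose idx hidx using fun τ : Gd ↦ τ.2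
  set J := maximalIdeal A
  have hT (j : ι) : T (idx j.1) ⊆ Fil J s' (s' j) 1 0 := fun t ht ↦ by
    refine mem_Fil_of_exists (mem_FU J j) ⟨1, ?_⟩
    have := upd j.1 (idx j.1) ⟨t, ht⟩
    rw [hidx, mul_one] at this
    rw [pow_one, ← mul_assoc, ← this]
    simpa [FU] using hprod _ j.2
  have hadj (j : ι) : ∀ x ∈ Algebra.adjoin A (T (idx j.1)), x ∈ Fil J s' (s' j) 1 0 := by
    intro x hx
    change x ∈ filSubring J (mem_FU J j)
    induction hx using Algebra.adjoin_induction with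
    | mem x hx => exact hT j hx
    | algebraMap a => exact algebraMap_mem_filSubring _ a
    | add x y _ _ hx hy => exact add_mem hx hy
    | mul x y _ _ hx hy => exact mul_mem hx hy
  have he0 (j : ι) : e (idx j.1) ∈ Fil J s' (s' j) 1 0 := hadj j _ (he _)
  have he1 (j : ι) : e (idx j.1) ^ 2 - e (idx j.1) ∈ Fil J s' (s' j) 1 1 := by
    refine Submodule.smul_induction_on (hidem (idx j.1)) (fun a ha x hx ↦ ?_) fun _ _ ↦ add_mem
    have := smul_mem_Fil (q := 1) (by rwa [pow_one]) (hadj j x hx)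
    rwa [add_zero] at this
  have he2 (j l : ι) : e (idx j.1) - e (idx l.1) ∈ Fil J s' (s' j * s' l) 2 1 := by
    refine mem_Fil_one_of_dominates (mul_mem_FU j l)
      (sub_mem (Fil_le_left j l (he0 j)) (Fil_le_right j l (he0 l))) ?_ fun O hO hle ↦ ?_
    · exact cube_sub_mem_Fil (mul_mem_FU j l) (Fil_le_left j l (he0 j)) (Fil_le_right j l (he0 l))
        (Fil_le_left j l (he1 j)) (Fil_le_right j l (he1 l))
    · exact hcomp O hO _ _ (fun t ht ↦ hle t (Fil_le_left j l (hT j ht)))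
        fun t ht ↦ hle t (Fil_le_right j l (hT l ht))
  obtain ⟨a, ha⟩ := exists_glue hs' he0 he2 he1
  have : Nonempty ι := ⟨(⟨fun i ↦ ⟨1, h1 i⟩, i₀, rfl⟩, fun _ i ↦ ⟨1, h1 i⟩)⟩
  have hmax (O : ValuationSubring L) : ∃ j, ∀ l, O.valuation (s' l) ≤ O.valuation (s' j) :=
    Finite.exists_max _
  obtain ⟨α, rfl⟩ := hA a <| isIntegral_of_forall_valuationSubring fun O hO ↦ by
    obtain ⟨j, hj⟩ := hmax O
    have := add_mem (Fil_anti (Nat.zero_le 1) (ha j)) (he0 j)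
    rw [sub_add_cancel] at this
    exact mem_of_mem_Fil hO hj (hs' j) this
  have key (O : ValuationSubring L) (hO : Dominates A O) (i) (hi : T i ⊆ O) :
      O.valuation (e i - algebraMap A L α) < 1 ∧
      O.valuation (algebraMap A L α ^ 2 - algebraMap A L α) < 1 := by
    obtain ⟨j, hj⟩ := hmax O
    have hadj' {x : L} (hx : x ∈ Fil J s' (s' j) 1 0) : x ∈ O :=
      mem_of_mem_Fil hO.mem hj (hs' j) hx
    have h3 := valuation_lt_one_of_mem_Fil hO.mem hj (hs' j) hO.lt (neg_mem (ha j))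
    have h4 := valuation_lt_one_of_mem_Fil hO.mem hj (hs' j) hO.lt (he1 j)
    have h5 := hcomp O hO i (idx j.1) hi fun t ht ↦ hadj' (hT j ht)
    have h6 : O.valuation (algebraMap A L α + e (idx j.1) - 1) ≤ 1 :=
      (O.valuation_le_one_iff _).mpr
        (sub_mem (add_mem (hO.mem α) (hadj' (he0 j))) (one_mem O))
    refine ⟨?_, ?_⟩
    · convert O.valuation.map_add_lt h5 h3 using 2
      ring
    · have h7 := mul_lt_one_of_nonneg_of_lt_one_left zero_le h3 h6
      rw [← map_mul, ← Valuation.map_neg] at h7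
      convert O.valuation.map_add_lt h7 h4 using 2
      ring
  by_cases hα : α ∈ maximalIdeal A
  · left
    intro O hO i hi
    simpa using O.valuation.map_add_lt (key O hO i hi).1 (hO.lt α hα)
  · right
    intro O hO i hi
    obtain ⟨h3, h4⟩ := key O hO i hi
    have hα : IsUnit α := by simpa using hα
    obtain ⟨β, hβ⟩ := hα.exists_right_inv
    have hβ : algebraMap A L α * algebraMap A L β = 1 := by rw [← map_mul, hβ, map_one]
    have h5 := mul_lt_one_of_nonneg_of_lt_one_left zero_le h4
      ((O.valuation_le_one_iff _).mpr (hO.mem β))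
    rw [← map_mul] at h5
    convert O.valuation.map_add_lt h3 h5 using 2
    linear_combination (1 - algebraMap A L α) * hβ

end Dominates

end GradedCech

namespace GradedCech

open Filter IsLocalRing CategoryTheory CategoryTheory.Limits

universe u

lemma exists_isIdempotent_of_isOpen {B : Type*} [CommRing B] (I : Ideal B)
    {U V : Set (PrimeSpectrum B)} (hU : IsOpen U) (hV : IsOpen V)
    (hUV : ∀ p, I ≤ p.asIdeal → p ∈ U ∨ p ∈ V) (hd : ∀ p, I ≤ p.asIdeal → p ∈ U → p ∉ V) :
    ∃ e : B, e ^ 2 - e ∈ I ∧ ∀ p, I ≤ p.asIdeal → (p ∈ V ↔ e ∉ p.asIdeal) := by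
  let q := Ideal.Quotient.mk I
  have hq (p : PrimeSpectrum (B ⧸ I)) : I ≤ (PrimeSpectrum.comap q p).asIdeal := by
    intro b hb
    change q b ∈ p.asIdeal
    rw [Ideal.Quotient.eq_zero_iff_mem.mpr hb]
    exact zero_mem _
  have hc : IsClopen (PrimeSpectrum.comap q ⁻¹' V) := by
    refine ⟨⟨?_⟩, hV.preimage (PrimeSpectrum.continuous_comap q)⟩
    convert hU.preimage (PrimeSpectrum.continuous_comap q)
    ext p
    have h1 := hUV _ (hq p)
    have h2 := hd _ (hq p)
    simp only [Set.mem_compl_iff, Set.mem_preimage]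
    tauto
  obtain ⟨e', he', hVe⟩ := PrimeSpectrum.exists_idempotent_basicOpen_eq_of_isClopen hc
  obtain ⟨e, rfl⟩ := Ideal.Quotient.mk_surjective e'
  refine ⟨e, ?_, fun p hp ↦ ?_⟩
  · rw [← Ideal.Quotient.eq_zero_iff_mem, map_sub, map_pow, sub_eq_zero, sq]
    exact he'
  · have : p ∈ Set.range (PrimeSpectrum.comap q) := by
      rw [range_comap_of_surjective _ _ Ideal.Quotient.mk_surjective,
        PrimeSpectrum.mem_zeroLocus]
      simpa [q] using hp
    obtain ⟨p', rfl⟩ := this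
    change p' ∈ PrimeSpectrum.comap q ⁻¹' V ↔ _
    rw [hVe]
    rfl

/-- The morphism from the spectrum of a field to the spectrum of a valuation ring. -/
noncomputable abbrev genericPt {K : Type u} [Field K] (O : ValuationSubring K) :
    Spec (.of K) ⟶ Spec (.of O) :=
  Spec.map (CommRingCat.ofHom (algebraMap O K))

variable {A : CommRingCat.{u}} {X : Scheme.{u}} {f : X ⟶ Spec A} {K : Type u} [Field K]
  {ξ : Spec (.of K) ⟶ X} {φ : A ⟶ .of K}

lemma comp_eq_of_genericPt (hφ : ξ ≫ f = Spec.map φ) {O : ValuationSubring K}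
    (hO : ∀ a, φ.hom a ∈ O) {c : Spec (.of O) ⟶ X} (hc : genericPt O ≫ c = ξ) :
    c ≫ f = Spec.map (CommRingCat.ofHom (φ.hom.codRestrict O.toSubring hO)) := by
  obtain ⟨ψ, hψ⟩ := Spec.map_surjective (c ≫ f)
  rw [← hψ]
  congr 1
  have : Spec.map (ψ ≫ CommRingCat.ofHom (algebraMap O K)) = Spec.map φ := by
    rw [Spec.map_comp, hψ, ← hφ, ← hc, Category.assoc]
  have := Spec.map_injective this
  ext a
  exact congr($(this).hom a)

lemma genericPt_unique [IsSeparated f] (hφ : ξ ≫ f = Spec.map φ) {O : ValuationSubring K}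
    (hO : ∀ a, φ.hom a ∈ O) {c c' : Spec (.of O) ⟶ X} (hc : genericPt O ≫ c = ξ)
    (hc' : genericPt O ≫ c' = ξ) : c = c' := by
  have h := comp_eq_of_genericPt hφ hO hc
  have h' := comp_eq_of_genericPt hφ hO hc'
  let S : ValuativeCommSq f :=
    { R := O, K := K, i₁ := ξ, i₂ := c ≫ f, commSq := ⟨by rw [← hc, Category.assoc]⟩ }
  have := IsSeparated.valuativeCriterion f S
  exact congr_arg (·.l) (Subsingleton.elim (⟨c, hc, rfl⟩ : S.commSq.LiftStruct)
    ⟨c', hc', h'.trans h.symm⟩)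

lemma genericPt_exists [IsProper f] (hφ : ξ ≫ f = Spec.map φ) {O : ValuationSubring K}
    (hO : ∀ a, φ.hom a ∈ O) : ∃ c : Spec (.of O) ⟶ X, genericPt O ≫ c = ξ := by
  have hf : ValuativeCriterion f := by
    have := IsProper.eq_valuativeCriterion.{u}.le _ _ f ‹_›
    exact this.1.1.1
  let S : ValuativeCommSq f :=
    { R := O, K := K, i₁ := ξ
      i₂ := Spec.map (CommRingCat.ofHom (φ.hom.codRestrict O.toSubring hO))
      commSq := ⟨by rw [hφ, ← Spec.map_comp]; rfl⟩ }
  obtain ⟨l, hl, -⟩ := (hf.existence S).exists_lift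
  exact ⟨l, hl⟩

variable {B : CommRingCat.{u}} {j : Spec B ⟶ X} {ev : B ⟶ .of K}

/-- A morphism from the spectrum of a local ring lands in any open subset containing the image of
the closed point. -/
lemma exists_factor_of_closedPoint [IsOpenImmersion j] {O : Type u} [CommRing O] [IsLocalRing O]
    (c : Spec (.of O) ⟶ X) (hc : c (closedPoint O) ∈ Set.range j) :
    ∃ ψ : B ⟶ .of O, Spec.map ψ ≫ j = c := by
  have : Set.range c ⊆ Set.range j := by
    rintro _ ⟨p, rfl⟩
    exact ((specializes_closedPoint p).map c.continuous).mem_open j.isOpenEmbedding.isOpen_range hc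
  obtain ⟨ψ, hψ⟩ := Spec.map_surjective (IsOpenImmersion.lift j c this)
  exact ⟨ψ, by rw [hψ, IsOpenImmersion.lift_fac]⟩

lemma exists_codRestrict_of_closedPoint [IsOpenImmersion j] (hev : Spec.map ev ≫ j = ξ)
    {O : ValuationSubring K} {c : Spec (.of O) ⟶ X} (hc : genericPt O ≫ c = ξ)
    (hcj : c (closedPoint O) ∈ Set.range j) (b : B) : ev.hom b ∈ O := by
  obtain ⟨ψ, rfl⟩ := exists_factor_of_closedPoint c hcj
  have : Spec.map (ψ ≫ CommRingCat.ofHom (algebraMap O K)) = Spec.map ev := by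
    rw [← cancel_mono j, hev, ← hc, Spec.map_comp, Category.assoc]
  rw [← Spec.map_injective this]
  exact (ψ.hom b).2

lemma exists_specMap_of_forall_mem [IsSeparated f] (hφ : ξ ≫ f = Spec.map φ)
    (hev : Spec.map ev ≫ j = ξ) {O : ValuationSubring K} (hO : ∀ a, φ.hom a ∈ O)
    {c : Spec (.of O) ⟶ X} (hc : genericPt O ≫ c = ξ) (h : ∀ b, ev.hom b ∈ O) :
    ∃ p : PrimeSpectrum B, j p = c (closedPoint O) ∧
      ∀ b, b ∉ p.asIdeal ↔ O.valuation (ev.hom b) = 1 := by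
  have hc' : genericPt O ≫ Spec.map (CommRingCat.ofHom (ev.hom.codRestrict O.toSubring h)) ≫ j
      = ξ := by
    rw [← Spec.map_comp_assoc]
    exact hev
  obtain rfl := genericPt_unique hφ hO hc hc'
  refine ⟨PrimeSpectrum.comap (ev.hom.codRestrict O.toSubring h) (closedPoint O), rfl, fun b ↦ ?_⟩
  change ¬ (ev.hom.codRestrict O.toSubring h b ∈ maximalIdeal O) ↔ _
  exact ((not_congr (mem_maximalIdeal (R := O) ⟨ev.hom b, h b⟩)).trans (not_not (a := IsUnit _))).trans
    (ValuationSubring.valuation_eq_one_iff O ⟨ev.hom b, h b⟩)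

lemma exists_finite_affine_cover (X : Scheme.{u}) [CompactSpace X] :
    ∃ (I : Type u) (_ : Finite I) (B : I → CommRingCat.{u}) (j : ∀ i, Spec (B i) ⟶ X),
      (∀ i, IsOpenImmersion (j i)) ∧ ∀ x : X, ∃ i, x ∈ Set.range (j i) := by
  let 𝒰 := X.affineCover.finiteSubcover
  refine ⟨𝒰.I₀, inferInstance, fun i ↦ Γ(𝒰.X i, ⊤), fun i ↦ (𝒰.X i).isoSpec.inv ≫ 𝒰.f i,
    inferInstance, fun x ↦ ?_⟩
  obtain ⟨i, y, rfl⟩ := 𝒰.exists_eq x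
  exact ⟨i, (𝒰.X i).isoSpec.hom y, by simp [← Scheme.Hom.comp_apply]⟩

variable {A : CommRingCat.{u}} [IsLocalRing A] {X : Scheme.{u}} {f : X ⟶ Spec A}

/-- An affine open chart `j` of `X` through the point `ξ`, with an element `e` of its coordinate
ring which is idempotent modulo the maximal ideal of `A` and separates `U` from `V` there. -/
lemma exists_chart [LocallyOfFiniteType f] {U V : Set X} (hU : IsOpen U) (hV : IsOpen V)
    (hUV : f ⁻¹' {closedPoint A} ⊆ U ∪ V) (hd : f ⁻¹' {closedPoint A} ∩ (U ∩ V) = ∅)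
    {B : CommRingCat.{u}} (j : Spec B ⟶ X) [IsOpenImmersion j] :
    ∃ (ρ : A ⟶ B) (S : Set B) (e : B), j ≫ f = Spec.map ρ ∧ S.Finite ∧
      (letI := ρ.hom.toAlgebra; Algebra.adjoin A S = ⊤) ∧
      e ^ 2 - e ∈ (maximalIdeal A).map ρ.hom ∧
      ∀ p : PrimeSpectrum B, f (j p) = closedPoint A →
        (j p ∈ U → e ∈ p.asIdeal) ∧ (j p ∈ V → e ∉ p.asIdeal) ∧ e ^ 2 - e ∈ p.asIdeal := by
  obtain ⟨ρ, hρ⟩ := Spec.map_surjective (j ≫ f)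
  have hft : LocallyOfFiniteType (Spec.map ρ) := by rw [hρ]; infer_instance
  rw [HasRingHomProperty.Spec_iff (P := @LocallyOfFiniteType)] at hft
  have hcl (p : PrimeSpectrum B) :
      f (j p) = closedPoint A ↔ (maximalIdeal A).map ρ.hom ≤ p.asIdeal := by
    change (j ≫ f) p = _ ↔ _
    rw [← hρ, Ideal.map_le_iff_le_comap]
    change PrimeSpectrum.comap ρ.hom p = _ ↔ _ ≤ (PrimeSpectrum.comap ρ.hom p).asIdeal
    refine ⟨fun h ↦ by rw [h]; rfl, fun h ↦ PrimeSpectrum.ext ?_⟩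
    exact (le_maximalIdeal (PrimeSpectrum.comap ρ.hom p).2.ne_top).antisymm h
  obtain ⟨e, he, heV⟩ := exists_isIdempotent_of_isOpen ((maximalIdeal A).map ρ.hom)
    (hU.preimage j.continuous) (hV.preimage j.continuous)
    (fun p hp ↦ hUV ((hcl p).mpr hp))
    (fun p hp h1 h2 ↦ Set.eq_empty_iff_forall_notMem.mp hd _ ⟨(hcl p).mpr hp, h1, h2⟩)
  obtain ⟨S, hS⟩ := hft
  refine ⟨ρ, S, e, hρ.symm, S.finite_toSet, hS, he, fun p hp ↦ ?_⟩
  have hp' := (hcl p).mp hp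
  refine ⟨fun h ↦ ?_, (heV p hp').mp, hp' he⟩
  by_contra h'
  exact Set.eq_empty_iff_forall_notMem.mp hd _ ⟨hp, h, (heV p hp').mpr h'⟩

variable {K : Type u} [Field K] {ξ : Spec (.of K) ⟶ X} {φ : A ⟶ .of K}

lemma apply_closedPoint_of_dominates (hφ : ξ ≫ f = Spec.map φ) {O : ValuationSubring K}
    (hO : letI := φ.hom.toAlgebra; Dominates A O) {c : Spec (.of O) ⟶ X}
    (hc : genericPt O ≫ c = ξ) : f (c (closedPoint O)) = closedPoint A := by
  let := φ.hom.toAlgebra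
  change (c ≫ f) (closedPoint O) = _
  rw [comp_eq_of_genericPt hφ hO.mem hc]
  change PrimeSpectrum.comap (φ.hom.codRestrict O.toSubring hO.mem) (closedPoint O) = _
  refine PrimeSpectrum.ext ((le_maximalIdeal (PrimeSpectrum.isPrime _).ne_top).antisymm
    fun a ha ↦ ?_)
  exact (ValuationSubring.valuation_lt_one_iff O ⟨φ.hom a, hO.mem a⟩).mpr (hO.lt a ha)

theorem false_of_dominates [IsProper f] (hφ : ξ ≫ f = Spec.map φ)
    (hA : ∀ x : K, φ.hom.IsIntegralElem x → x ∈ Set.range φ.hom)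
    {U V : Set X} (hU : IsOpen U) (hV : IsOpen V)
    (hUV : f ⁻¹' {closedPoint A} ⊆ U ∪ V) (hd : f ⁻¹' {closedPoint A} ∩ (U ∩ V) = ∅)
    {P Q : ValuationSubring K} (hP : letI := φ.hom.toAlgebra; Dominates A P)
    (hQ : letI := φ.hom.toAlgebra; Dominates A Q)
    {c : Spec (.of P) ⟶ X} (hc : genericPt P ≫ c = ξ) (hcU : c (closedPoint P) ∈ U)
    {d : Spec (.of Q) ⟶ X} (hd' : genericPt Q ≫ d = ξ) (hdV : d (closedPoint Q) ∈ V) : False := by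
  let := φ.hom.toAlgebra
  have : CompactSpace X := QuasiCompact.compactSpace_of_compactSpace f
  obtain ⟨I₀, _, B₀, j₀, hj₀, hcov⟩ := exists_finite_affine_cover X
  let I := {i : I₀ // ξ (closedPoint K) ∈ Set.range (j₀ i)}
  let B : I → CommRingCat := fun i ↦ B₀ i
  let j : ∀ i : I, Spec (B i) ⟶ X := fun i ↦ j₀ i
  have hj (i) : IsOpenImmersion (j i) := hj₀ i
  have := fun i : I ↦ exists_factor_of_closedPoint (j := j i) (O := K) ξ i.2
  choose ev hev using this
  choose ρ S e hρ hSf hS he heUV using fun i : I ↦ exists_chart hU hV hUV hd (j i)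
  have hρev (i : I) (a : A) : (ev i).hom ((ρ i).hom a) = φ.hom a := by
    have : Spec.map (ρ i ≫ ev i) = Spec.map φ := by
      rw [Spec.map_comp, ← hρ, ← hφ, ← hev i, Category.assoc]
    exact congr($(Spec.map_injective this).hom a)
  let T : I → Set K := fun i ↦ insert 1 ((ev i).hom '' S i \ {0})
  have hTf (i : I) : Finite (T i) := (((hSf i).image _).sdiff.insert 1).to_subtype
  have hadj (i : I) (b : B i) : (ev i).hom b ∈ Algebra.adjoin A (T i) := by
    let := (ρ i).hom.toAlgebra
    have hb : b ∈ Algebra.adjoin A (S i) := by rw [hS i]; trivial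
    induction hb using Algebra.adjoin_induction with
    | mem x hx =>
      by_cases h : (ev i).hom x = 0
      · rw [h]; exact zero_mem _
      · exact Algebra.subset_adjoin (.inr ⟨⟨x, hx, rfl⟩, h⟩)
    | algebraMap a => exact (hρev i a).symm ▸ (Algebra.adjoin A (T i)).algebraMap_mem a
    | add x y _ _ hx hy => rw [map_add]; exact add_mem hx hy
    | mul x y _ _ hx hy => rw [map_mul]; exact mul_mem hx hy
  have hev_of_T (O : ValuationSubring K) (hO : ∀ a, φ.hom a ∈ O) (i : I) (h : T i ⊆ O) (b : B i) :
      (ev i).hom b ∈ O := by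
    have hb := hadj i b
    generalize (ev i).hom b = x at hb
    induction hb using Algebra.adjoin_induction with
    | mem x hx => exact h hx
    | algebraMap a => exact hO a
    | add x y _ _ hx hy => exact add_mem hx hy
    | mul x y _ _ hx hy => exact mul_mem hx hy
  have hT_of_mem (O : ValuationSubring K) (c : Spec (.of O) ⟶ X) (hc : genericPt O ≫ c = ξ) :
      ∃ i, T i ⊆ O := by
    obtain ⟨i, hi⟩ := hcov (c (closedPoint O))
    have hξ : ξ (closedPoint K) ∈ Set.range (j₀ i) := by
      rw [← hc]
      exact ((specializes_closedPoint _).map c.continuous).mem_open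
        (j₀ i).isOpenEmbedding.isOpen_range hi
    refine ⟨⟨i, hξ⟩, ?_⟩
    rintro _ (rfl | ⟨⟨x, -, rfl⟩, -⟩)
    · exact one_mem O
    · exact exists_codRestrict_of_closedPoint (hev ⟨i, hξ⟩) hc hi x
  have key (O : ValuationSubring K) (hO : Dominates A O) (c : Spec (.of O) ⟶ X)
      (hc : genericPt O ≫ c = ξ) (i : I) (h : T i ⊆ O) :
      (c (closedPoint O) ∈ U → O.valuation ((ev i).hom (e i)) < 1) ∧
      (c (closedPoint O) ∈ V → O.valuation ((ev i).hom (e i) - 1) < 1) := by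
    have hb := hev_of_T O hO.mem i h
    obtain ⟨p, hp, hpO⟩ := exists_specMap_of_forall_mem hφ (hev i) hO.mem hc hb
    have hlt (b : B i) (hbp : b ∈ p.asIdeal) : O.valuation ((ev i).hom b) < 1 :=
      lt_of_le_of_ne ((O.valuation_le_one_iff _).mpr (hb b)) fun h ↦ (hpO b).mpr h hbp
    have hpc : f (j i p) = closedPoint A := by
      rw [hp]; exact apply_closedPoint_of_dominates hφ hO hc
    obtain ⟨h1, h2, h3⟩ := heUV i p hpc
    rw [← hp]
    refine ⟨fun h ↦ hlt _ (h1 h), fun h ↦ ?_⟩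
    have := hlt (e i - 1) ((p.2.mem_or_mem (x := e i) (y := e i - 1)
      (by convert h3 using 1; ring)).resolve_left (h2 h))
    rwa [map_sub, map_one] at this
  have hfib (O : ValuationSubring K) (hO : Dominates A O) (c : Spec (.of O) ⟶ X)
      (hc : genericPt O ≫ c = ξ) : c (closedPoint O) ∈ U ∨ c (closedPoint O) ∈ V :=
    hUV (apply_closedPoint_of_dominates hφ hO hc)
  have main := forall_or_forall_of_dominates (A := A) (T := T) (e := fun i ↦ (ev i).hom (e i))
    (fun x hx ↦ hA x hx) (fun i ↦ .inl rfl)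
    (fun i h ↦ by
      obtain h | h := h
      · exact zero_ne_one h
      · exact h.2 rfl)
    (fun i ↦ hadj i _) ?_ ?_ ?_
  · obtain ⟨i, hi⟩ := hT_of_mem P c hc
    obtain ⟨i', hi'⟩ := hT_of_mem Q d hd'
    have contra (O : ValuationSubring K) (x : K) (h : O.valuation x < 1)
        (h' : O.valuation (x - 1) < 1) : False := by
      have := O.valuation.map_sub_lt h h'
      rw [sub_sub_cancel, map_one] at this
      exact lt_irrefl _ this
    obtain h | h := main
    · exact contra Q _ (h Q hQ i' hi') ((key Q hQ d hd' i' hi').2 hdV)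
    · exact contra P _ ((key P hP c hc i hi).1 hcU) (h P hP i hi)
  · intro i
    rw [← map_pow, ← map_sub]
    have := he i
    generalize e i ^ 2 - e i = x at this
    induction this using Submodule.span_induction with
    | mem x hx =>
      obtain ⟨a, ha, rfl⟩ := hx
      rw [hρev i a, ← mul_one (φ.hom a)]
      exact Submodule.smul_mem_smul ha (one_mem (Algebra.adjoin A (T i)))
    | zero => rw [map_zero]; exact zero_mem _
    | add x y _ _ hx hy => rw [map_add]; exact add_mem hx hy
    | smul b x _ hx =>
      rw [smul_eq_mul, map_mul]
      generalize (ev i).hom x = z at hx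
      induction hx using Submodule.smul_induction_on' with
      | smul a ha y hy =>
        rw [mul_smul_comm]
        exact Submodule.smul_mem_smul ha ((Algebra.adjoin A (T i)).mul_mem (hadj i b) hy)
      | add x _ y _ hx hy => rw [mul_add]; exact add_mem hx hy
  · intro O hO
    obtain ⟨c, hc⟩ := genericPt_exists hφ hO
    exact hT_of_mem O c hc
  · intro O hO i i' hi hi'
    obtain ⟨c, hc⟩ := genericPt_exists hφ hO.mem
    obtain h | h := hfib O hO c hc
    · exact O.valuation.map_sub_lt ((key O hO c hc i hi).1 h) ((key O hO c hc i' hi').1 h)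
    · have := O.valuation.map_sub_lt ((key O hO c hc i hi).2 h) ((key O hO c hc i' hi').2 h)
      rwa [sub_sub_sub_cancel_right] at this

end GradedCech

namespace GradedCech

open Filter IsLocalRing CategoryTheory CategoryTheory.Limits Topology

universe u

lemma disjoint_nhds_of_forall_not_specializes {X : Type*} [TopologicalSpace X] [CompactSpace X]
    [QuasiSober X] [PrespectralSpace X] [QuasiSeparatedSpace X] {u v : X}
    (h : ∀ x, x ⤳ u → ¬ x ⤳ v) : Disjoint (𝓝 u) (𝓝 v) := by
  by_contra hd
  rw [disjoint_iff] at hd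
  have : NeBot (𝓝 u ⊓ 𝓝 v) := ⟨hd⟩
  obtain ⟨y, hy⟩ := exists_clusterPt_of_compactSpace
    ((𝓝 u ⊓ 𝓝 v).map (WithTopology.toTopology (constructibleTopology X)))
  have key (N : Set X) (hNo : IsOpen N) (hNc : IsCompact N) (hN : N ∈ 𝓝 u ⊓ 𝓝 v) :
      y.ofTopology ∈ N := by
    have hcl : IsClosed (WithTopology.ofTopology ⁻¹' N : Set (WithConstructibleTopology X)) := by
      rw [← isOpen_compl_iff, WithConstructibleTopology.isOpen_iff]
      refine IsCompact.isOpen_constructibleTopology_of_isClosed (s := Nᶜ) ?_ hNo.isClosed_compl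
      rwa [compl_compl]
    have : y ∈ closure (WithTopology.ofTopology ⁻¹' N : Set (WithConstructibleTopology X)) :=
      mem_closure_iff_clusterPt.mpr (hy.mono (le_principal_iff.mpr hN))
    rwa [hcl.closure_eq] at this
  have key' (w : X) (hw : 𝓝 u ⊓ 𝓝 v ≤ 𝓝 w) : y.ofTopology ⤳ w := by
    rw [specializes_iff_forall_open]
    intro N hNo hwN
    obtain ⟨N', ⟨hN'o, hN'c⟩, hwN', hN'N⟩ :=
      PrespectralSpace.isTopologicalBasis.exists_subset_of_mem_open hwN hNo
    exact hN'N (key N' hN'o hN'c (hw (hN'o.mem_nhds hwN')))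
  exact h _ (key' u inf_le_left) (key' v inf_le_right)

lemma separatedNhds_of_forall_not_specializes {X : Type*} [TopologicalSpace X] [CompactSpace X]
    [QuasiSober X] [PrespectralSpace X] [QuasiSeparatedSpace X] {Y Z : Set X}
    (hY : IsCompact Y) (hZ : IsCompact Z)
    (h : ∀ u ∈ Y, ∀ v ∈ Z, ∀ x, x ⤳ u → ¬ x ⤳ v) : SeparatedNhds Y Z := by
  rw [separatedNhds_iff_disjoint, hY.disjoint_nhdsSet_left]
  intro u hu
  rw [hZ.disjoint_nhdsSet_right]
  exact fun v hv ↦ disjoint_nhds_of_forall_not_specializes (h u hu v hv)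

lemma eq_bot_or_eq_bot_of_surjective {R : Type*} [CommRing R] [IsLocalRing R] {X : Scheme.{u}}
    (σ : R →+* Γ(X, ⊤)) (hσ : Function.Surjective σ) {U V : X.Opens} (hUV : U ⊔ V = ⊤)
    (hd : U ⊓ V = ⊥) : U = ⊥ ∨ V = ⊥ := by
  let W : Bool → X.Opens := fun b ↦ cond b U V
  let s : ∀ b, Γ(X, W b) := fun b ↦ Bool.rec 0 1 b
  have hcompat : X.presheaf.IsCompatible W s := by
    have hsub {O : X.Opens} (hO : O = ⊥) : Subsingleton Γ(X, O) := by
      subst hO; exact inferInstance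
    rintro (_ | _) (_ | _)
    · rfl
    · have := hsub ((inf_comm V U).trans hd)
      exact Subsingleton.elim (α := Γ(X, V ⊓ U)) _ _
    · have := hsub hd
      exact Subsingleton.elim (α := Γ(X, U ⊓ V)) _ _
    · rfl
  obtain ⟨e, he, -⟩ := X.sheaf.existsUnique_gluing' W ⊤ (fun b ↦ homOfLE le_top)
    (by rw [← hUV]; exact sup_le (le_iSup W true) (le_iSup W false)) s hcompat
  have hz {O : X.Opens} {a : Γ(X, ⊤)} (ha : IsUnit a)
      (h0 : X.presheaf.map (homOfLE (le_top : O ≤ ⊤)).op a = 0) : O = ⊥ := by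
    have h1 := ha.map (X.presheaf.map (homOfLE (le_top : O ≤ ⊤)).op).hom
    rw [h0, isUnit_zero_iff] at h1
    have := X.basicOpen_of_isUnit (U := O) (f := 1) isUnit_one
    rw [← h1, Scheme.basicOpen_zero] at this
    exact this.symm
  obtain ⟨a, rfl⟩ := hσ e
  obtain h | h := IsLocalRing.isUnit_or_isUnit_one_sub_self a
  · exact .inr (hz (h.map σ) (he false))
  · refine .inl (hz (h.map σ) ?_)
    have := he true
    rw [map_sub, map_one, map_sub, map_one, sub_eq_zero]
    exact this.symm

variable {A : CommRingCat.{u}} [IsLocalRing A] {X : Scheme.{u}} {f : X ⟶ Spec A}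

lemma exists_dominates_of_specializes {x w : X} (h : x ⤳ w) (hw : f w = closedPoint A)
    {φ : A ⟶ X.residueField x} (hφ : X.fromSpecResidueField x ≫ f = Spec.map φ) :
    ∃ O : ValuationSubring (X.residueField x), (letI := φ.hom.toAlgebra; Dominates A O) ∧
      ∃ c : Spec (.of O) ⟶ X, genericPt O ≫ c = X.fromSpecResidueField x ∧
        c (closedPoint O) = w := by
  let g : X.presheaf.stalk w ⟶ X.residueField x := X.presheaf.stalkSpecializes h ≫ X.residue x
  obtain ⟨O, hO, hloc⟩ := exists_factor_valuationRing g.hom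
  let c : Spec (.of O) ⟶ X := Spec.map (CommRingCat.ofHom (g.hom.codRestrict O.toSubring hO)) ≫
    X.fromSpecStalk w
  have hc : genericPt O ≫ c = X.fromSpecResidueField x := by
    rw [Scheme.fromSpecResidueField, ← Scheme.SpecMap_stalkSpecializes_fromSpecStalk h,
      ← Spec.map_comp_assoc, ← Spec.map_comp_assoc]
    rfl
  have hcw : c (closedPoint O) = w := by
    have : Spec.map (CommRingCat.ofHom (g.hom.codRestrict O.toSubring hO)) (closedPoint O) =
        closedPoint (X.presheaf.stalk w) :=
      comap_closedPoint (S := O) (g.hom.codRestrict O.toSubring hO)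
    exact (congr(X.fromSpecStalk w $this)).trans X.fromSpecStalk_closedPoint
  obtain ⟨τ, hτ⟩ := Spec.map_surjective (c ≫ f)
  have hτφ (a : A) : (τ.hom a : X.residueField x) = φ.hom a := by
    have : Spec.map (τ ≫ CommRingCat.ofHom (algebraMap O (X.residueField x))) = Spec.map φ := by
      rw [Spec.map_comp, hτ, ← hφ, ← hc, Category.assoc]
      rfl
    exact congr($(Spec.map_injective this).hom a)
  let := φ.hom.toAlgebra
  refine ⟨O, ⟨fun a ↦ ?_, fun a ha ↦ ?_⟩, c, hc, hcw⟩
  · change φ.hom a ∈ O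
    rw [← hτφ]
    exact (τ.hom a).2
  · change O.valuation (φ.hom a) < 1
    rw [← hτφ]
    refine (ValuationSubring.valuation_lt_one_iff O _).mp ?_
    have : PrimeSpectrum.comap τ.hom (closedPoint O) = closedPoint A := by
      rw [← hw, ← hcw]
      exact congr($hτ (closedPoint O))
    have ha' : a ∈ (PrimeSpectrum.comap τ.hom (closedPoint O)).asIdeal := by rwa [this]
    exact ha'

theorem isPreconnected_preimage_closedPoint [IsProper f]
    (hA : ∀ (K : Type u) [Field K] (φ : A →+* K) (x : K), φ.IsIntegralElem x → x ∈ Set.range φ)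
    {R : Type*} [CommRing R] [IsLocalRing R] (σ : R →+* Γ(X, ⊤)) (hσ : Function.Surjective σ) :
    _root_.IsPreconnected (f ⁻¹' {closedPoint A}) := by
  intro U V hU hV hUV hnU hnV
  by_contra hne
  rw [Set.not_nonempty_iff_eq_empty] at hne
  have : CompactSpace X := QuasiCompact.compactSpace_of_compactSpace f
  have : QuasiSeparatedSpace X := by
    have : QuasiSeparated f := inferInstance
    exact quasiSeparatedSpace_of_quasiSeparated f
  have hcl : IsClosed (f ⁻¹' {closedPoint A}) :=
    (isClosed_singleton_closedPoint A).preimage f.continuous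
  have hcU : IsCompact (f ⁻¹' {closedPoint A} ∩ U) := by
    have : f ⁻¹' {closedPoint A} ∩ U = f ⁻¹' {closedPoint A} ∩ Vᶜ := by
      ext x
      have h1 := @hUV x
      have h2 := Set.eq_empty_iff_forall_notMem.mp hne x
      simp only [Set.mem_inter_iff, Set.mem_union, Set.mem_compl_iff] at h1 h2 ⊢
      tauto
    rw [this]
    exact (hcl.inter hV.isClosed_compl).isCompact
  have hcV : IsCompact (f ⁻¹' {closedPoint A} ∩ V) := by
    have : f ⁻¹' {closedPoint A} ∩ V = f ⁻¹' {closedPoint A} ∩ Uᶜ := by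
      ext x
      have h1 := @hUV x
      have h2 := Set.eq_empty_iff_forall_notMem.mp hne x
      simp only [Set.mem_inter_iff, Set.mem_union, Set.mem_compl_iff] at h1 h2 ⊢
      tauto
    rw [this]
    exact (hcl.inter hU.isClosed_compl).isCompact
  obtain ⟨N, N', hN, hN', hUN, hVN, hd⟩ := separatedNhds_of_forall_not_specializes hcU hcV
    (fun u hu v hv x hxu hxv ↦ by
      obtain ⟨φ, hφ⟩ := Spec.map_surjective (X.fromSpecResidueField x ≫ f)
      obtain ⟨P, hP, c, hc, rfl⟩ := exists_dominates_of_specializes hxu hu.1 hφ.symm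
      obtain ⟨Q, hQ, d, hd, rfl⟩ := exists_dominates_of_specializes hxv hv.1 hφ.symm
      exact false_of_dominates (K := X.residueField x) hφ.symm
        (hA (X.residueField x) φ.hom) hU hV hUV hne hP hQ hc hu.2 hd hv.2)
  have hcov (x : X) : x ∈ N ∨ x ∈ N' := by
    have hm : closedPoint A ∈ f '' closure {x} := by
      have : IsClosed (f '' closure {x}) := f.isClosedMap _ isClosed_closure
      exact (specializes_closedPoint (f x)).mem_closed this ⟨x, subset_closure rfl, rfl⟩
    obtain ⟨y, hy, hyA⟩ := hm
    have hxy : x ⤳ y := specializes_iff_mem_closure.mpr hy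
    obtain h | h := hUV hyA
    · exact .inl (hxy.mem_open hN (hUN ⟨hyA, h⟩))
    · exact .inr (hxy.mem_open hN' (hVN ⟨hyA, h⟩))
  obtain h | h := eq_bot_or_eq_bot_of_surjective σ hσ (U := ⟨N, hN⟩) (V := ⟨N', hN'⟩)
    (TopologicalSpace.Opens.ext (Set.eq_univ_of_forall hcov))
    (TopologicalSpace.Opens.ext (Set.disjoint_iff_inter_eq_empty.mp hd))
  · obtain ⟨x, hx⟩ := hnU
    exact (congr(x ∈ $h).mp (hUN hx) : x ∈ (⊥ : X.Opens))
  · obtain ⟨x, hx⟩ := hnV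
    exact (congr(x ∈ $h).mp (hVN hx) : x ∈ (⊥ : X.Opens))

end GradedCech

namespace GradedCech

open IsLocalRing

universe u

section Splitting

open Polynomial

lemma exists_split_extension (n : ℕ) : ∀ {C R : Type u} [CommRing C] [CommRing R] (β : C →+* R)
    (g : C[X]) (_ : g.Monic) (_ : Nontrivial C → g.natDegree = n) (x : Fin n → R)
    (_ : g.map β = ∏ i, (X - .C (x i))),
    ∃ (C' : Type u) (_ : CommRing C') (ι : C →+* C') (β' : C' →+* R) (x' : Fin n → C'),
      ι.Flat ∧ β'.comp ι = β ∧ (∀ i, β' (x' i) = x i) ∧ g.map ι = ∏ i, (X - .C (x' i)) := by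
  induction n with
  | zero =>
    intro C R _ _ β g hg hn x hx
    refine ⟨C, inferInstance, .id C, β, Fin.elim0, .id C, β.comp_id, fun i ↦ i.elim0, ?_⟩
    rcases subsingleton_or_nontrivial C with hC | hC
    · simp [Subsingleton.elim g 1]
    · simp [eq_one_of_monic_natDegree_zero hg (hn hC)]
  | succ n ih =>
    intro C R _ _ β g hg hn x hx
    rcases subsingleton_or_nontrivial C with hC | hC
    · have := β.codomain_trivial
      refine ⟨C, inferInstance, .id C, β, fun _ ↦ 0, .id C, β.comp_id,
        fun i ↦ Subsingleton.elim _ _, Subsingleton.elim _ _⟩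
    replace hn := hn hC
    have hfree := hg.free_adjoinRoot
    have hroot : g.eval₂ β (x 0) = 0 := by
      rw [← eval_map, hx, eval_prod]
      exact Finset.prod_eq_zero (Finset.mem_univ 0) (by simp)
    let β₁ : AdjoinRoot g →+* R := AdjoinRoot.lift β (x 0) hroot
    have hβ₁ : β₁.comp (AdjoinRoot.of g) = β := AdjoinRoot.lift_comp_of _
    have : Nonempty (Fin g.natDegree) := ⟨⟨0, by lia⟩⟩
    have : Nontrivial (AdjoinRoot g) :=
      (AdjoinRoot.powerBasisAux' hg).repr.toEquiv.nontrivial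
    let r : AdjoinRoot g := AdjoinRoot.root g
    let g' := (g.map (AdjoinRoot.of g)) /ₘ (X - .C r)
    have hgg' : (X - .C r) * g' = g.map (AdjoinRoot.of g) :=
      mul_divByMonic_eq_iff_isRoot.mpr (AdjoinRoot.isRoot_root g)
    have hg' : g'.Monic := (monic_X_sub_C r).of_mul_monic_left (hgg' ▸ hg.map _)
    have hn' : g'.natDegree = n := by
      have := congr_arg natDegree hgg'
      rw [(monic_X_sub_C r).natDegree_mul hg', hg.natDegree_map, hn, natDegree_X_sub_C] at this
      lia
    have hx' : g'.map β₁ = ∏ i, (X - .C (Fin.tail x i)) := by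
      have := congr_arg (map β₁) hgg'
      rw [map_map, hβ₁, hx, Fin.prod_univ_succ, Polynomial.map_mul, Polynomial.map_sub, map_X,
        map_C, AdjoinRoot.lift_root] at this
      exact (monic_X_sub_C (x 0)).isRegular.left this
    obtain ⟨C', _, ι, β', x', hι, hβ', hxx', hg'x⟩ := ih β₁ g' hg' (fun _ ↦ hn') (Fin.tail x) hx'
    refine ⟨C', inferInstance, ι.comp (AdjoinRoot.of g), β', Fin.cons (ι r) x', ?_, ?_, ?_, ?_⟩
    · refine RingHom.Flat.comp ?_ hι
      have : (algebraMap C (AdjoinRoot g)).Flat := by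
        rw [RingHom.flat_algebraMap_iff]; infer_instance
      exact this
    · rw [← RingHom.comp_assoc, hβ', hβ₁]
    · refine Fin.cases ?_ fun i ↦ ?_
      · rw [Fin.cons_zero, ← RingHom.comp_apply, hβ']
        exact AdjoinRoot.lift_root _
      · rw [Fin.cons_succ, hxx']
        rfl
    · rw [Fin.prod_univ_succ, ← map_map, ← hgg', Polynomial.map_mul, hg'x]
      simp

variable (A : Type u) [CommRing A]

/-- Indices for the formal roots of all monic polynomials over `A`. -/
abbrev RootIndex : Type u := Σ g : {g : A[X] // g.Monic}, Fin g.1.natDegree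

/-- The difference between `g` and the product of its formal linear factors. -/
noncomputable def splitDefect (g : {g : A[X] // g.Monic}) : (MvPolynomial (RootIndex A) A)[X] :=
  g.1.map MvPolynomial.C - ∏ i, (X - .C (MvPolynomial.X (⟨g, i⟩ : RootIndex A)))

/-- The relations expressing that every monic polynomial is the product of its formal linear
factors. -/
noncomputable def splitIdeal : Ideal (MvPolynomial (RootIndex A) A) :=
  Ideal.span {p | ∃ g k, (splitDefect A g).coeff k = p}

/-- The universal algebra over `A` in which every monic polynomial splits. -/
abbrev UnivSplit : Type u := MvPolynomial (RootIndex A) A ⧸ splitIdeal A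

lemma map_splitDefect {C : Type*} [CommRing C] (ev : MvPolynomial (RootIndex A) A →+* C)
    (g : {g : A[X] // g.Monic}) : (splitDefect A g).map ev =
      g.1.map (ev.comp MvPolynomial.C) - ∏ i, (X - .C (ev (MvPolynomial.X ⟨g, i⟩))) := by
  simp [splitDefect, Polynomial.map_prod, Polynomial.map_map]

lemma map_splitDefect_mk (g : {g : A[X] // g.Monic}) :
    (splitDefect A g).map (Ideal.Quotient.mk (splitIdeal A)) = 0 := by
  ext k
  rw [coeff_map, coeff_zero, Ideal.Quotient.eq_zero_iff_mem]
  exact Ideal.subset_span ⟨g, k, rfl⟩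

lemma map_eq_prod_univSplit (g : {g : A[X] // g.Monic}) :
    g.1.map (algebraMap A (UnivSplit A)) =
      ∏ i, (X - .C (Ideal.Quotient.mk (splitIdeal A) (MvPolynomial.X ⟨g, i⟩))) := by
  have := map_splitDefect_mk A g
  rw [map_splitDefect, sub_eq_zero] at this
  exact this

lemma exists_flat_approximation (G : Finset {g : A[X] // g.Monic}) :
    ∃ (C : Type u) (_ : CommRing C) (ev : MvPolynomial (RootIndex A) A →+* C)
      (β : C →+* UnivSplit A), (ev.comp MvPolynomial.C).Flat ∧
        β.comp ev = Ideal.Quotient.mk (splitIdeal A) ∧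
        ∀ g ∈ G, (splitDefect A g).map ev = 0 := by
  classical
  induction G using Finset.induction_on with
  | empty =>
    refine ⟨_, inferInstance, .id _, Ideal.Quotient.mk _, ?_, RingHom.comp_id _, by simp⟩
    rw [RingHom.id_comp]
    have : (algebraMap A (MvPolynomial (RootIndex A) A)).Flat := by
      rw [RingHom.flat_algebraMap_iff]; infer_instance
    exact this
  | insert g G hgG ih =>
    obtain ⟨C, _, ev, β, hfl, hβ, hG⟩ := ih
    obtain ⟨C', _, ι, β', x', hι, hβ', hx', hgx⟩ := exists_split_extension g.1.natDegree β
      (g.1.map (ev.comp MvPolynomial.C)) (g.2.map _) (fun _ ↦ g.2.natDegree_map _)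
      (fun i ↦ Ideal.Quotient.mk (splitIdeal A) (MvPolynomial.X ⟨g, i⟩)) (by
        rw [map_map, ← RingHom.comp_assoc, hβ]
        exact map_eq_prod_univSplit A g)
    let c : RootIndex A → C' := fun p ↦
      if h : p.1 = g then x' (Fin.cast (by rw [h]) p.2) else ι (ev (MvPolynomial.X p))
    let ev' : MvPolynomial (RootIndex A) A →+* C' :=
      MvPolynomial.eval₂Hom (ι.comp (ev.comp MvPolynomial.C)) c
    have hev'C : ev'.comp MvPolynomial.C = ι.comp (ev.comp MvPolynomial.C) := by
      ext a; simp [ev']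
    have hev'X (p) : ev' (MvPolynomial.X p) = c p := MvPolynomial.eval₂Hom_X' _ _ _
    refine ⟨C', inferInstance, ev', β', hev'C ▸ hfl.comp hι, ?_, fun h hh ↦ ?_⟩
    · refine MvPolynomial.ringHom_ext' ?_ fun p ↦ ?_
      · rw [RingHom.comp_assoc, hev'C, ← RingHom.comp_assoc, hβ', ← RingHom.comp_assoc, hβ]
      · rw [RingHom.comp_apply, hev'X]
        obtain ⟨h, i⟩ := p
        by_cases hg : h = g
        · subst hg
          simp [c, hx']
        · simp only [c, hg, dif_neg, not_false_eq_true]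
          rw [← RingHom.comp_apply, hβ', ← RingHom.comp_apply, hβ]
    · rw [map_splitDefect, hev'C]
      simp only [hev'X]
      by_cases hg : h = g
      · subst hg
        rw [← map_map, hgx]
        simp [c]
      · have := congr_arg (map ι) (hG h (Finset.mem_of_mem_insert_of_ne hh hg))
        rw [map_splitDefect, Polynomial.map_sub, map_map, Polynomial.map_prod,
          Polynomial.map_zero] at this
        simpa [c, hg] using this

lemma flat_of_forall_exists_flat {A P U : Type u} [CommRing A] [CommRing P] [CommRing U]
    [Algebra A U] (c : A →+* P) (q : P →+* U) (hq : Function.Surjective q)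
    (hqc : q.comp c = algebraMap A U)
    (H : ∀ p, q p = 0 → ∃ (C : Type u) (_ : CommRing C) (ev : P →+* C) (β : C →+* U),
      (ev.comp c).Flat ∧ β.comp ev = q ∧ ev p = 0) : Module.Flat A U := by
  refine Module.Flat.of_forall_isTrivialRelation fun {l a r} h ↦ ?_
  choose p hp using fun i ↦ hq (r i)
  obtain ⟨C, _, ev, β, hfl, hβ, hev⟩ := H (∑ i, c (a i) * p i) (by
    rw [← h, map_sum]
    refine Finset.sum_congr rfl fun i _ ↦ ?_
    rw [map_mul, hp, Algebra.smul_def, ← hqc, RingHom.comp_apply])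
  let := (ev.comp c).toAlgebra
  have : Module.Flat A C := hfl
  have hrel : ∑ i, a i • ev (p i) = 0 := by
    rw [← hev, map_sum]
    refine Finset.sum_congr rfl fun i _ ↦ ?_
    rw [map_mul]
    rfl
  obtain ⟨k, b, y, hy, hb⟩ :=
    Module.Flat.isTrivialRelation_of_sum_smul_eq_zero (R := A) (M := C) hrel
  refine ⟨k, b, fun j ↦ β (y j), fun i ↦ ?_, hb⟩
  rw [← hp i, ← hβ, RingHom.comp_apply, show ev (p i) = _ from hy i, map_sum]
  refine Finset.sum_congr rfl fun j _ ↦ ?_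
  rw [Algebra.smul_def, Algebra.smul_def, map_mul, ← hqc, ← hβ]
  rfl

instance flat_univSplit : Module.Flat A (UnivSplit A) := by
  classical
  refine flat_of_forall_exists_flat MvPolynomial.C (Ideal.Quotient.mk (splitIdeal A))
    Ideal.Quotient.mk_surjective rfl fun p hp ↦ ?_
  rw [Ideal.Quotient.eq_zero_iff_mem] at hp
  obtain ⟨S, hS, hmem⟩ := Submodule.mem_span_finite_of_mem_span hp
  have : Nonempty {g : A[X] // g.Monic} := ⟨1, monic_one⟩
  choose! γ hγ using fun p (hp : p ∈ S) ↦ hS hp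
  obtain ⟨C, _, ev, β, hfl, hβ, hG⟩ := exists_flat_approximation A (S.image γ)
  refine ⟨C, inferInstance, ev, β, hfl, hβ, ?_⟩
  have hker : Ideal.span (S : Set (MvPolynomial (RootIndex A) A)) ≤ RingHom.ker ev := by
    rw [Ideal.span_le]
    intro p hp
    obtain ⟨k, hk⟩ := hγ p hp
    have := congr_arg (coeff · k) (hG _ (Finset.mem_image_of_mem γ hp))
    simp only [coeff_map, coeff_zero, hk] at this
    exact this
  exact hker hmem

end Splitting

section Splitting

open Polynomial

lemma exists_eq_prod_of_isAlgClosed {K : Type*} [Field K] [IsAlgClosed K] (g : K[X])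
    (hg : g.Monic) (n : ℕ) (hn : g.natDegree = n) : ∃ x : Fin n → K, g = ∏ i, (X - .C (x i)) := by
  have hs := IsAlgClosed.splits g
  have hcard : g.roots.toList.length = n := by
    rw [Multiset.length_toList, ← hn, hs.natDegree_eq_card_roots]
  subst hcard
  refine ⟨fun i ↦ g.roots.toList[i], ?_⟩
  conv_lhs => rw [hs.eq_prod_roots_of_monic hg]
  conv_lhs => rw [← Multiset.coe_toList g.roots]
  rw [Multiset.map_coe, Multiset.prod_coe, ← List.prod_ofFn]
  congr 1
  refine List.ext_getElem (by simp) fun i h₁ h₂ ↦ by simp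

variable (A : Type u) [CommRing A]

instance isIntegral_univSplit : Algebra.IsIntegral A (UnivSplit A) := by
  refine ⟨fun u ↦ ?_⟩
  obtain ⟨p, rfl⟩ := Ideal.Quotient.mk_surjective u
  induction p using MvPolynomial.induction_on with
  | C a => exact isIntegral_algebraMap (R := A) (A := UnivSplit A) (x := a)
  | add p q hp hq => rw [map_add]; exact hp.add hq
  | mul_X p i hp =>
    rw [map_mul]
    refine hp.mul ⟨i.1.1, i.1.2, ?_⟩
    rw [← eval_map, map_eq_prod_univSplit, eval_prod]
    exact Finset.prod_eq_zero (Finset.mem_univ i.2) (by simp)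

lemma exists_lift_univSplit {K : Type*} [Field K] [IsAlgClosed K] (φ : A →+* K) :
    ∃ ψ : UnivSplit A →+* K, ψ.comp (algebraMap A (UnivSplit A)) = φ := by
  choose x hx using fun g : {g : A[X] // g.Monic} ↦ exists_eq_prod_of_isAlgClosed (g.1.map φ)
    (g.2.map φ) g.1.natDegree (g.2.natDegree_map φ)
  let ev : MvPolynomial (RootIndex A) A →+* K := MvPolynomial.eval₂Hom φ fun p ↦ x p.1 p.2
  have hev : ev.comp MvPolynomial.C = φ := by ext a; simp [ev]
  have hle : ∀ a ∈ splitIdeal A, ev a = 0 := by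
    have : splitIdeal A ≤ RingHom.ker ev := by
      refine Ideal.span_le.mpr ?_
      rintro _ ⟨g, k, rfl⟩
      have : (splitDefect A g).map ev = 0 := by
        rw [map_splitDefect, hev, sub_eq_zero, hx]
        simp [ev]
      have := congr_arg (coeff · k) this
      simp only [coeff_map, coeff_zero] at this
      exact this
    exact this
  exact ⟨Ideal.Quotient.lift _ ev hle, hev⟩

lemma mem_range_of_isIntegralElem {A U B K : Type*} [CommRing A] [CommRing U] [CommRing B]
    [Field K] [Algebra A U] [Algebra.IsIntegral A U] [Algebra U B] (M : Submonoid U)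
    [IsLocalization M B] (hU : ∀ g : A[X], g.Monic →
      ∃ c : Fin g.natDegree → U, g.map (algebraMap A U) = ∏ i, (X - .C (c i)))
    (ψ : B →+* K) (x : K) (hx : ψ.IsIntegralElem x) : x ∈ Set.range ψ := by
  let := ψ.toAlgebra
  let := (ψ.comp (algebraMap U B)).toAlgebra
  let := ((ψ.comp (algebraMap U B)).comp (algebraMap A U)).toAlgebra
  have : IsScalarTower U B K := .of_algebraMap_eq fun _ ↦ rfl
  have : IsScalarTower A U K := .of_algebraMap_eq fun _ ↦ rfl
  obtain ⟨m, hm⟩ := IsIntegral.exists_multiple_integral_of_isLocalization (R := U) (Rₘ := B) M x hx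
  obtain ⟨g, hg, hgx⟩ : IsIntegral A (m • x) := isIntegral_trans (A := U) _ hm
  obtain ⟨c, hc⟩ := hU g hg
  rw [IsScalarTower.algebraMap_eq A U K, ← eval_map, ← map_map, hc, Polynomial.map_prod,
    eval_prod, Finset.prod_eq_zero_iff] at hgx
  obtain ⟨i, -, hi⟩ := hgx
  rw [Polynomial.map_sub, map_X, map_C, eval_sub, eval_X, eval_C, sub_eq_zero] at hi
  obtain ⟨v, hv⟩ := IsLocalization.map_units B m
  refine ⟨↑v⁻¹ * algebraMap U B (c i), ?_⟩
  rw [map_mul]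
  change _ * algebraMap U K (c i) = x
  rw [← hi, Submonoid.smul_def, Algebra.smul_def]
  change _ * (ψ (algebraMap U B m) * x) = x
  rw [← hv, ← mul_assoc, ← map_mul, Units.inv_mul, map_one, one_mul]

theorem exists_flat_local_integrallyClosed [IsLocalRing A] :
    ∃ (B : Type u) (_ : CommRing B) (_ : IsLocalRing B) (φ : A →+* B),
      φ.Flat ∧ IsLocalHom φ ∧ ∀ (K : Type u) [Field K] (ψ : B →+* K) (x : K),
        ψ.IsIntegralElem x → x ∈ Set.range ψ := by
  obtain ⟨χ, hχ⟩ := exists_lift_univSplit A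
    ((algebraMap (ResidueField A) (AlgebraicClosure (ResidueField A))).comp (residue A))
  let q : Ideal (UnivSplit A) := RingHom.ker χ
  have hq : q.IsPrime := RingHom.ker_isPrime χ
  let B := Localization.AtPrime q
  have hfl : Module.Flat A B :=
    have := IsLocalization.flat B q.primeCompl
    Module.Flat.trans A (UnivSplit A) B
  refine ⟨B, inferInstance, inferInstance, algebraMap A B, ?_, ⟨fun a ha ↦ ?_⟩, ?_⟩
  · rwa [RingHom.flat_algebraMap_iff]
  · by_contra h
    rw [← mem_nonunits_iff, ← IsLocalRing.mem_maximalIdeal, ← residue_eq_zero_iff] at h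
    rw [IsScalarTower.algebraMap_apply A (UnivSplit A) B,
      IsLocalization.AtPrime.isUnit_to_map_iff B q] at ha
    apply ha
    change χ (algebraMap A _ a) = 0
    rw [← RingHom.comp_apply, hχ, RingHom.comp_apply, h, map_zero]
  · exact fun K _ ψ x hx ↦ mem_range_of_isIntegralElem (A := A) q.primeCompl
      (fun g hg ↦ ⟨_, map_eq_prod_univSplit A ⟨g, hg⟩⟩) ψ x hx

end Splitting

end GradedCech

namespace GradedCech

open IsLocalRing CategoryTheory CategoryTheory.Limits TopologicalSpace

universe u

section Descent

lemma surjective_of_isPushout {R G A B : CommRingCat.{u}} {a : R ⟶ G} {b : R ⟶ A} {c : G ⟶ B}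
    {d : A ⟶ B} (h : IsPushout a b c d) (hc : ∀ g, ∃ r, d r = c g) :
    Function.Surjective d := by
  intro x
  have hx : x ∈ Subring.closure (Set.range c ∪ Set.range d) := by
    rw [CommRingCat.closure_range_union_range_eq_top_of_isPushout h]
    trivial
  have hle : Subring.closure (Set.range c ∪ Set.range d) ≤ d.hom.range := by
    rw [Subring.closure_le]
    rintro _ (⟨g, rfl⟩ | ⟨r, rfl⟩)
    · exact hc g
    · exact ⟨r, rfl⟩
  exact hle hx

lemma exists_app_eq_of_stalk_surjective {M N : Scheme.{u}} (f : M ⟶ N) (y : N)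
    (hsurj : Function.Surjective
      ((TopCat.Presheaf.stalkFunctor CommRingCat y).map f.toPshHom.c)) (W : N.Opens) (hy : y ∈ W)
    (g : Γ(M, f ⁻¹ᵁ W)) : ∃ (V : N.Opens) (hVW : V ≤ W) (_ : y ∈ V) (s : Γ(N, V)),
      f.app V s = M.presheaf.map (homOfLE (f.preimage_mono hVW)).op g := by
  obtain ⟨a, ha⟩ := hsurj (TopCat.Presheaf.germ (f.toPshHom.base _* M.presheaf) W y hy g)
  obtain ⟨V, hyV, s, rfl⟩ := TopCat.Presheaf.exists_germ_eq _ a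
  rw [TopCat.Presheaf.stalkFunctor_map_germ_apply] at ha
  obtain ⟨V', hyV', i, j, h⟩ := TopCat.Presheaf.germ_eq _ y _ _ _ _ ha
  refine ⟨V', j.le, hyV', N.presheaf.map i.op s, ?_⟩
  refine Eq.trans ?_ h
  exact congr($(f.toPshHom.c.naturality i.op).hom s)

lemma flat_fromSpecStalk (N : Scheme.{u}) (y : N) : Flat (N.fromSpecStalk y) := by
  obtain ⟨U, hU, hyU, -⟩ := Opens.isBasis_iff_nbhd.mp N.isBasis_affineOpens (Opens.mem_top y)
  rw [← IsAffineOpen.fromSpecStalk_eq_fromSpecStalk hU hyU]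
  have : Flat (Spec.map (N.presheaf.germ U y hyU)) := by
    rw [Flat.SpecMap_iff]
    algebraize [(N.presheaf.germ U y hyU).hom]
    have := hU.isLocalization_stalk ⟨y, hyU⟩
    exact IsLocalization.flat _ (hU.primeIdealOf ⟨y, hyU⟩).asIdeal.primeCompl
  have : IsOpenImmersion hU.fromSpec := IsAffineOpen.isOpenImmersion_fromSpec hU
  exact Flat.comp (Spec.map (N.presheaf.germ U y hyU)) hU.fromSpec

lemma surjective_appTop_of_stalk_surjective {M N P T : Scheme.{u}} {f : M ⟶ N} [QuasiCompact f]
    [QuasiSeparated f] [IsAffine T] {j : T ⟶ N} [Flat j] {p : P ⟶ M} {q : P ⟶ T}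
    (H : IsPullback p q f j) (y : N) (hj : ∀ V : N.Opens, y ∈ V → j ⁻¹ᵁ V = ⊤)
    (hsurj : Function.Surjective
      ((TopCat.Presheaf.stalkFunctor CommRingCat y).map f.toPshHom.c)) :
    Function.Surjective q.appTop := by
  obtain ⟨W, hW, hyW, -⟩ := Opens.isBasis_iff_nbhd.mp N.isBasis_affineOpens (Opens.mem_top y)
  have hp (V : N.Opens) (hV : y ∈ V) : p ⁻¹ᵁ (f ⁻¹ᵁ V) = ⊤ := by
    rw [← Scheme.Hom.comp_preimage, H.w, Scheme.Hom.comp_preimage, hj V hV]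
    rfl
  have hpush := (isIso_pushoutSection_iff H (US := W) (UT := ⊤) (UX := f ⁻¹ᵁ W) (UY := ⊤)
    (hj W hyW).ge le_rfl (by rw [hp W hyW]; exact (inf_top_eq _).symm)).mp
    (isIso_pushoutSection_of_isQuasiSeparated_of_flat_right H _ _ _ hW (isAffineOpen_top T)
      (f.isCompact_preimage hW.isCompact) (f.isQuasiSeparated_preimage hW.isQuasiSeparated))
  have := surjective_of_isPushout hpush fun g ↦ ?_
  · rw [show q.appTop = q.appLE ⊤ ⊤ le_rfl from Scheme.Hom.app_eq_appLE q]
    exact this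
  obtain ⟨V, hVW, hyV, s, hs⟩ := exists_app_eq_of_stalk_surjective f y hsurj W hyW g
  refine ⟨j.appLE V ⊤ (hj V hyV).ge s, ?_⟩
  have h₁ : (M.presheaf.map (homOfLE (f.preimage_mono hVW)).op ≫
      p.appLE (f ⁻¹ᵁ V) ⊤ (hp V hyV).ge) g = p.appLE (f ⁻¹ᵁ W) ⊤ (hp W hyW).ge g :=
    congr($(Scheme.Hom.map_appLE p (hp V hyV).ge (homOfLE (f.preimage_mono hVW)).op).hom g)
  refine Eq.trans ?_ h₁
  rw [CommRingCat.comp_apply, ← hs, ← CommRingCat.comp_apply, ← CommRingCat.comp_apply,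
    Scheme.Hom.app_eq_appLE, Scheme.Hom.appLE_comp_appLE, Scheme.Hom.appLE_comp_appLE]
  simp only [H.w]

theorem isPreconnected_fiber_of_stalk_surjective {M N : Scheme.{u}} (f : M ⟶ N) [IsProper f]
    (y : N) (hsurj : Function.Surjective
      ((TopCat.Presheaf.stalkFunctor CommRingCat y).map f.toPshHom.c)) :
    _root_.IsPreconnected (f ⁻¹' {y}) := by
  obtain ⟨B, _, _, φ, hφ, hloc, hB⟩ := exists_flat_local_integrallyClosed (N.presheaf.stalk y)
  let j : Spec (.of B) ⟶ N := Spec.map (CommRingCat.ofHom φ) ≫ N.fromSpecStalk y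
  have hφ' : Flat (Spec.map (CommRingCat.ofHom φ)) := by rwa [Flat.SpecMap_iff]
  have := flat_fromSpecStalk N y
  have hj : Flat j := inferInstanceAs (Flat (_ ≫ _))
  have hjy : j (closedPoint B) = y := by
    have h : Spec.map (CommRingCat.ofHom φ) (closedPoint B) = closedPoint (N.presheaf.stalk y) :=
      comap_closedPoint φ
    change N.fromSpecStalk y (Spec.map (CommRingCat.ofHom φ) (closedPoint B)) = y
    rw [h, Scheme.fromSpecStalk_closedPoint]
  have hjV (V : N.Opens) (hV : y ∈ V) : j ⁻¹ᵁ V = ⊤ := by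
    rw [eq_top_iff]
    intro x _
    exact (specializes_closedPoint x).mem_open (j ⁻¹ᵁ V).2 (by
      change j (closedPoint B) ∈ V
      rwa [hjy])
  have hq := surjective_appTop_of_stalk_surjective (IsPullback.of_hasPullback f j) y hjV hsurj
  have hpre := isPreconnected_preimage_closedPoint (A := .of B) (f := pullback.snd f j) hB
    ((pullback.snd f j).appTop.hom.comp (Scheme.ΓSpecIso (.of B)).inv.hom)
    (hq.comp (Scheme.ΓSpecIso (.of B)).symm.commRingCatIsoToRingEquiv.surjective)
  convert! hpre.image (pullback.fst f j) (pullback.fst f j).continuous.continuousOn using 1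
  ext x
  constructor
  · intro hx
    obtain ⟨z, hz₁, hz₂⟩ := Scheme.Pullback.exists_preimage_pullback (f := f) (g := j) x
      (closedPoint B) (show f x = j (closedPoint B) from hx.trans hjy.symm)
    exact ⟨z, hz₂, hz₁⟩
  · rintro ⟨z, hz, rfl⟩
    change (pullback.fst f j ≫ f) z = y
    rw [pullback.condition]
    change j (pullback.snd f j z) = y
    rw [show pullback.snd f j z = closedPoint B from hz, hjy]

end Descent

end GradedCech

/-- Connectedness criterion: if `f : M → N` is a proper morphism (of schemes) such that
the natural map `O_N → f_*O_M` is surjective (i.e. surjective on all stalks), then every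
fiber of `f` is connected. -/
theorem fibers_connected_of_pushforward_structure_sheaf_surjective
    {M N : Scheme} (f : M ⟶ N) [IsProper f]
    (hsurj : ∀ y : N, Function.Surjective
      ((TopCat.Presheaf.stalkFunctor CommRingCat y).map f.toPshHom.c)) :
    ∀ y : N, IsPreconnected (f.base ⁻¹' {y}) := by
  exact fun y ↦ GradedCech.isPreconnected_fiber_of_stalk_surjective f y (hsurj y)
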